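/- Let S ⊆ ℝ² be any sun graph realization. Then for every basepoint x of UConf_3(S), the fundamental group π₁(UConf_3(S), x) is a free group of finite rank, i.e. isomorphic to FreeGroup (Fin k) for some k ∈ ℕ. -/

import Mathlib

/-- The relation identifying two injective tuples of points that differ by a
permutation of the coordinates. -/
def permRel (n : ℕ) (X : Type*) (f g : {f : Fin n → X // Function.Injective f}) : Prop :=
  ∃ σ : Equiv.Perm (Fin n), (f : Fin n → X) ∘ σ = (g : Fin n → X)

/-- The unordered configuration space of `n` points on `X`: the quotient of the
subspace of injective maps `Fin n → X` of the product space by the permutation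
action, with the quotient topology. -/
def UConf (n : ℕ) (X : Type*) [TopologicalSpace X] : Type _ :=
  Quot (permRel n X)

instance (n : ℕ) (X : Type*) [TopologicalSpace X] : TopologicalSpace (UConf n X) :=
  inferInstanceAs (TopologicalSpace (Quot (permRel n X)))

/-- The unit circle in `ℝ²`. -/
def unitCircle : Set (ℝ × ℝ) := {x : ℝ × ℝ | x.1 ^ 2 + x.2 ^ 2 = 1}

section FreeFundamentalGroups

open Topology unitInterval CategoryTheory

/-- An induction principle for homotopy classes of paths: a property that holds for the paths
lifting along a surjective local homeomorphism and is stable under concatenation always holds. -/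
theorem Path.Homotopic.Quotient.induction_of_isLocalHomeomorph {K X : Type*} [TopologicalSpace K]
    [TopologicalSpace X] {Ψ : K → X} (hΨ : IsLocalHomeomorph Ψ) (hsurj : Function.Surjective Ψ)
    {C : ∀ x y : X, Path.Homotopic.Quotient x y → Prop}
    (lifted : ∀ (u w : K) (p : Path u w),
      C (Ψ u) (Ψ w) (Path.Homotopic.Quotient.mk (p.map hΨ.continuous)))
    (trans : ∀ x y z (p : Path.Homotopic.Quotient x y) (q : Path.Homotopic.Quotient y z),
      C x y p → C y z q → C x z (p.trans q))
    {x y : X} (p : Path.Homotopic.Quotient x y) : C x y p := by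
  induction p using Path.Homotopic.Quotient.ind with | mk γ => ?_
  have lifted' : ∀ (u w : K) (p : Path u w) (x y : X) (hx : x = Ψ u) (hy : y = Ψ w),
      C x y (.mk ((p.map hΨ.continuous).cast hx hy)) := by
    rintro u w p _ _ rfl rfl
    exact lifted u w p
  have hΨ₂ := hΨ
  choose e he hΨe using hΨ₂
  obtain ⟨t, t0, tmono, ⟨N, hN⟩, ht⟩ := exists_monotone_Icc_subset_open_cover_unitInterval
    (c := fun u : K => γ ⁻¹' (e u).target)
    (fun u => (e u).open_target.preimage γ.continuous) (by
      intro s _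
      obtain ⟨u, hu⟩ := hsurj (γ s)
      refine Set.mem_iUnion.2 ⟨u, ?_⟩
      rw [Set.mem_preimage, ← hu, congrFun (hΨe u) u]
      exact (e u).map_source (he u))
  have step : ∀ n, C _ _ (.mk (γ.subpath (t n) (t (n + 1)))) := by
    intro n
    obtain ⟨u, hu⟩ := ht n
    have hr : ∀ s, γ.subpath (t n) (t (n + 1)) s ∈ (e u).target := by
      intro s
      have : γ.subpath (t n) (t (n + 1)) s ∈ Set.range (γ.subpath (t n) (t (n + 1))) := ⟨s, rfl⟩
      rw [Path.range_subpath_of_le _ _ _ (tmono n.le_succ)] at this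
      obtain ⟨s', hs', h⟩ := this
      rw [← h]
      exact hu hs'
    have hcont : Continuous fun s => (e u).symm (γ.subpath (t n) (t (n + 1)) s) :=
      (e u).continuousOn_symm.comp_continuous (γ.subpath _ _).continuous hr
    have key := lifted' _ _ (⟨⟨fun s => (e u).symm (γ.subpath (t n) (t (n + 1)) s), hcont⟩,
      rfl, rfl⟩ : Path _ _) (γ (t n)) (γ (t (n + 1)))
      (by simpa [hΨe u] using ((e u).right_inv (hr 0)).symm)
      (by simpa [hΨe u] using ((e u).right_inv (hr 1)).symm)
    convert key using 2
    ext s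
    simpa [hΨe u] using ((e u).right_inv (hr s)).symm
  have all : ∀ n, C _ _ (.mk (γ.subpath (t 0) (t n))) := by
    intro n
    induction n with
    | zero =>
      obtain ⟨u, hu⟩ := hsurj (γ (t 0))
      have key := lifted' u u (Path.refl u) _ _ hu.symm hu.symm
      convert key using 2
      ext s
      simp [hu]
    | succ n ih =>
      have := trans _ _ _ _ _ ih (step n)
      rwa [← Path.Homotopic.Quotient.mk_trans,
        Path.Homotopic.Quotient.eq.2 ⟨Path.Homotopy.subpathTransSubpath γ (t 0) (t n) (t (n + 1))⟩]
        at this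
  have := all N
  have cast : ∀ (a b : X) (ha : a = x) (hb : b = y), C a b (.mk (γ.cast ha hb)) →
      C x y (.mk γ) := by
    rintro a b rfl rfl h
    exact h
  have h1 : t N = 1 := hN N le_rfl
  rw [t0, h1, Path.subpath_zero_one] at this
  exact cast _ _ _ _ this

section Holonomy

variable {K X G : Type*} [TopologicalSpace K] [TopologicalSpace X] [Group G]
  [TopologicalSpace G] [DiscreteTopology G] {Ψ : K → X}

/-- The principal bundle obtained by gluing trivial bundles over the charts of a surjective local
homeomorphism along a locally constant cocycle of the form `(κ w)⁻¹ * κ u`. -/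
@[simps] noncomputable def coboundaryBundle (e : K → OpenPartialHomeomorph K X)
    (he : ∀ u, u ∈ (e u).source) (hΨe : ∀ u, Ψ = e u) (sec : X → K) (hsec : ∀ x, Ψ (sec x) = x)
    (κ : K → G) (hκ : ∀ u₀ w₀, Ψ u₀ = Ψ w₀ → ∀ᶠ z : K × K in 𝓝 (u₀, w₀), Ψ z.1 = Ψ z.2 →
      (κ z.1)⁻¹ * κ z.2 = (κ u₀)⁻¹ * κ w₀) : FiberBundleCore K X G where
  baseSet u := (e u).target
  isOpen_baseSet u := (e u).open_target
  indexAt := sec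
  mem_baseSet_at x := by
    have := (e (sec x)).map_source (he (sec x))
    rwa [← hΨe, hsec] at this
  coordChange u w x g := (κ ((e w).symm x))⁻¹ * κ ((e u).symm x) * g
  coordChange_self u x hx g := by simp
  continuousOn_coordChange u w := by
    refine ContinuousOn.mul ?_ continuousOn_snd
    have : ContinuousOn (fun x => (κ ((e w).symm x))⁻¹ * κ ((e u).symm x))
        ((e u).target ∩ (e w).target) := by
      intro x hx
      have h1 : ContinuousAt (fun x => ((e w).symm x, (e u).symm x)) x :=
        ((e w).continuousAt_symm hx.2).prodMk ((e u).continuousAt_symm hx.1)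
      have h2 : ∀ x' ∈ (e u).target ∩ (e w).target, Ψ ((e w).symm x') = Ψ ((e u).symm x') := by
        intro x' hx'
        nth_rw 1 [hΨe w]
        rw [hΨe u, (e u).right_inv hx'.1, (e w).right_inv hx'.2]
      refine ContinuousAt.continuousWithinAt ?_
      refine continuousAt_const.congr (f := fun _ =>
        (κ ((e w).symm x))⁻¹ * κ ((e u).symm x)) ?_
      filter_upwards [h1.eventually (hκ _ _ (h2 x hx)),
        ((e u).open_target.inter (e w).open_target).mem_nhds hx] with x' hx' hm
      exact (hx' (h2 x' hm)).symm
    exact this.comp continuousOn_fst fun z hz => hz.1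
  coordChange_comp u v w x hx g := by group

/-- Holonomy of a locally constant cocycle: it is multiplicative along paths and computed by `κ`
along those paths that lift. -/
theorem exists_holonomy_of_discreteTopology (hΨ : IsLocalHomeomorph Ψ)
    (hsurj : Function.Surjective Ψ)
    (κ : K → G) (hκ : ∀ u₀ w₀, Ψ u₀ = Ψ w₀ → ∀ᶠ z : K × K in 𝓝 (u₀, w₀), Ψ z.1 = Ψ z.2 →
      (κ z.1)⁻¹ * κ z.2 = (κ u₀)⁻¹ * κ w₀) :
    ∃ hol : ∀ x y : X, Path.Homotopic.Quotient x y → G,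
      (∀ x y z (p : Path.Homotopic.Quotient x y) (q : Path.Homotopic.Quotient y z),
        hol x z (p.trans q) = hol y z q * hol x y p) ∧
      ∀ (u w : K) (p : Path u w),
        hol (Ψ u) (Ψ w) (.mk (p.map hΨ.continuous)) = κ w * (κ u)⁻¹ := by
  have hΨ₂ := hΨ
  choose e he hΨe using hΨ₂
  choose sec hsec using hsurj
  let Z := coboundaryBundle e he hΨe sec hsec κ hκ
  have cov : IsCoveringMap (Bundle.TotalSpace.proj : Bundle.TotalSpace G Z.Fiber → X) :=
    FiberBundle.isCoveringMap
  let pt (x : X) (g : G) : Bundle.TotalSpace G Z.Fiber := ⟨x, (κ (sec x))⁻¹ * g⟩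
  have pt_inj : ∀ x g g', pt x g = pt x g' → g = g' := by
    intro x g g' h
    have := congrArg (fun z : Bundle.TotalSpace G Z.Fiber => (z.2 : G)) h
    exact mul_left_cancel this
  have lift_cont : ∀ (g : G), Continuous fun u : K => pt (Ψ u) (κ u * g) := by
    intro g
    rw [continuous_iff_continuousAt]
    intro u
    have hmem : ∀ v ∈ (e u).source, Ψ v ∈ (e u).target := fun v hv => by
      rw [hΨe u]; exact (e u).map_source hv
    rw [(Z.localTriv u).continuousAt_iff_continuousAt_comp_left]
    · have : ContinuousAt (fun v => (Ψ v, g)) u :=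
        hΨ.continuous.continuousAt.prodMk continuousAt_const
      refine this.congr ?_
      filter_upwards [(e u).open_source.mem_nhds (he u)] with v hv
      simp only [Function.comp]
      refine Eq.trans ?_ (Z.localTriv_apply u _).symm
      refine Prod.ext rfl ?_
      have h1 : (e u).symm (Ψ v) = v := by rw [hΨe u, (e u).left_inv hv]
      have h2 : (e (sec (Ψ v))).symm (Ψ v) = sec (Ψ v) := by
        conv_lhs => rw [← hsec (Ψ v)]
        rw [hsec (Ψ v)]
        nth_rw 2 [← hsec (Ψ v)]
        rw [congrFun (hΨe (sec (Ψ v))) (sec (Ψ v)), (e (sec (Ψ v))).left_inv (he _)]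
      change g = (κ ((e u).symm (Ψ v)))⁻¹ * κ ((e (sec (Ψ v))).symm (Ψ v)) *
        ((κ (sec (Ψ v)))⁻¹ * (κ v * g))
      rw [h1, h2]
      group
    · filter_upwards [(e u).open_source.mem_nhds (he u)] with v hv
      exact (Z.mem_localTriv_source u _).2 (hmem v hv)
  have lifted : ∀ (u w : K) (p : Path u w) (g : G),
      (cov.monodromy (.mk (p.map hΨ.continuous)) ⟨pt (Ψ u) (κ u * g), rfl⟩ :
        Bundle.TotalSpace G Z.Fiber) = pt (Ψ w) (κ w * g) := fun u w p g =>
    congrArg Subtype.val (cov.monodromy_map (.mk (p.map (lift_cont g))))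
  have main : ∀ x y (p : Path.Homotopic.Quotient x y), ∃ h : G, ∀ g,
      (cov.monodromy p ⟨pt x g, rfl⟩ : Bundle.TotalSpace G Z.Fiber) = pt y (h * g) := by
    intro x y p
    refine Path.Homotopic.Quotient.induction_of_isLocalHomeomorph hΨ
      (fun x => ⟨sec x, hsec x⟩) (C := fun x y p => ∃ h : G, ∀ g,
      (cov.monodromy p ⟨pt x g, rfl⟩ : Bundle.TotalSpace G Z.Fiber) = pt y (h * g)) ?_ ?_ p
    · intro u w p
      refine ⟨κ w * (κ u)⁻¹, fun g => ?_⟩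
      obtain ⟨g, rfl⟩ : ∃ g', g = κ u * g' := ⟨(κ u)⁻¹ * g, by group⟩
      rw [show κ w * (κ u)⁻¹ * (κ u * g) = κ w * g by group]
      exact lifted u w p g
    · rintro x y z p q ⟨h, hh⟩ ⟨h', hh'⟩
      refine ⟨h' * h, fun g => ?_⟩
      rw [cov.monodromy_trans_apply, mul_assoc, ← hh' (h * g)]
      congr 2
      exact Subtype.ext (hh g)
  choose hol hhol using main
  refine ⟨hol, fun x y z p q => ?_, fun u w p => ?_⟩
  · apply mul_right_cancel (b := (1 : G))
    apply pt_inj z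
    rw [← hhol, cov.monodromy_trans_apply, mul_assoc, ← hhol]
    congr 2
    exact Subtype.ext (hhol x y p 1)
  · apply mul_right_cancel (b := κ u)
    apply pt_inj
    rw [← hhol]
    simpa using lifted u w p 1

theorem exists_holonomy {K X G : Type*} [TopologicalSpace K] [TopologicalSpace X] [Group G]
    {Ψ : K → X} (hΨ : IsLocalHomeomorph Ψ) (hsurj : Function.Surjective Ψ)
    (κ : K → G) (hκ : ∀ u₀ w₀, Ψ u₀ = Ψ w₀ → ∀ᶠ z : K × K in 𝓝 (u₀, w₀), Ψ z.1 = Ψ z.2 →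
      (κ z.1)⁻¹ * κ z.2 = (κ u₀)⁻¹ * κ w₀) :
    ∃ hol : ∀ x y : X, Path.Homotopic.Quotient x y → G,
      (∀ x y z (p : Path.Homotopic.Quotient x y) (q : Path.Homotopic.Quotient y z),
        hol x z (p.trans q) = hol y z q * hol x y p) ∧
      ∀ (u w : K) (p : Path u w),
        hol (Ψ u) (Ψ w) (.mk (p.map hΨ.continuous)) = κ w * (κ u)⁻¹ :=
  letI : TopologicalSpace G := ⊥
  haveI : DiscreteTopology G := ⟨rfl⟩
  exists_holonomy_of_discreteTopology hΨ hsurj κ hκ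

end Holonomy

section FreeGroupoid

variable {C : Type} [Groupoid.{0} C]

/-- The vertex groups of a connected groupoid that is free on finitely many generators are free
of finite rank. -/
theorem exists_end_mulEquiv_freeGroup [IsConnected C] {ε : Type} [Finite ε] (src tgt : ε → C)
    (gen : ∀ e, src e ⟶ tgt e)
    (h : ∀ {G : Type} [Group G] (a : ε → G), ∃! F : C ⥤ SingleObj G, ∀ e, F.map (gen e) = a e)
    (c : C) : ∃ n : ℕ, Nonempty (End c ≃* FreeGroup (Fin n)) := by
  let _ : IsFreeGroupoid C :=
    { quiverGenerators := ⟨fun x y => {e : ε // src e = x ∧ tgt e = y}⟩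
      of := fun {x y} e => eqToHom e.2.1.symm ≫ gen e.1 ≫ eqToHom e.2.2
      unique_lift := by
        intro G _ f
        obtain ⟨F, hF, huniq⟩ := h (fun e => f ⟨e, rfl, rfl⟩)
        refine ⟨F, ?_, fun F' hF' => huniq F' fun e => ?_⟩
        · rintro x y ⟨e, rfl, rfl⟩
          simpa using hF e
        · simpa using hF' _ _ ⟨e, rfl, rfl⟩ }
  have hfree : IsFreeGroup (End c) := inferInstance
  let M := Multiplicative (ZMod 2)
  have hconn : ∀ x : C, Nonempty (c ⟶ x) := fun x => nonempty_hom_of_preconnected_groupoid c x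
  let t : ∀ x : C, c ⟶ x := fun x => (hconn x).some
  let val (φ : End c →* M) {x y : C} (f : x ⟶ y) : M :=
    φ (End.of (t x ≫ f ≫ Groupoid.inv (t y)))
  have val_comp : ∀ φ {x y z : C} (f : x ⟶ y) (g : y ⟶ z),
      val φ (f ≫ g) = val φ g * val φ f := by
    intro φ x y z f g
    simp only [val]
    rw [← map_mul, End.mul_def]
    simp [End.of]
  let ext (φ : End c →* M) : C ⥤ SingleObj M :=
    { obj := fun _ => SingleObj.star M
      map := fun {x y} f => val φ f
      map_id := fun x => by
        simp only [val, Category.id_comp, Groupoid.comp_inv]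
        exact φ.map_one
      map_comp := fun {x y z} f g => val_comp φ f g }
  have val_end : ∀ φ (f : c ⟶ c), val φ f = φ (End.of f) := by
    intro φ f
    have h1 : (End.of (t c ≫ f ≫ Groupoid.inv (t c)) : End c) =
        End.of (Groupoid.inv (t c)) * End.of f * End.of (t c) := by
      simp [End.mul_def, End.of]
    have h2 : (End.of (Groupoid.inv (t c)) * End.of (t c) : End c) = 1 := by
      simp [End.mul_def, End.of]
    simp only [val]
    rw [h1, map_mul, map_mul, mul_right_comm, ← map_mul, h2, map_one, one_mul]
  have inj : Function.Injective fun (φ : End c →* M) (e : ε) => val φ (gen e) := by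
    intro φ ψ hφψ
    obtain ⟨F, -, huniq⟩ := h (fun e => val φ (gen e))
    have h1 := huniq (ext φ) fun e => rfl
    have h2 := huniq (ext ψ) fun e => (congrFun hφψ e).symm
    have h3 : ext φ = ext ψ := h1.trans h2.symm
    refine MonoidHom.ext fun f => ?_
    have h4 := Functor.congr_hom h3 (End.asHom f)
    have h5 : val φ (End.asHom f) = val ψ (End.asHom f) := by simpa [ext] using h4
    rwa [val_end, val_end] at h5
  have : Finite (End c →* M) := Finite.of_injective _ inj
  have : Finite (IsFreeGroup.Generators (End c) → M) :=
    Finite.of_equiv _ (IsFreeGroup.lift (G := End c) (H := M)).symm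
  have : Finite (IsFreeGroup.Generators (End c)) := by
    classical
    refine Finite.of_injective
      (fun x : IsFreeGroup.Generators (End c) => (Pi.mulSingle x (Multiplicative.ofAdd 1) :
        IsFreeGroup.Generators (End c) → M)) fun x y hxy => ?_
    by_contra hne
    have := congrFun hxy x
    simp [hne] at this
    revert this
    decide
  obtain ⟨n, ⟨e⟩⟩ := Finite.exists_equiv_fin (IsFreeGroup.Generators (End c))
  exact ⟨n, ⟨(IsFreeGroup.toFreeGroup (End c)).trans (FreeGroup.freeGroupCongr e)⟩⟩

end FreeGroupoid

theorem IsLocalHomeomorph.sigma {X ι : Type*} {K : ι → Type*} [TopologicalSpace X]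
    [∀ i, TopologicalSpace (K i)] {Ψ : ∀ i, K i → X} (hΨ : ∀ i, IsLocalHomeomorph (Ψ i)) :
    IsLocalHomeomorph fun z : Σ i, K i => Ψ z.1 z.2 := by
  refine IsLocalHomeomorph.mk _ ?_
  rintro ⟨i, u⟩
  obtain ⟨e, he, hΨe⟩ := hΨ i u
  have : Nonempty (K i) := ⟨u⟩
  let j := (IsOpenEmbedding.sigmaMk :
    IsOpenEmbedding (Sigma.mk i : K i → Σ i, K i)).toOpenPartialHomeomorph
  have hj : ∀ v : K i, j.symm ⟨i, v⟩ = v := fun v => j.left_inv (x := v) (by simp [j])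
  refine ⟨j.symm.trans e, ?_, ?_⟩
  · rw [OpenPartialHomeomorph.trans_source]
    refine ⟨by simp [j], ?_⟩
    rw [Set.mem_preimage, hj]
    exact he
  · rintro ⟨i', v⟩ hv
    rw [OpenPartialHomeomorph.trans_source] at hv
    have h1 : (⟨i', v⟩ : Σ i, K i) ∈ Set.range (Sigma.mk i) := by simpa [j] using hv.1
    obtain ⟨v', hv'⟩ := h1
    obtain rfl : i = i' := congrArg Sigma.fst hv'
    simp [hj, hΨe]

theorem Path.exists_eq_map_sigmaMk {ι : Type*} {K : ι → Type*} [∀ i, TopologicalSpace (K i)]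
    {i j : ι} {u : K i} {w : K j} (p : Path (⟨i, u⟩ : Σ i, K i) ⟨j, w⟩) :
    ∃ (h : i = j) (q : Path u (h ▸ w)), ∀ t, p t = ⟨i, q t⟩ := by
  obtain ⟨m, g, hg⟩ := ContinuousMap.exists_lift_sigma p.toContinuousMap
  have hg' : ∀ t, p t = ⟨m, g t⟩ := fun t => congrArg (fun f => f t) hg
  have h0 := p.source.symm.trans (hg' 0)
  have h1 := p.target.symm.trans (hg' 1)
  obtain rfl : i = m := congrArg Sigma.fst h0
  obtain rfl : j = i := congrArg Sigma.fst h1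
  exact ⟨rfl, ⟨g, (eq_of_heq (Sigma.mk.inj h0).2).symm, (eq_of_heq (Sigma.mk.inj h1).2).symm⟩, hg'⟩

/-- The gluing relation on the points of the pieces of an atlas generated by the edges. -/
def glueRel {ι : Type} {K : ι → Type} {ε : Type} (src tgt : ε → ι)
    {E : ε → Type} (l : ∀ e, E e → K (src e))
    (r : ∀ e, E e → K (tgt e)) (z z' : Σ i, K i) : Prop :=
  ∃ e t, z = ⟨src e, l e t⟩ ∧ z' = ⟨tgt e, r e t⟩

theorem eq_of_eqvGen_glueRel {X ι : Type} {K : ι → Type} {Ψ : ∀ i, K i → X} {ε : Type}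
    {src tgt : ε → ι} {E : ε → Type}
    {l : ∀ e, E e → K (src e)} {r : ∀ e, E e → K (tgt e)}
    (hlr : ∀ e t, Ψ _ (l e t) = Ψ _ (r e t)) {z z' : Σ i, K i}
    (h : Relation.EqvGen (glueRel src tgt l r) z z') : Ψ z.1 z.2 = Ψ z'.1 z'.2 := by
  induction h with
  | rel z z' h =>
    obtain ⟨e, t, rfl, rfl⟩ := h
    exact hlr e t
  | refl => rfl
  | symm _ _ _ ih => exact ih.symm
  | trans _ _ _ _ _ ih ih' => exact ih.trans ih'

section Atlas

variable {X : Type} [TopologicalSpace X] {ι : Type} {K : ι → Type} [∀ i, TopologicalSpace (K i)]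
  [∀ i, SimplyConnectedSpace (K i)] {Ψ : ∀ i, K i → X} (hΨ : ∀ i, Continuous (Ψ i))
  (base : ∀ i, K i)

/-- A homotopy class of paths as a morphism of the fundamental groupoid. -/
def Path.Homotopic.Quotient.toHom {x y : X} (p : Path.Homotopic.Quotient x y) :
    FundamentalGroupoid.mk x ⟶ FundamentalGroupoid.mk y :=
  p

/-- The homotopy class of the image of a path from the base point of a simply connected piece. -/
noncomputable def pieceHom (i : ι) (u : K i) (x : X) (hx : Ψ i u = x) :
    FundamentalGroupoid.mk (Ψ i (base i)) ⟶ FundamentalGroupoid.mk x :=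
  Path.Homotopic.Quotient.mk
    (((PathConnectedSpace.somePath (base i) u).map (hΨ i)).cast rfl hx.symm)

theorem pieceHom_comp {i : ι} {u w : K i} (p : Path u w) {x y : X} (γ : Path x y)
    (h : ∀ t, Ψ i (p t) = γ t) (hu : Ψ i u = x) (hw : Ψ i w = y) :
    pieceHom hΨ base i u x hu ≫
      (Path.Homotopic.Quotient.mk γ).toHom = pieceHom hΨ base i w y hw := by
  subst hu hw
  have hγ : γ = p.map (hΨ i) := by
    ext t
    exact (h t).symm
  subst hγ
  have := SimplyConnectedSpace.paths_homotopic
    ((PathConnectedSpace.somePath (base i) u).trans p) (PathConnectedSpace.somePath (base i) w)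
  have h2 := this.map ⟨Ψ i, hΨ i⟩
  refine Eq.trans ?_ (Path.Homotopic.Quotient.eq.2 h2)
  change Path.Homotopic.Quotient.trans (.mk ((PathConnectedSpace.somePath (base i) u).map (hΨ i)))
    (.mk (p.map (hΨ i))) = _
  rw [← Path.Homotopic.Quotient.mk_trans]
  congr 1
  exact (Path.map_trans _ _ _).symm

/-- The groupoid of homotopy classes of paths between the base points of the pieces. -/
abbrev PieceGroupoid (Ψ : ∀ i, K i → X) (base : ∀ i, K i) : Type :=
  InducedCategory (FundamentalGroupoid X) fun i => FundamentalGroupoid.mk (Ψ i (base i))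

/-- The morphism of the piece groupoid associated with a common value of two pieces. -/
noncomputable def linkHom (i : ι) (u : K i) (j : ι) (w : K j) (x : X) (hu : Ψ i u = x)
    (hw : Ψ j w = x) :
    @Quiver.Hom (PieceGroupoid Ψ base) _ i j :=
  InducedCategory.homMk (pieceHom hΨ base i u x hu ≫ inv (pieceHom hΨ base j w x hw))

theorem linkHom_self (i : ι) (u : K i) (x : X) (hu hu' : Ψ i u = x) :
    linkHom hΨ base i u i u x hu hu' = 𝟙 _ := by
  ext
  simp [linkHom]

theorem linkHom_comp (i : ι) (u : K i) (j : ι) (w : K j) (m : ι) (v : K m) (x : X)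
    (hu : Ψ i u = x) (hw : Ψ j w = x) (hv : Ψ m v = x) :
    linkHom hΨ base i u j w x hu hw ≫ linkHom hΨ base j w m v x hw hv =
      linkHom hΨ base i u m v x hu hv := by
  ext
  simp [linkHom]

theorem linkHom_eq_linkHom {i j : ι} {u u' : K i} {w w' : K j} (p : Path u u') (q : Path w w')
    (h : ∀ t, Ψ i (p t) = Ψ j (q t)) {x x' : X} (hu : Ψ i u = x) (hw : Ψ j w = x)
    (hu' : Ψ i u' = x') (hw' : Ψ j w' = x') :
    linkHom hΨ base i u j w x hu hw = linkHom hΨ base i u' j w' x' hu' hw' := by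
  ext
  simp only [linkHom, InducedCategory.homMk_hom]
  have h₁ := pieceHom_comp hΨ base p ((p.map (hΨ i)).cast hu.symm hu'.symm) (fun t => rfl) hu hu'
  have h₂ := pieceHom_comp hΨ base q ((p.map (hΨ i)).cast hu.symm hu'.symm)
    (fun t => (h t).symm) hw hw'
  rw [← cancel_mono (pieceHom hΨ base j w' x' hw'), Category.assoc, Category.assoc,
    IsIso.inv_hom_id, Category.comp_id, ← h₂, ← h₁]
  simp

/-- Two functors from the piece groupoid to a group agree if they agree on the links given by
gluings of the pieces. -/
theorem pieceGroupoid_functor_ext (hloc : ∀ i, IsLocalHomeomorph (Ψ i))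
    (hcov : ∀ x, ∃ i u, Ψ i u = x) {G : Type} [Group G]
    (F F' : PieceGroupoid Ψ base ⥤ SingleObj G)
    (h : ∀ i u j w x hu hw, F.map (linkHom hΨ base i u j w x hu hw) =
      F'.map (linkHom hΨ base i u j w x hu hw)) : F = F' := by
  let conj (x y : X) (p : Path.Homotopic.Quotient x y) (i : ι) (u : K i) (hu : Ψ i u = x) (j : ι)
    (w : K j) (hw : Ψ j w = y) : @Quiver.Hom (PieceGroupoid Ψ base) _ i j :=
    InducedCategory.homMk (pieceHom hΨ base i u x hu ≫
      p.toHom ≫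
      inv (pieceHom hΨ base j w y hw))
  have main : ∀ x y (p : Path.Homotopic.Quotient x y), ∀ i u hu j w hw,
      F.map (conj x y p i u hu j w hw) = F'.map (conj x y p i u hu j w hw) := by
    intro x y p
    refine Path.Homotopic.Quotient.induction_of_isLocalHomeomorph (.sigma hloc)
      (fun x => (hcov x).elim fun i hi => hi.elim fun u hu => ⟨⟨i, u⟩, hu⟩)
      (C := fun x y p => ∀ i u hu j w hw,
        F.map (conj x y p i u hu j w hw) = F'.map (conj x y p i u hu j w hw)) ?_ ?_ p
    · rintro ⟨m, u₀⟩ ⟨m', w₀⟩ p i u hu j w hw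
      obtain ⟨rfl, q, hq⟩ := p.exists_eq_map_sigmaMk
      have h₁ := pieceHom_comp hΨ base q (p.map (IsLocalHomeomorph.sigma hloc).continuous)
        (fun t => (congrArg (fun z : Σ i, K i => Ψ z.1 z.2) (hq t)).symm) rfl rfl
      have : conj _ _ (.mk (p.map (IsLocalHomeomorph.sigma hloc).continuous)) i u hu j w hw =
          linkHom hΨ base i u m u₀ _ hu rfl ≫ linkHom hΨ base m w₀ j w _ rfl hw := by
        ext
        simp only [conj, linkHom, InducedCategory.homMk_hom, InducedCategory.comp_hom]
        rw [← h₁]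
        simp
      rw [this, F.map_comp, F'.map_comp, h, h]
    · intro x y z p q hp hq i u hu j w hw
      obtain ⟨m, v, hv⟩ := hcov y
      have : conj x z (p.trans q) i u hu j w hw =
          conj x y p i u hu m v hv ≫ conj y z q m v hv j w hw := by
        ext
        simp only [conj, InducedCategory.homMk_hom, InducedCategory.comp_hom]
        rw [Category.assoc, Category.assoc, IsIso.inv_hom_id_assoc,
          show (p.trans q).toHom = p.toHom ≫ q.toHom from rfl, Category.assoc]
      rw [this, F.map_comp, F'.map_comp, hp, hq]
  refine Functor.hext (fun _ => rfl) ?_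
  intro i j f
  refine heq_of_eq ?_
  have := main _ _ f.hom i (base i) rfl j (base j) rfl
  have h1 : ∀ i, pieceHom hΨ base i (base i) _ rfl = 𝟙 _ := by
    intro i
    exact Path.Homotopic.Quotient.eq.2 ((SimplyConnectedSpace.paths_homotopic
      (PathConnectedSpace.somePath (base i) (base i)) (Path.refl _)).map ⟨Ψ i, hΨ i⟩)
  have h2 : conj _ _ f.hom i (base i) rfl j (base j) rfl = f := by
    ext
    simp only [conj, h1, InducedCategory.homMk_hom, IsIso.inv_id, Category.id_comp]
    exact Category.comp_id _
  rwa [h2] at this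

/-- A cocycle on an atlas defines a functor from the piece groupoid to a group. -/
theorem exists_pieceGroupoid_functor (hloc : ∀ i, IsLocalHomeomorph (Ψ i))
    (hcov : ∀ x, ∃ i u, Ψ i u = x) {G : Type} [Group G] (κ : ∀ i, K i → G)
    (hκ : ∀ i j u₀ w₀, Ψ i u₀ = Ψ j w₀ → ∀ᶠ z : K i × K j in 𝓝 (u₀, w₀), Ψ i z.1 = Ψ j z.2 →
      (κ i z.1)⁻¹ * κ j z.2 = (κ i u₀)⁻¹ * κ j w₀) :
    ∃ F : PieceGroupoid Ψ base ⥤ SingleObj G, ∀ i u j w x hu hw,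
      F.map (linkHom hΨ base i u j w x hu hw) = (κ j w)⁻¹ * κ i u := by
  obtain ⟨hol, hol_trans, hol_lift⟩ := exists_holonomy (IsLocalHomeomorph.sigma hloc)
    (fun x => (hcov x).elim fun i hi => hi.elim fun u hu => ⟨⟨i, u⟩, hu⟩)
    (fun z : Σ i, K i => κ z.1 z.2) (by
      rintro ⟨i, u⟩ ⟨j, w⟩ h
      have hopen : IsOpenEmbedding (Prod.map (Sigma.mk i : K i → Σ i, K i)
        (Sigma.mk j : K j → Σ i, K i)) := IsOpenEmbedding.sigmaMk.prodMap IsOpenEmbedding.sigmaMk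
      have := hopen.map_nhds_eq (u, w)
      rw [Prod.map_apply] at this
      rw [← this, Filter.eventually_map]
      exact hκ i j u w h)
  have hol_refl : ∀ x, hol x x (.refl x) = 1 := by
    intro x
    have := hol_trans x x x (.refl x) (.refl x)
    rw [Path.Homotopic.Quotient.refl_trans] at this
    simpa using this
  have hol_piece : ∀ i u x hu, hol _ _ (pieceHom hΨ base i u x hu) =
      κ i u * (κ i (base i))⁻¹ := by
    rintro i u _ rfl
    exact hol_lift ⟨i, base i⟩ ⟨i, u⟩
      ((PathConnectedSpace.somePath (base i) u).map continuous_sigmaMk)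
  have hol_comp : ∀ {x y z : X} (f : FundamentalGroupoid.mk x ⟶ FundamentalGroupoid.mk y)
      (g : FundamentalGroupoid.mk y ⟶ FundamentalGroupoid.mk z),
      hol x z (f ≫ g) = hol y z g * hol x y f := fun f g => hol_trans _ _ _ f g
  have hol_inv : ∀ {x y : X} (f : FundamentalGroupoid.mk x ⟶ FundamentalGroupoid.mk y),
      hol y x (inv f) = (hol x y f)⁻¹ := by
    intro x y f
    rw [eq_inv_iff_mul_eq_one, ← hol_comp, IsIso.hom_inv_id]
    exact hol_refl x
  refine ⟨{ obj := fun _ => SingleObj.star G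
            map := fun {i j} f => (κ j (base j))⁻¹ * hol _ _ f.hom * κ i (base i)
            map_id := fun i => ?_
            map_comp := fun {i j m} f g => ?_ }, ?_⟩
  · have : hol _ _ (InducedCategory.Hom.hom (𝟙 (i : PieceGroupoid Ψ base))) = 1 := hol_refl _
    rw [this, mul_one, inv_mul_cancel]
    rfl
  · have : hol _ _ (InducedCategory.Hom.hom (f ≫ g)) = _ := hol_comp f.hom g.hom
    rw [this]
    change _ = ((κ m (base m))⁻¹ * hol _ _ g.hom * κ j (base j)) *
      ((κ j (base j))⁻¹ * hol _ _ f.hom * κ i (base i))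
    group
  · intro i u j w x hu hw
    have : hol _ _ (linkHom hΨ base i u j w x hu hw).hom =
      (κ j w * (κ j (base j))⁻¹)⁻¹ * (κ i u * (κ i (base i))⁻¹) := by
      rw [← hol_piece i u x hu, ← hol_piece j w x hw, ← hol_inv]
      exact hol_comp _ _
    change (κ j (base j))⁻¹ * hol _ _ (linkHom hΨ base i u j w x hu hw).hom * κ i (base i) = _
    rw [this]
    group

end Atlas

/-- A path connected space covered by finitely many simply connected pieces, glued along finitely
many path connected edges that carry arbitrary cocycles, has free fundamental groups of finite
rank. -/
theorem exists_fundamentalGroup_mulEquiv_freeGroup_of_atlas {X : Type} [TopologicalSpace X]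
    [PathConnectedSpace X] {ι : Type} {K : ι → Type} [∀ i, TopologicalSpace (K i)]
    [∀ i, SimplyConnectedSpace (K i)] {Ψ : ∀ i, K i → X}
    (hloc : ∀ i, IsLocalHomeomorph (Ψ i)) (hcov : ∀ x, ∃ i u, Ψ i u = x)
    {ε : Type} [Finite ε] {src tgt : ε → ι} {E : ε → Type} [∀ e, TopologicalSpace (E e)]
    [∀ e, PathConnectedSpace (E e)] {l : ∀ e, E e → K (src e)} {r : ∀ e, E e → K (tgt e)}
    (hl : ∀ e, Continuous (l e)) (hr : ∀ e, Continuous (r e))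
    (hlr : ∀ e t, Ψ _ (l e t) = Ψ _ (r e t))
    (hglue : ∀ i j u w, Ψ i u = Ψ j w →
      Relation.EqvGen (glueRel src tgt l r) ⟨i, u⟩ ⟨j, w⟩)
    (hcocycle : ∀ {G : Type} [Group G] (a : ε → G), ∃ κ : ∀ i, K i → G,
      (∀ e t, κ _ (l e t) = κ _ (r e t) * a e) ∧
      ∀ i j u₀ w₀, Ψ i u₀ = Ψ j w₀ → ∀ᶠ z : K i × K j in 𝓝 (u₀, w₀), Ψ i z.1 = Ψ j z.2 →
        (κ i z.1)⁻¹ * κ j z.2 = (κ i u₀)⁻¹ * κ j w₀)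
    (x : X) : ∃ n : ℕ, Nonempty (FundamentalGroup X x ≃* FreeGroup (Fin n)) := by
  let base : ∀ i, K i := fun i => (PathConnectedSpace.nonempty (X := K i)).some
  have hΨ : ∀ i, Continuous (Ψ i) := fun i => (hloc i).continuous
  obtain ⟨i₀, -⟩ := hcov x
  have : Nonempty (PieceGroupoid Ψ base) := ⟨i₀⟩
  have hconn : CategoryTheory.IsPreconnected (PieceGroupoid Ψ base) :=
    zigzag_isPreconnected fun i j => Zigzag.of_hom (InducedCategory.homMk
      (Path.Homotopic.Quotient.mk
        (PathConnectedSpace.somePath (Ψ i (base i)) (Ψ j (base j)))).toHom)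
  have : CategoryTheory.IsConnected (PieceGroupoid Ψ base) := { }
  let t₀ : ∀ e, E e := fun e => (PathConnectedSpace.nonempty (X := E e)).some
  obtain ⟨n, ⟨φ⟩⟩ := exists_end_mulEquiv_freeGroup (C := PieceGroupoid Ψ base) src tgt
    (fun e => linkHom hΨ base _ (l e (t₀ e)) _ (r e (t₀ e)) _ rfl (hlr e _).symm) (by
      intro G _ a
      obtain ⟨κ, hκa, hκ⟩ := hcocycle a
      obtain ⟨F, hF⟩ := exists_pieceGroupoid_functor hΨ base hloc hcov κ hκ
      have hFa : ∀ e, F.map (linkHom hΨ base _ (l e (t₀ e)) _ (r e (t₀ e)) _ rfl (hlr e _).symm) =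
          a e := by
        intro e
        rw [hF, hκa, inv_mul_cancel_left]
      refine ⟨F, hFa, fun F' hF' => ?_⟩
      refine pieceGroupoid_functor_ext hΨ base hloc hcov F' F ?_
      have key : ∀ z z', Relation.EqvGen (glueRel src tgt l r) z z' → ∀ x hx hx',
          F'.map (linkHom hΨ base z.1 z.2 z'.1 z'.2 x hx hx') =
            F.map (linkHom hΨ base z.1 z.2 z'.1 z'.2 x hx hx') := by
        intro z z' h
        induction h with
        | rel z z' h =>
          obtain ⟨e, t, rfl, rfl⟩ := h
          intro x hx hx'
          have p := PathConnectedSpace.somePath t (t₀ e)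
          rw [linkHom_eq_linkHom hΨ base (p.map (hl e)) (p.map (hr e)) (fun s => hlr e (p s)) hx hx'
            rfl (hlr e _).symm, hFa e]
          exact hF' e
        | refl =>
          intro x hx hx'
          rw [linkHom_self, F.map_id, F'.map_id]
          rfl
        | symm z z' h ih =>
          intro x hx hx'
          have h1 := linkHom_comp hΨ base z.1 z.2 z'.1 z'.2 z.1 z.2 x hx' hx hx'
          rw [linkHom_self] at h1
          rw [← cancel_epi (F.map (linkHom hΨ base z.1 z.2 z'.1 z'.2 x hx' hx)), ← F.map_comp, h1,
            ← ih, F.map_id]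
          rw [← F'.map_comp, h1, F'.map_id]
          rfl
        | trans z z' z'' h h' ih ih' =>
          intro x hx hx'
          have hz' : Ψ z'.1 z'.2 = x := (eq_of_eqvGen_glueRel hlr h).symm.trans hx
          rw [← linkHom_comp hΨ base z.1 z.2 z'.1 z'.2 z''.1 z''.2 x hx hz' hx',
            F.map_comp, F'.map_comp, ih, ih']
      intro i u j w x hu hw
      exact key ⟨i, u⟩ ⟨j, w⟩ (hglue i j u w (hu.trans hw.symm)) x hu hw) i₀
  have ψ : FundamentalGroup X (Ψ i₀ (base i₀)) ≃* @End (PieceGroupoid Ψ base) _ i₀ :=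
    { toFun := fun f => InducedCategory.homMk f
      invFun := fun f => f.hom
      left_inv := fun f => rfl
      right_inv := fun f => rfl
      map_mul' := fun f g => rfl }
  exact ⟨n, ⟨(FundamentalGroup.fundamentalGroupMulEquivOfPathConnected x _).trans (ψ.trans φ)⟩⟩

section Pieces

theorem eqvGen_of_eq_of_height {X M α : Type*} {Ψ : M → X} {T : M → M} {τ : M → ℝ} {f : M → α}
    {s : α → α → Prop}
    (hTΨ : ∀ u, Ψ (T u) = Ψ u) (hTτ : ∀ u, τ (T u) = τ u + 1)
    (hker : ∀ u w, Ψ u = Ψ w → ∃ n : ℤ, τ w = τ u + n)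
    (hinj : ∀ u w, Ψ u = Ψ w → τ u = τ w → u = w) (hs : ∀ u, s (f (T u)) (f u)) (u w : M)
    (h : Ψ u = Ψ w) : Relation.EqvGen s (f u) (f w) := by
  have iter : ∀ (n : ℕ) (u : M), Ψ (T^[n] u) = Ψ u ∧ τ (T^[n] u) = τ u + n ∧
      Relation.EqvGen s (f (T^[n] u)) (f u) := by
    intro n
    induction n with
    | zero => exact fun u => ⟨rfl, by simp, .refl _⟩
    | succ n ih =>
      intro u
      obtain ⟨h1, h2, h3⟩ := ih (T u)
      refine ⟨h1.trans (hTΨ u), ?_, h3.trans _ _ _ (.rel _ _ (hs u))⟩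
      rw [Function.iterate_succ_apply, h2, hTτ]
      push_cast
      ring
  obtain ⟨n, hn⟩ := hker u w h
  obtain ⟨m, rfl | rfl⟩ := n.eq_nat_or_neg
  · obtain ⟨h1, h2, h3⟩ := iter m u
    rw [hinj _ w (h1.trans h) (by simpa [h2] using hn.symm)] at h3
    exact h3.symm
  · obtain ⟨h1, h2, h3⟩ := iter m w
    rwa [hinj _ u (h1.trans h.symm) (by rw [h2, hn]; simp)] at h3

variable {X M : Type} [TopologicalSpace X] [TopologicalSpace M] {Ψ : M → X} {τ : M → ℝ}

theorem isLocalHomeomorph_of_height (hΨ : Continuous Ψ) (hΨo : IsOpenMap Ψ) (hτ : Continuous τ)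
    (hker : ∀ u w, Ψ u = Ψ w → ∃ n : ℤ, τ w = τ u + n)
    (hinj : ∀ u w, Ψ u = Ψ w → τ u = τ w → u = w) : IsLocalHomeomorph Ψ := by
  rw [isLocalHomeomorph_iff_isOpenEmbedding_restrict]
  intro u₀
  have hU : IsOpen (τ ⁻¹' Metric.ball (τ u₀) (1 / 2)) := Metric.isOpen_ball.preimage hτ
  refine ⟨_, hU.mem_nhds (by simp), .of_continuous_injective_isOpenMap ?_ ?_ ?_⟩
  · exact hΨ.comp continuous_subtype_val
  · rintro ⟨u, hu⟩ ⟨w, hw⟩ h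
    replace h : Ψ u = Ψ w := h
    obtain ⟨n, hn⟩ := hker u w h
    simp only [Set.mem_preimage, Metric.mem_ball, Real.dist_eq, abs_lt] at hu hw
    have h1 : n < 1 := by exact_mod_cast (by linarith : (n : ℝ) < 1)
    have h2 : -1 < n := by exact_mod_cast (by linarith : (-1 : ℝ) < n)
    have h3 : n = 0 := by omega
    subst h3
    exact Subtype.ext (hinj u w h (by simpa using hn.symm))
  · exact hΨo.domRestrict hU

/-- A locally constant choice of heights, twisted by the sections `l e`. -/
theorem exists_height_cocycle {G : Type} [Group G] {ε : Type} {E : ε → Type}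
    [∀ e, TopologicalSpace (E e)] {jE : ∀ e, E e → X} (hE : ∀ e, IsOpenEmbedding (jE e))
    (hEE : ∀ e e' x x', jE e x = jE e' x' → e = e')
    {l : ∀ e, E e → M} (hl : ∀ e, Continuous (l e)) (hlj : ∀ e x, Ψ (l e x) = jE e x)
    (hΨ : Continuous Ψ) (hτ : Continuous τ)
    (hker : ∀ u w, Ψ u = Ψ w → ∃ n : ℤ, τ w = τ u + n) (a : ε → G) (g : G) :
    ∃ κ : M → G, (∀ e x, κ (l e x) = a e) ∧
      (∀ u w (n : ℤ), Ψ u = Ψ w → τ w = τ u + n → κ w = κ u * g ^ n) ∧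
      ∀ e x u₀, jE e x = Ψ u₀ → ∀ᶠ u in 𝓝 u₀, κ u = κ u₀ := by
  classical
  have hspec : ∀ u, ∃ h : G, (∀ e x, jE e x = Ψ u → h = a e * g ^ ⌊τ u - τ (l e x)⌋) ∧
      ((¬∃ e x, jE e x = Ψ u) → h = g ^ ⌊τ u⌋) := by
    intro u
    by_cases h : ∃ e x, jE e x = Ψ u
    · obtain ⟨e, x, hx⟩ := h
      refine ⟨a e * g ^ ⌊τ u - τ (l e x)⌋, fun e' x' hx' => ?_, fun h => (h ⟨e, x, hx⟩).elim⟩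
      obtain rfl := hEE e e' x x' (hx.trans hx'.symm)
      rw [(hE e).injective (hx.trans hx'.symm)]
    · exact ⟨_, fun e x hx => (h ⟨e, x, hx⟩).elim, fun _ => rfl⟩
  choose κ hκ hκ' using hspec
  refine ⟨κ, fun e x => ?_, fun u w n h hn => ?_, fun e x₀ u₀ h₀ => ?_⟩
  · simp [hκ (l e x) e x (hlj e x).symm]
  · by_cases hu : ∃ e x, jE e x = Ψ u
    · obtain ⟨e, x, hx⟩ := hu
      rw [hκ u e x hx, hκ w e x (hx.trans h), hn, add_sub_right_comm, Int.floor_add_intCast,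
        zpow_add, mul_assoc]
    · rw [hκ' u hu, hκ' w (h ▸ hu), hn, Int.floor_add_intCast, zpow_add]
  · have : Nonempty (E e) := ⟨x₀⟩
    let φ := (hE e).toOpenPartialHomeomorph
    have hφ : ∀ x, φ x = jE e x := fun _ => rfl
    have hmem : ∀ᶠ u in 𝓝 u₀, Ψ u ∈ Set.range (jE e) :=
      hΨ.continuousAt.eventually_mem ((hE e).isOpen_range.mem_nhds ⟨x₀, h₀⟩)
    have hx : ∀ u, Ψ u ∈ Set.range (jE e) → jE e (φ.symm (Ψ u)) = Ψ u := by
      intro u hu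
      rw [← hφ]
      exact φ.right_inv (by simpa [φ] using hu)
    have hcont : ContinuousAt (fun u => τ u - τ (l e (φ.symm (Ψ u)))) u₀ := by
      refine hτ.continuousAt.sub (hτ.continuousAt.comp ((hl e).continuousAt.comp ?_))
      exact (φ.continuousAt_symm (x := Ψ u₀) (by simpa [φ] using ⟨x₀, h₀⟩)).comp hΨ.continuousAt
    filter_upwards [hmem, hcont.eventually (Metric.ball_mem_nhds _ one_pos)] with u hu hball
    have hheight : ∀ u, Ψ u ∈ Set.range (jE e) →
        ∃ n : ℤ, τ u - τ (l e (φ.symm (Ψ u))) = n := by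
      intro u hu
      obtain ⟨n, hn⟩ := hker (l e (φ.symm (Ψ u))) u ((hlj _ _).trans (hx u hu))
      exact ⟨n, by rw [hn]; ring⟩
    obtain ⟨n, hn⟩ := hheight u hu
    obtain ⟨n₀, hn₀⟩ := hheight u₀ ⟨x₀, h₀⟩
    rw [hκ u e _ (hx u hu), hκ u₀ e _ (hx u₀ ⟨x₀, h₀⟩)]
    rw [Real.dist_eq, hn, hn₀, abs_lt] at hball
    have h1 : n < n₀ + 1 := by exact_mod_cast (by linarith [hball.2] : (n : ℝ) < n₀ + 1)
    have h2 : n₀ - 1 < n := by exact_mod_cast (by linarith [hball.1] : (n₀ - 1 : ℝ) < n)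
    rw [hn, hn₀, show n = n₀ by omega]

/-- A space glued from a piece `M` carrying a free `ℤ`-action, embedded pieces `KP` and `KV`, and
embedded overlaps `E₁` between `KV`s and `KP`s and `E₂` between `KV`s and `M`, has free fundamental
group. -/
theorem exists_fundamentalGroup_mulEquiv_freeGroup_of_pieces [PathConnectedSpace X]
    [SimplyConnectedSpace M] (hΨ : Continuous Ψ) (hΨo : IsOpenMap Ψ) (hτ : Continuous τ)
    {T : M → M} (hT : Continuous T) (hTΨ : ∀ u, Ψ (T u) = Ψ u) (hTτ : ∀ u, τ (T u) = τ u + 1)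
    (hker : ∀ u w, Ψ u = Ψ w → ∃ n : ℤ, τ w = τ u + n)
    (hinj : ∀ u w, Ψ u = Ψ w → τ u = τ w → u = w)
    {P V : Type} {KP : P → Type} {KV : V → Type} [∀ p, TopologicalSpace (KP p)]
    [∀ v, TopologicalSpace (KV v)] [∀ p, SimplyConnectedSpace (KP p)]
    [∀ v, SimplyConnectedSpace (KV v)] {jP : ∀ p, KP p → X} {jV : ∀ v, KV v → X}
    (hP : ∀ p, IsOpenEmbedding (jP p)) (hV : ∀ v, IsOpenEmbedding (jV v))
    {ε₁ ε₂ : Type} [Finite ε₁] [Finite ε₂] {E₁ : ε₁ → Type} {E₂ : ε₂ → Type}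
    [∀ e, TopologicalSpace (E₁ e)] [∀ e, TopologicalSpace (E₂ e)]
    [∀ e, PathConnectedSpace (E₁ e)] [∀ e, PathConnectedSpace (E₂ e)]
    {j₁ : ∀ e, E₁ e → X} {j₂ : ∀ e, E₂ e → X} (h₁ : ∀ e, IsOpenEmbedding (j₁ e))
    (h₂ : ∀ e, IsOpenEmbedding (j₂ e))
    {tP : ε₁ → P} {tV₁ : ε₁ → V} {tV₂ : ε₂ → V}
    {r₁ : ∀ e, E₁ e → KV (tV₁ e)} {r₂ : ∀ e, E₂ e → KV (tV₂ e)}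
    {l₁ : ∀ e, E₁ e → KP (tP e)} {l₂ : ∀ e, E₂ e → M}
    (hr₁ : ∀ e x, jV _ (r₁ e x) = j₁ e x) (hr₂ : ∀ e x, jV _ (r₂ e x) = j₂ e x)
    (hl₁ : ∀ e x, jP _ (l₁ e x) = j₁ e x) (hl₂ : ∀ e x, Ψ (l₂ e x) = j₂ e x)
    (hl₂c : ∀ e, Continuous (l₂ e))
    (hPP : ∀ p p' x x', jP p x = jP p' x' → p = p')
    (hVV : ∀ v v' x x', jV v x = jV v' x' → v = v')
    (h₁₁ : ∀ e e' x x', j₁ e x = j₁ e' x' → e = e')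
    (h₂₂ : ∀ e e' x x', j₂ e x = j₂ e' x' → e = e')
    (hMP : ∀ u p x, Ψ u ≠ jP p x)
    (hVP : ∀ v x p y, jV v x = jP p y → ∃ e t, j₁ e t = jV v x)
    (hVM : ∀ v x u, jV v x = Ψ u → ∃ e t, j₂ e t = jV v x)
    (hcov : ∀ z, (∃ u, Ψ u = z) ∨ (∃ p x, jP p x = z) ∨ ∃ v x, jV v x = z) (z : X) :
    ∃ n : ℕ, Nonempty (FundamentalGroup X z ≃* FreeGroup (Fin n)) := by
  let ι := Unit ⊕ (P ⊕ V)
  let K : ι → Type := Sum.elim (fun _ => M) (Sum.elim KP KV)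
  let : ∀ i, TopologicalSpace (K i) := fun
    | .inl _ => ‹TopologicalSpace M›
    | .inr (.inl p) => ‹∀ x, TopologicalSpace (KP x)› p
    | .inr (.inr v) => ‹∀ x, TopologicalSpace (KV x)› v
  have : ∀ i, SimplyConnectedSpace (K i) := fun
    | .inl _ => ‹SimplyConnectedSpace M›
    | .inr (.inl p) => ‹∀ x, SimplyConnectedSpace (KP x)› p
    | .inr (.inr v) => ‹∀ x, SimplyConnectedSpace (KV x)› v
  let J : ∀ i, K i → X := fun
    | .inl _ => Ψ
    | .inr (.inl p) => jP p
    | .inr (.inr v) => jV v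
  let ε := Unit ⊕ (ε₁ ⊕ ε₂)
  let E : ε → Type := Sum.elim (fun _ => M) (Sum.elim E₁ E₂)
  let : ∀ e, TopologicalSpace (E e) := fun
    | .inl _ => ‹TopologicalSpace M›
    | .inr (.inl p) => ‹∀ x, TopologicalSpace (E₁ x)› p
    | .inr (.inr v) => ‹∀ x, TopologicalSpace (E₂ x)› v
  have : ∀ e, PathConnectedSpace (E e) := fun
    | .inl _ => (inferInstance : PathConnectedSpace M)
    | .inr (.inl p) => ‹∀ x, PathConnectedSpace (E₁ x)› p
    | .inr (.inr v) => ‹∀ x, PathConnectedSpace (E₂ x)› v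
  let src : ε → ι := fun
    | .inl _ => .inl ()
    | .inr (.inl e) => .inr (.inl (tP e))
    | .inr (.inr _) => .inl ()
  let tgt : ε → ι := fun
    | .inl _ => .inl ()
    | .inr (.inl e) => .inr (.inr (tV₁ e))
    | .inr (.inr e) => .inr (.inr (tV₂ e))
  let l : ∀ e, E e → K (src e) := fun
    | .inl _ => T
    | .inr (.inl e) => l₁ e
    | .inr (.inr e) => l₂ e
  let r : ∀ e, E e → K (tgt e) := fun
    | .inl _ => id
    | .inr (.inl e) => r₁ e
    | .inr (.inr e) => r₂ e
  have hr₁c : ∀ e, Continuous (r₁ e) := fun e =>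
    (hV _).continuous_iff.2 ((h₁ e).continuous.congr fun x => (hr₁ e x).symm)
  have hr₂c : ∀ e, Continuous (r₂ e) := fun e =>
    (hV _).continuous_iff.2 ((h₂ e).continuous.congr fun x => (hr₂ e x).symm)
  have hl₁c : ∀ e, Continuous (l₁ e) := fun e =>
    (hP _).continuous_iff.2 ((h₁ e).continuous.congr fun x => (hl₁ e x).symm)
  have glueVP : ∀ v x p y, jV v x = jP p y → ∃ e t, tV₁ e = v ∧ tP e = p ∧
      (⟨.inr (.inr v), x⟩ : Σ i, K i) = ⟨.inr (.inr (tV₁ e)), r₁ e t⟩ ∧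
      (⟨.inr (.inl p), y⟩ : Σ i, K i) = ⟨.inr (.inl (tP e)), l₁ e t⟩ := by
    intro v x p y h
    obtain ⟨e, t, ht⟩ := hVP v x p y h
    obtain rfl := hVV _ _ _ _ (ht.symm.trans (hr₁ e t).symm)
    obtain rfl := hPP _ _ _ _ (h.symm.trans (ht.symm.trans (hl₁ e t).symm))
    obtain rfl := (hV _).injective (ht.symm.trans (hr₁ e t).symm)
    obtain rfl := (hP _).injective (h.symm.trans (ht.symm.trans (hl₁ e t).symm))
    exact ⟨e, t, rfl, rfl, rfl, rfl⟩
  have glueMM : ∀ u w, Ψ u = Ψ w →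
      Relation.EqvGen (glueRel src tgt l r) ⟨.inl (), u⟩ ⟨.inl (), w⟩ :=
    eqvGen_of_eq_of_height (f := fun u => (⟨.inl (), u⟩ : Σ i, K i)) hTΨ hTτ hker hinj
      fun u => ⟨.inl (), u, rfl, rfl⟩
  have gluePV : ∀ v x p y, jV v x = jP p y →
      Relation.EqvGen (glueRel src tgt l r) ⟨.inr (.inl p), y⟩ ⟨.inr (.inr v), x⟩ := by
    intro v x p y h
    obtain ⟨e, t, -, -, h1, h2⟩ := glueVP v x p y h
    exact .rel _ _ ⟨.inr (.inl e), t, h2, h1⟩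
  have glueMV : ∀ v x u, jV v x = Ψ u →
      Relation.EqvGen (glueRel src tgt l r) ⟨.inl (), u⟩ ⟨.inr (.inr v), x⟩ := by
    intro v x u h
    obtain ⟨e, t, ht⟩ := hVM v x u h
    obtain rfl := hVV _ _ _ _ (ht.symm.trans (hr₂ e t).symm)
    obtain rfl := (hV _).injective (ht.symm.trans (hr₂ e t).symm)
    exact (glueMM u (l₂ e t) (h.symm.trans ((hr₂ e t).trans (hl₂ e t).symm))).trans _ _ _
      (.rel _ _ ⟨.inr (.inr e), t, rfl, rfl⟩)
  refine exists_fundamentalGroup_mulEquiv_freeGroup_of_atlas (Ψ := J) (src := src) (tgt := tgt)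
    (l := l) (r := r) ?_ ?_ ?_ ?_ ?_ ?_ ?_ z
  · rintro (_ | p | v)
    · exact isLocalHomeomorph_of_height hΨ hΨo hτ hker hinj
    · exact (hP p).isLocalHomeomorph
    · exact (hV v).isLocalHomeomorph
  · intro z
    obtain ⟨u, h⟩ | ⟨p, x, h⟩ | ⟨v, x, h⟩ := hcov z
    exacts [⟨.inl (), u, h⟩, ⟨.inr (.inl p), x, h⟩, ⟨.inr (.inr v), x, h⟩]
  · rintro (_ | e | e)
    exacts [hT, hl₁c e, hl₂c e]
  · rintro (_ | e | e)
    exacts [continuous_id, hr₁c e, hr₂c e]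
  · rintro (_ | e | e) t
    exacts [hTΨ t, (hl₁ e t).trans (hr₁ e t).symm, (hl₂ e t).trans (hr₂ e t).symm]
  · rintro (_ | p | v) (_ | p' | v') u w h
    · exact glueMM u w h
    · exact (hMP _ _ _ h).elim
    · exact glueMV _ _ _ h.symm
    · exact (hMP _ _ _ h.symm).elim
    · obtain rfl := hPP _ _ _ _ h
      obtain rfl := (hP p).injective h
      exact .refl _
    · exact gluePV _ _ _ _ h.symm
    · exact (glueMV _ _ _ h).symm
    · exact (gluePV _ _ _ _ h).symm
    · obtain rfl := hVV _ _ _ _ h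
      obtain rfl := (hV v).injective h
      exact .refl _
  · intro G _ a
    obtain ⟨κM, hκl, hκn, hκc⟩ := exists_height_cocycle h₂ h₂₂ hl₂c hl₂ hΨ hτ hker
      (fun e => a (.inr (.inr e))) (a (.inl ()))
    have hspec : ∀ p (y : KP p), ∃ b : G, ∀ e t, j₁ e t = jP p y → b = a (.inr (.inl e)) := by
      intro p y
      by_cases h : ∃ e t, j₁ e t = jP p y
      · obtain ⟨e, t, ht⟩ := h
        refine ⟨a (.inr (.inl e)), fun e' t' ht' => ?_⟩
        rw [h₁₁ e' e t' t (ht'.trans ht.symm)]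
      · exact ⟨1, fun e t ht => (h ⟨e, t, ht⟩).elim⟩
    choose κP hκP using hspec
    let κ : ∀ i, K i → G := fun
      | .inl _ => κM
      | .inr (.inl p) => κP p
      | .inr (.inr v) => fun _ => 1
    have locM : ∀ v x u, jV v x = Ψ u → ∀ᶠ u' in 𝓝 u, κM u' = κM u := by
      intro v x u h
      obtain ⟨e, t, ht⟩ := hVM v x u h
      exact hκc e t u (ht.trans h)
    have locP : ∀ v x p y, jV v x = jP p y → ∀ᶠ y' in 𝓝 y, κP p y' = κP p y := by
      intro v x p y h
      obtain ⟨e, t, ht⟩ := hVP v x p y h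
      have : ∀ᶠ y' in 𝓝 y, jP p y' ∈ Set.range (j₁ e) :=
        (hP p).continuous.continuousAt.eventually_mem
          ((h₁ e).isOpen_range.mem_nhds ⟨t, ht.trans h⟩)
      filter_upwards [this] with y' hy'
      obtain ⟨t', ht'⟩ := hy'
      rw [hκP p y' e t' ht', hκP p y e t (ht.trans h)]
    refine ⟨κ, ?_, ?_⟩
    · rintro (_ | e | e) t
      · exact (hκn t (T t) 1 (hTΨ t).symm ((hTτ t).trans (by simp))).trans (by rw [zpow_one]; rfl)
      · exact (hκP _ _ e t (hl₁ e t).symm).trans (one_mul _).symm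
      · exact (hκl e t).trans (one_mul _).symm
    · rintro (_ | p | v) (_ | p' | v') u₀ w₀ h
      · change M at u₀ w₀
        obtain ⟨n, hn⟩ := hker u₀ w₀ h
        have hcont : ContinuousAt (fun z : M × M => τ z.2 - τ z.1) (u₀, w₀) := by fun_prop
        filter_upwards [hcont.eventually (Metric.ball_mem_nhds _ one_pos)] with z hz hzz
        obtain ⟨m, hm⟩ := hker z.1 z.2 hzz
        change (κM z.1)⁻¹ * κM z.2 = (κM u₀)⁻¹ * κM w₀
        rw [hκn _ _ m hzz hm, hκn _ _ n h hn, inv_mul_cancel_left, inv_mul_cancel_left]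
        have hz := abs_lt.1 ((Real.dist_eq _ _).symm.trans_lt hz)
        have hm' : τ z.2 - τ z.1 = m := by rw [hm]; ring
        have hn' : τ w₀ - τ u₀ = n := by rw [hn]; ring
        rw [hm', hn'] at hz
        have h1 : m < n + 1 := by exact_mod_cast (by linarith [hz.2] : (m : ℝ) < n + 1)
        have h2 : n - 1 < m := by exact_mod_cast (by linarith [hz.1] : (n - 1 : ℝ) < m)
        rw [show m = n by omega]
      · exact (hMP _ _ _ h).elim
      · filter_upwards [continuous_fst.continuousAt.eventually (locM _ _ _ h.symm)] with z hz _
        exact congrArg (fun b => b⁻¹ * 1) hz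
      · exact (hMP _ _ _ h.symm).elim
      · obtain rfl := hPP _ _ _ _ h
        obtain rfl := (hP p).injective h
        refine .of_forall fun z hz => ?_
        obtain ⟨z₁, z₂⟩ := z
        obtain rfl : z₁ = z₂ := (hP p).injective hz
        exact (inv_mul_cancel _).trans (inv_mul_cancel _).symm
      · filter_upwards [continuous_fst.continuousAt.eventually (locP _ _ _ _ h.symm)] with z hz _
        exact congrArg (fun b => b⁻¹ * 1) hz
      · filter_upwards [continuous_snd.continuousAt.eventually (locM _ _ _ h)] with z hz _
        exact congrArg (fun b => 1⁻¹ * b) hz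
      · filter_upwards [continuous_snd.continuousAt.eventually (locP _ _ _ _ h)] with z hz _
        exact congrArg (fun b => 1⁻¹ * b) hz
      · exact .of_forall fun z _ => rfl

end Pieces

end FreeFundamentalGroups

section SunGraphs

open Topology

section ContractibleSets

theorem contractibleSpace_of_shrink {E : Type*} [AddCommGroup E] [Module ℝ E] [TopologicalSpace E]
    [ContinuousAdd E] [ContinuousSMul ℝ E] {A : Set E} (hA : A.Nonempty) {R : E → E}
    (hR : Continuous R)
    (hshrink : ∀ x ∈ A, ∀ a b : ℝ, 0 ≤ a → 0 ≤ b → a + b = 1 → a • x + b • R x ∈ A)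
    (hconv : ∀ x ∈ A, ∀ y ∈ A, ∀ a b : ℝ, 0 ≤ a → 0 ≤ b → a + b = 1 → a • R x + b • R y ∈ A) :
    ContractibleSpace A := by
  obtain ⟨x₀, hx₀⟩ := hA
  have hRA : ∀ x ∈ A, R x ∈ A := fun x hx => by
    simpa using hshrink x hx 0 1 le_rfl zero_le_one (by norm_num)
  rw [contractible_iff_id_nullhomotopic]
  refine ⟨⟨R x₀, hRA x₀ hx₀⟩, ?_⟩
  have h1 : (ContinuousMap.id A).Homotopic ⟨fun x => ⟨R x, hRA x x.2⟩, by fun_prop⟩ := ⟨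
    { toFun := fun z => ⟨(1 - (z.1 : ℝ)) • (z.2 : E) + (z.1 : ℝ) • R z.2,
        hshrink _ z.2.2 _ _ (by linarith [z.1.2.2]) z.1.2.1 (by ring)⟩
      continuous_toFun := by fun_prop
      map_zero_left := fun x => Subtype.ext (by simp)
      map_one_left := fun x => Subtype.ext (by simp) }⟩
  refine h1.trans ⟨
    { toFun := fun z => ⟨(1 - (z.1 : ℝ)) • R z.2 + (z.1 : ℝ) • R x₀,
        hconv _ z.2.2 _ hx₀ _ _ (by linarith [z.1.2.2]) z.1.2.1 (by ring)⟩
      continuous_toFun := by fun_prop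
      map_zero_left := fun x => Subtype.ext (by simp)
      map_one_left := fun x => Subtype.ext (by simp) }⟩

end ContractibleSets

section SunPoints

variable {k : ℕ}

/-- The infinite cyclic cover of a circle with unit intervals attached at the points
`c i : ℝ / ℤ`; the second coordinate of a point records the position on the intervals. -/
def sunCover (c : Fin k → ℝ) : Set (ℝ × (Fin k → ℝ)) :=
  {y | (∀ i, 0 ≤ y.2 i ∧ y.2 i ≤ 1) ∧ (∀ i, y.2 i ≠ 0 → ∃ n : ℤ, y.1 = c i + n) ∧
    ∀ i j, y.2 i ≠ 0 → y.2 j ≠ 0 → i = j}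

/-- Two points are related if they differ by a deck transformation of `sunCover`. -/
def DeckRel (y y' : ℝ × (Fin k → ℝ)) : Prop := ∃ n : ℤ, y'.1 = y.1 + n ∧ y'.2 = y.2

theorem DeckRel.refl (y : ℝ × (Fin k → ℝ)) : DeckRel y y := ⟨0, by simp, rfl⟩

theorem DeckRel.symm {y y' : ℝ × (Fin k → ℝ)} : DeckRel y y' → DeckRel y' y := by
  rintro ⟨n, h1, h2⟩
  exact ⟨-n, by rw [h1]; push_cast; ring, h2.symm⟩

theorem DeckRel.trans {y y' y'' : ℝ × (Fin k → ℝ)} :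
    DeckRel y y' → DeckRel y' y'' → DeckRel y y'' := by
  rintro ⟨n, h1, h2⟩ ⟨m, h3, h4⟩
  exact ⟨n + m, by rw [h3, h1]; push_cast; ring, h4.trans h2⟩

/-- The open legs at the vertex `v`: the attached intervals, labelled by `i : Fin k`, and the rest
of the circle, labelled by `⊤`. -/
def leg (c : Fin k → ℝ) (v : ℝ) : WithTop (Fin k) → Set (ℝ × (Fin k → ℝ))
  | (i : Fin k) => {y | c i = v ∧ |y.1 - v| < 1 ∧ 0 < y.2 i}
  | ⊤ => {y | v < y.1 ∧ y.1 < v + 1}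

/-- The distance to the vertex `v` along a leg. -/
noncomputable def reach (v : ℝ) : WithTop (Fin k) → ℝ × (Fin k → ℝ) → ℝ
  | (i : Fin k), y => y.2 i
  | ⊤, y => min (y.1 - v) (v + 1 - y.1)

/-- The distance to the vertex `v`. -/
def vertexDist (v : ℝ) (y : ℝ × (Fin k → ℝ)) : ℝ := |y.1 - v| + ∑ i, y.2 i

/-- Forget the position on the intervals attached along the circle leg. -/
def legShrink : WithTop (Fin k) → ℝ × (Fin k → ℝ) → ℝ × (Fin k → ℝ)
  | (_ : Fin k), y => y
  | ⊤, y => (y.1, 0)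

/-- The lexicographic key used to order points on the legs. -/
noncomputable def legKey (v : ℝ) (l : WithTop (Fin k)) (y : ℝ × (Fin k → ℝ)) :
    WithTop (Fin k) ×ₗ ℝ := toLex (l, reach v l y)

/-- `ε` is so small that the `2 ε`-neighbourhoods of the vertices are disjoint. -/
structure IsVertexGap (c : Fin k → ℝ) (ε : ℝ) : Prop where
  pos : 0 < ε
  le_half : ε ≤ 1 / 2
  eq_of_lt : ∀ i j (n : ℤ), |c j + n - c i| < 2 * ε → c j = c i

theorem mk_zero_mem_sunCover (c : Fin k → ℝ) (a : ℝ) : (a, (0 : Fin k → ℝ)) ∈ sunCover c := by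
  simp [sunCover]

variable {c : Fin k → ℝ} {v ε : ℝ} {y y' z z' : ℝ × (Fin k → ℝ)}

theorem mk_smul_mem_sunCover (hy : y ∈ sunCover c) {t : ℝ} (h0 : 0 ≤ t) (h1 : t ≤ 1) :
    (y.1, t • y.2) ∈ sunCover c := by
  refine ⟨fun i => ⟨mul_nonneg h0 (hy.1 i).1, mul_le_one₀ h1 (hy.1 i).1 (hy.1 i).2⟩,
    fun i hi => hy.2.1 i (right_ne_zero_of_mul hi),
    fun i j hi hj => hy.2.2 i j (right_ne_zero_of_mul hi) (right_ne_zero_of_mul hj)⟩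

theorem mk_single_mem_sunCover (i : Fin k) {t : ℝ} (h0 : 0 ≤ t) (h1 : t ≤ 1) :
    (c i, Pi.single i t) ∈ sunCover c := by
  have key : ∀ j, (Pi.single i t : Fin k → ℝ) j ≠ 0 → j = i := by
    intro j hj
    by_contra h
    exact hj (by simp [h])
  refine ⟨fun j => ?_, fun j hj => ⟨0, by simp [key j hj]⟩,
    fun j l hj hl => (key j hj).trans (key l hl).symm⟩
  by_cases h : j = i
  · subst h; simp [h0, h1]
  · simp [h]

theorem DeckRel.mem_sunCover (h : DeckRel y y') (hy : y ∈ sunCover c) : y' ∈ sunCover c := by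
  obtain ⟨n, h1, h2⟩ := h
  rw [sunCover, Set.mem_ofPred_eq, h2]
  refine ⟨hy.1, fun i hi => ?_, hy.2.2⟩
  obtain ⟨m, hm⟩ := hy.2.1 i hi
  exact ⟨m + n, by rw [h1, hm]; push_cast; ring⟩

theorem intCast_eq_zero_of_abs_lt_one {n : ℤ} (h : |(n : ℝ)| < 1) : n = 0 := by
  have : |n| < 1 := by exact_mod_cast h
  exact Int.abs_lt_one_iff.1 this

theorem eq_of_mem_leg {i : Fin k} (hy : y ∈ sunCover c) (h : y ∈ leg c v i) :
    y = (v, Pi.single i (y.2 i)) := by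
  obtain ⟨h1, h2, h3⟩ := h
  obtain ⟨n, hn⟩ := hy.2.1 i h3.ne'
  rw [hn, h1, add_sub_cancel_left] at h2
  rw [intCast_eq_zero_of_abs_lt_one h2] at hn
  refine Prod.ext (by simp [hn, h1]) (funext fun j => ?_)
  by_cases hj : j = i
  · subst hj; simp
  · simp only [Pi.single_apply, hj, if_false]
    by_contra h0
    exact hj (hy.2.2 j i h0 h3.ne')

theorem fst_eq_of_mem_leg {i : Fin k} (hy : y ∈ sunCover c) (h : y ∈ leg c v i) : y.1 = v := by
  rw [eq_of_mem_leg hy h]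

theorem reach_pos {l : WithTop (Fin k)} (h : y ∈ leg c v l) : 0 < reach v l y := by
  cases l with
  | top => exact lt_min (by linarith [h.1]) (by linarith [h.2])
  | coe i => exact h.2.2

theorem isOpen_leg (c : Fin k → ℝ) (v : ℝ) (l : WithTop (Fin k)) : IsOpen (leg c v l) := by
  cases l with
  | top =>
    change IsOpen {y : ℝ × (Fin k → ℝ) | v < y.1 ∧ y.1 < v + 1}
    refine .and (isOpen_lt ?_ ?_) (isOpen_lt ?_ ?_) <;> fun_prop
  | coe i =>
    change IsOpen {y : ℝ × (Fin k → ℝ) | c i = v ∧ |y.1 - v| < 1 ∧ 0 < y.2 i}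
    refine isOpen_const.and (.and (isOpen_lt ?_ ?_) (isOpen_lt ?_ ?_)) <;> fun_prop

theorem continuous_reach (v : ℝ) (l : WithTop (Fin k)) : Continuous (reach v l) := by
  cases l with
  | top => unfold reach; fun_prop
  | coe i => unfold reach; fun_prop

theorem continuous_vertexDist (v : ℝ) : Continuous (vertexDist (k := k) v) := by
  unfold vertexDist; fun_prop

theorem continuous_legShrink (l : WithTop (Fin k)) : Continuous (legShrink l) := by
  cases l with
  | top => unfold legShrink; fun_prop
  | coe i => unfold legShrink; fun_prop

theorem DeckRel.eq_of_mem_leg {l l' : WithTop (Fin k)} (h : DeckRel y y') (hy : y ∈ sunCover c)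
    (hl : y ∈ leg c v l) (hl' : y' ∈ leg c v l') : l = l' ∧ y = y' := by
  have hy' := h.mem_sunCover hy
  obtain ⟨n, h1, h2⟩ := h
  have hn : n = 0 → y = y' := by
    rintro rfl
    exact Prod.ext (by simp [h1]) h2.symm
  cases l with
  | top =>
    have h3 := hl.1
    have h4 := hl.2
    cases l' with
    | top =>
      have h5 := hl'.1
      have h6 := hl'.2
      refine ⟨rfl, hn (intCast_eq_zero_of_abs_lt_one (abs_lt.2 ⟨?_, ?_⟩))⟩ <;> linarith
    | coe j =>
      rw [fst_eq_of_mem_leg hy' hl'] at h1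
      have h5 : n = 0 := intCast_eq_zero_of_abs_lt_one (abs_lt.2 ⟨by linarith, by linarith⟩)
      simp only [h5, Int.cast_zero, add_zero] at h1
      linarith
  | coe i =>
    rw [fst_eq_of_mem_leg hy hl] at h1
    cases l' with
    | top =>
      have h3 := hl'.1
      have h4 := hl'.2
      have h5 : n = 0 := intCast_eq_zero_of_abs_lt_one (abs_lt.2 ⟨by linarith, by linarith⟩)
      simp only [h5, Int.cast_zero, add_zero] at h1
      linarith
    | coe j =>
      rw [fst_eq_of_mem_leg hy' hl'] at h1
      refine ⟨congrArg _ (hy.2.2 i j hl.2.2.ne' ?_), hn ?_⟩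
      · rw [← h2]; exact hl'.2.2.ne'
      · exact_mod_cast (by linarith : (n : ℝ) = 0)

theorem snd_le_vertexDist (hy : y ∈ sunCover c) (i : Fin k) : y.2 i ≤ vertexDist v y :=
  (Finset.single_le_sum (f := y.2) (fun j _ => (hy.1 j).1) (Finset.mem_univ i)).trans
    (le_add_of_nonneg_left (abs_nonneg _))

theorem abs_le_vertexDist (hy : y ∈ sunCover c) : |y.1 - v| ≤ vertexDist v y :=
  le_add_of_nonneg_right (Finset.sum_nonneg fun j _ => (hy.1 j).1)

theorem DeckRel.reach_le_vertexDist {l : WithTop (Fin k)} (h : DeckRel y y')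
    (hy : y ∈ sunCover c) (hd : vertexDist v y < 1) (hl : y' ∈ leg c v l) :
    reach v l y' ≤ vertexDist v y := by
  obtain ⟨n, h1, h2⟩ := h
  cases l with
  | top =>
    have h3 := hl.1
    have h4 := hl.2
    have h5 := (abs_le_vertexDist hy (v := v))
    have h6 := h5.trans_lt hd
    have h7 := abs_lt.1 h6
    have h8 := abs_le.1 h5
    rcases lt_trichotomy n 0 with hn | hn | hn
    · have : (n : ℝ) ≤ -1 := by exact_mod_cast (by omega : n ≤ -1)
      linarith
    · refine (min_le_left _ _).trans ?_
      simp only [hn, Int.cast_zero, add_zero] at h1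
      linarith
    · have : (1 : ℝ) ≤ n := by exact_mod_cast hn
      refine (min_le_right _ _).trans ?_
      linarith
  | coe i =>
    change y'.2 i ≤ _
    rw [h2]
    exact snd_le_vertexDist hy i

end SunPoints

section Convexity

variable {k : ℕ} {c : Fin k → ℝ} {v ε a b : ℝ} {y y' z z' : ℝ × (Fin k → ℝ)}
  {l l' : WithTop (Fin k)}

theorem vertexDist_combo_le (v : ℝ) (y z : ℝ × (Fin k → ℝ)) (ha : 0 ≤ a) (hb : 0 ≤ b)
    (hab : a + b = 1) :
    vertexDist v (a • y + b • z) ≤ a * vertexDist v y + b * vertexDist v z := by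
  have h1 : (a • y + b • z).1 - v = a * (y.1 - v) + b * (z.1 - v) := by
    simp only [Prod.fst_add, Prod.smul_fst, smul_eq_mul]
    linear_combination v * hab
  have h2 : ∑ i, (a • y + b • z).2 i = a * ∑ i, y.2 i + b * ∑ i, z.2 i := by
    simp [Finset.sum_add_distrib, Finset.mul_sum]
  have h3 := abs_add_le (a * (y.1 - v)) (b * (z.1 - v))
  rw [abs_mul, abs_mul, abs_of_nonneg ha, abs_of_nonneg hb] at h3
  unfold vertexDist
  rw [h1, h2]
  linarith

theorem combo_legShrink (hab : a + b = 1) :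
    a • y + b • legShrink ⊤ y = (y.1, a • y.2) := by
  refine Prod.ext ?_ ?_
  · simp only [legShrink, Prod.fst_add, Prod.smul_fst, smul_eq_mul]
    linear_combination y.1 * hab
  · simp [legShrink]

theorem combo_legShrink_mem (ha : 0 ≤ a) (hb : 0 ≤ b) (hab : a + b = 1) (hy : y ∈ sunCover c)
    (hl : y ∈ leg c v l) : a • y + b • legShrink l y ∈ sunCover c ∧
      a • y + b • legShrink l y ∈ leg c v l ∧
      reach v l (a • y + b • legShrink l y) = reach v l y := by
  cases l with
  | top =>
    rw [combo_legShrink hab]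
    exact ⟨mk_smul_mem_sunCover hy ha (by linarith), hl, rfl⟩
  | coe i =>
    have : a • y + b • legShrink (i : WithTop (Fin k)) y = y := Convex.combo_self hab y
    rw [this]
    exact ⟨hy, hl, rfl⟩

theorem combo_mem_of_mem_leg {i : Fin k} (ha : 0 ≤ a) (hb : 0 ≤ b) (hab : a + b = 1)
    (hy : y ∈ sunCover c) (hz : z ∈ sunCover c) (hly : y ∈ leg c v i) (hlz : z ∈ leg c v i) :
    a • y + b • z ∈ sunCover c ∧ a • y + b • z ∈ leg c v i := by
  have h1 : a • y + b • z = (c i, Pi.single i (a * y.2 i + b * z.2 i)) := by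
    rw [eq_of_mem_leg hy hly, eq_of_mem_leg hz hlz, hly.1]
    refine Prod.ext (Convex.combo_self hab v) ?_
    simp [← Pi.single_smul, ← Pi.single_add]
  have h2 : 0 < a * y.2 i + b * z.2 i := by
    rcases ha.eq_or_lt with rfl | ha
    · simpa [show b = 1 by linarith] using hlz.2.2
    · exact add_pos_of_pos_of_nonneg (mul_pos ha hly.2.2) (mul_nonneg hb hlz.2.2.le)
  rw [h1]
  refine ⟨mk_single_mem_sunCover i h2.le ?_, hly.1, ?_, ?_⟩
  · nlinarith [(hy.1 i).2, (hz.1 i).2]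
  · simp [hly.1]
  · simpa using h2

theorem combo_legShrink_legShrink_mem (ha : 0 ≤ a) (hb : 0 ≤ b) (hab : a + b = 1)
    (hy : y ∈ sunCover c) (hz : z ∈ sunCover c) (hly : y ∈ leg c v l) (hlz : z ∈ leg c v l) :
    a • legShrink l y + b • legShrink l z ∈ sunCover c ∧
      a • legShrink l y + b • legShrink l z ∈ leg c v l ∧
      a * reach v l y + b * reach v l z ≤ reach v l (a • legShrink l y + b • legShrink l z) := by
  cases l with
  | top =>
    have h1 : a • legShrink ⊤ y + b • legShrink ⊤ z = (a * y.1 + b * z.1, 0) := by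
      simp [legShrink]
    have h2 : a * reach v ⊤ y + b * reach v ⊤ z ≤
        reach v ⊤ (a • legShrink ⊤ y + b • legShrink ⊤ z) := by
      rw [h1]
      have e1 : reach v ⊤ y ≤ y.1 - v := min_le_left _ _
      have e2 : reach v ⊤ y ≤ v + 1 - y.1 := min_le_right _ _
      have e3 : reach v ⊤ z ≤ z.1 - v := min_le_left _ _
      have e4 : reach v ⊤ z ≤ v + 1 - z.1 := min_le_right _ _
      have hb' : b = 1 - a := by linarith
      subst hb'
      refine le_min ?_ ?_ <;> dsimp only <;> nlinarith
    refine ⟨h1 ▸ mk_zero_mem_sunCover c _, ?_, h2⟩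
    have h3 : 0 < a * reach v ⊤ y + b * reach v ⊤ z := by
      rcases ha.eq_or_lt with rfl | ha
      · simpa [show b = 1 by linarith] using reach_pos hlz
      · exact add_pos_of_pos_of_nonneg (mul_pos ha (reach_pos hly))
          (mul_nonneg hb (reach_pos hlz).le)
    have h4 := lt_min_iff.1 (h3.trans_le h2)
    exact ⟨by linarith [h4.1], by linarith [h4.2]⟩
  | coe i =>
    obtain ⟨h1, h2⟩ := combo_mem_of_mem_leg ha hb hab hy hz hly hlz
    exact ⟨h1, h2, le_of_eq rfl⟩

theorem legKey_combo_lt (ha : 0 ≤ a) (hb : 0 ≤ b) (hab : a + b = 1) (hl : l ≠ ⊤)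
    (hy : legKey v l y < legKey v l' y') (hz : legKey v l z < legKey v l' z') :
    legKey v l (a • legShrink l y + b • legShrink l z) <
      legKey v l' (a • legShrink l' y' + b • legShrink l' z') := by
  simp only [legKey, Prod.Lex.toLex_lt_toLex] at hy hz ⊢
  rcases hy with hy | ⟨rfl, hy⟩
  · exact .inl hy
  · refine .inr ⟨rfl, ?_⟩
    replace hz := (hz.resolve_left (lt_irrefl _)).2
    obtain ⟨i, rfl⟩ := WithTop.ne_top_iff_exists.1 hl
    simp only [reach, legShrink, Prod.snd_add, Prod.smul_snd, Pi.add_apply, Pi.smul_apply,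
      smul_eq_mul] at hy hz ⊢
    rcases ha.eq_or_lt with rfl | ha
    · simpa [show b = 1 by linarith] using hz
    · exact add_lt_add_of_lt_of_le (mul_lt_mul_of_pos_left hy ha)
        (mul_le_mul_of_nonneg_left hz.le hb)

theorem isOpen_legKey_lt (v : ℝ) (l l' : WithTop (Fin k)) {T : Type*} [TopologicalSpace T]
    {f g : T → ℝ × (Fin k → ℝ)} (hf : Continuous f) (hg : Continuous g) :
    IsOpen {x | legKey v l (f x) < legKey v l' (g x)} := by
  simp only [legKey, Prod.Lex.toLex_lt_toLex]
  rw [Set.ofPred_or]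
  exact isOpen_const.union (isOpen_const.and
    (isOpen_lt ((continuous_reach v l).comp hf) ((continuous_reach v l').comp hg)))

theorem eq_of_legKey_eq (hl : l ≠ ⊤) (hy : y ∈ sunCover c) (hy' : y' ∈ sunCover c)
    (hly : y ∈ leg c v l) (hly' : y' ∈ leg c v l') (h : legKey v l y = legKey v l' y') :
    y = y' := by
  obtain ⟨rfl, h⟩ := Prod.ext_iff.1 (toLex_inj.1 h)
  obtain ⟨i, rfl⟩ := WithTop.ne_top_iff_exists.1 hl
  rw [eq_of_mem_leg hy hly, eq_of_mem_leg hy' hly']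
  exact congrArg (fun t => (v, Pi.single i t)) h

end Convexity

section Germs

variable {k : ℕ} {c : Fin k → ℝ} {v ε a b : ℝ} {y y' z z' : ℝ × (Fin k → ℝ)}
  {l l' : WithTop (Fin k)} {g g' : Fin k ⊕ Bool}

theorem IsVertexGap.eq_of_snd_ne_zero (hε : IsVertexGap c ε) (hv : v ∈ Set.range c)
    (hy : y ∈ sunCover c) (hd : vertexDist v y < ε) {j : Fin k} (hj : y.2 j ≠ 0) :
    c j = v ∧ y.1 = v := by
  obtain ⟨i, rfl⟩ := hv
  obtain ⟨n, hn⟩ := hy.2.1 j hj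
  have h1 := (abs_le_vertexDist hy).trans_lt hd
  rw [hn] at h1
  have h2 := hε.eq_of_lt i j n (by linarith [hε.pos])
  rw [h2, add_sub_cancel_left] at h1
  have h3 := intCast_eq_zero_of_abs_lt_one (h1.trans_le (by linarith [hε.le_half]))
  exact ⟨h2, by simp [hn, h2, h3]⟩

theorem IsVertexGap.combo_vertex_mem (hε : IsVertexGap c ε) (hv : v ∈ Set.range c)
    (ha : 0 ≤ a) (hb : 0 ≤ b) (hab : a + b = 1) (hy : y ∈ sunCover c) (hd : vertexDist v y < ε) :
    a • y + b • (v, (0 : Fin k → ℝ)) ∈ sunCover c := by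
  by_cases h : y.2 = 0
  · have : a • y + b • (v, (0 : Fin k → ℝ)) = (a * y.1 + b * v, 0) := by
      ext <;> simp [h]
    rw [this]
    exact mk_zero_mem_sunCover c _
  · obtain ⟨j, hj⟩ := Function.ne_iff.1 h
    obtain ⟨-, h1⟩ := hε.eq_of_snd_ne_zero hv hy hd hj
    rw [← h1]
    have : a • y + b • (y.1, (0 : Fin k → ℝ)) = _ := combo_legShrink (y := y) hab
    rw [this]
    exact mk_smul_mem_sunCover hy ha (by linarith)

/-- The germs of edges at the vertex `v`: the attached intervals, and the two sides of the
circle. -/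
def germ (c : Fin k → ℝ) (v : ℝ) : Fin k ⊕ Bool → Set (ℝ × (Fin k → ℝ))
  | .inl i => {y | c i = v ∧ 0 < y.2 i}
  | .inr false => {y | y.1 < v}
  | .inr true => {y | v < y.1}

/-- The leg containing a germ of an edge. -/
def germLabel : Fin k ⊕ Bool → WithTop (Fin k)
  | .inl i => i
  | .inr _ => ⊤

/-- The translate of a point on a germ which lies on the corresponding leg. -/
def germRep : Fin k ⊕ Bool → ℝ × (Fin k → ℝ) → ℝ × (Fin k → ℝ)
  | .inl _, y => y
  | .inr false, y => (y.1 + 1, y.2)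
  | .inr true, y => y

theorem deckRel_germRep (g : Fin k ⊕ Bool) (y : ℝ × (Fin k → ℝ)) : DeckRel y (germRep g y) := by
  rcases g with i | (_ | _)
  exacts [.refl y, ⟨1, by simp [germRep], rfl⟩, .refl y]

theorem isOpen_germ (c : Fin k → ℝ) (v : ℝ) (g : Fin k ⊕ Bool) : IsOpen (germ c v g) := by
  rcases g with i | (_ | _)
  · change IsOpen {y : ℝ × (Fin k → ℝ) | c i = v ∧ 0 < y.2 i}
    refine isOpen_const.and (isOpen_lt ?_ ?_) <;> fun_prop
  · change IsOpen {y : ℝ × (Fin k → ℝ) | y.1 < v}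
    refine isOpen_lt ?_ ?_ <;> fun_prop
  · change IsOpen {y : ℝ × (Fin k → ℝ) | v < y.1}
    refine isOpen_lt ?_ ?_ <;> fun_prop

theorem germRep_mem_leg (hy : y ∈ sunCover c) (hd : vertexDist v y < 1)
    (hg : y ∈ germ c v g) : germRep g y ∈ leg c v (germLabel g) := by
  have h1 := (abs_le_vertexDist hy).trans_lt hd
  have h2 := abs_lt.1 h1
  rcases g with i | (_ | _)
  · exact ⟨hg.1, h1, hg.2⟩
  · have hg : y.1 < v := hg
    constructor <;> dsimp only [germRep] <;> linarith
  · have hg : v < y.1 := hg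
    constructor <;> dsimp only [germRep] <;> linarith

theorem mem_germ_inl_iff (hy : y ∈ sunCover c) (hd : vertexDist v y < 1) {i : Fin k}
    (hg : y ∈ germ c v (.inl i)) : y ∈ leg c v i :=
  germRep_mem_leg (g := .inl i) hy hd hg

theorem IsVertexGap.snd_eq_zero (hε : IsVertexGap c ε) (hv : v ∈ Set.range c)
    (hy : y ∈ sunCover c) (hd : vertexDist v y < ε) (h : y.1 ≠ v) : y.2 = 0 := by
  by_contra h0
  obtain ⟨j, hj⟩ := Function.ne_iff.1 h0
  exact h (hε.eq_of_snd_ne_zero hv hy hd hj).2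

theorem germ_unique (hy : y ∈ sunCover c) (hd : vertexDist v y < 1)
    (hg : y ∈ germ c v g) (hg' : y ∈ germ c v g') : g = g' := by
  rcases g with i | s
  · have h1 := fst_eq_of_mem_leg hy (mem_germ_inl_iff hy hd hg)
    rcases g' with j | (_ | _)
    · rw [hy.2.2 i j hg.2.ne' hg'.2.ne']
    · exact ((show y.1 < v from hg').ne h1).elim
    · exact ((show v < y.1 from hg').ne' h1).elim
  · rcases g' with j | s'
    · have h1 := fst_eq_of_mem_leg hy (mem_germ_inl_iff hy hd hg')
      rcases s with _ | _
      · exact ((show y.1 < v from hg).ne h1).elim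
      · exact ((show v < y.1 from hg).ne' h1).elim
    · rcases s with _ | _ <;> rcases s' with _ | _
      · rfl
      · exact ((show y.1 < v from hg).asymm hg').elim
      · exact ((show v < y.1 from hg).asymm hg').elim
      · rfl

theorem DeckRel.exists_mem_germ (h : DeckRel y y') (hl : y' ∈ leg c v l) :
    ∃ g, y ∈ germ c v g := by
  obtain ⟨n, h1, h2⟩ := h
  rcases lt_trichotomy y.1 v with h3 | h3 | h3
  · exact ⟨.inr false, h3⟩
  · cases l with
    | top =>
      have h4 := hl.1
      have h5 := hl.2
      rw [h1, h3] at h4 h5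
      have h6 : n = 0 := intCast_eq_zero_of_abs_lt_one (abs_lt.2 ⟨by linarith, by linarith⟩)
      simp [h6] at h4
    | coe i => exact ⟨.inl i, hl.1, h2 ▸ hl.2.2⟩
  · exact ⟨.inr true, h3⟩

theorem IsVertexGap.combo_mem_germ (hε : IsVertexGap c ε) (hv : v ∈ Set.range c)
    (ha : 0 ≤ a) (hb : 0 ≤ b) (hab : a + b = 1) (hy : y ∈ sunCover c) (hz : z ∈ sunCover c)
    (hdy : vertexDist v y < ε) (hdz : vertexDist v z < ε) (hgy : y ∈ germ c v g)
    (hgz : z ∈ germ c v g) : a • y + b • z ∈ sunCover c ∧ a • y + b • z ∈ germ c v g := by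
  have h1 : ε < 1 := by linarith [hε.le_half]
  rcases g with i | s
  · obtain ⟨h2, h3⟩ := combo_mem_of_mem_leg ha hb hab hy hz
      (mem_germ_inl_iff hy (hdy.trans h1) hgy) (mem_germ_inl_iff hz (hdz.trans h1) hgz)
    exact ⟨h2, h3.1, h3.2.2⟩
  · have h2 : a • y + b • z = (a * y.1 + b * z.1, 0) := by
      have hy0 : y.2 = 0 := hε.snd_eq_zero hv hy hdy (by
        rcases s with _ | _
        exacts [(show y.1 < v from hgy).ne, (show v < y.1 from hgy).ne'])
      have hz0 : z.2 = 0 := hε.snd_eq_zero hv hz hdz (by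
        rcases s with _ | _
        exacts [(show z.1 < v from hgz).ne, (show v < z.1 from hgz).ne'])
      ext <;> simp [hy0, hz0]
    refine ⟨h2 ▸ mk_zero_mem_sunCover c _, ?_⟩
    rcases s with _ | _
    · exact convex_Iio v (show y.1 < v from hgy) (show z.1 < v from hgz) ha hb hab
    · exact convex_Ioi v (show v < y.1 from hgy) (show v < z.1 from hgz) ha hb hab

end Germs

section Configurations

variable {k : ℕ} {c : Fin k → ℝ} {v v' ε a b : ℝ} {w w' x : Fin 3 → ℝ × (Fin k → ℝ)}
  {l l' m m' : WithTop (Fin k)} {L L' : Fin 3 → WithTop (Fin k)} {g g' : Fin k ⊕ Bool}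

/-- Triples of points of `sunCover c` with distinct images in the quotient. -/
def sunConf (c : Fin k → ℝ) : Set (Fin 3 → ℝ × (Fin k → ℝ)) :=
  {w | (∀ s, w s ∈ sunCover c) ∧ ∀ s t, DeckRel (w s) (w t) → s = t}

/-- Two triples represent the same unordered configuration. -/
def ConfRel (w w' : Fin 3 → ℝ × (Fin k → ℝ)) : Prop :=
  ∃ σ : Equiv.Perm (Fin 3), ∀ s, DeckRel (w (σ s)) (w' s)

theorem ConfRel.symm : ConfRel w w' → ConfRel w' w := by
  rintro ⟨σ, h⟩
  exact ⟨σ.symm, fun s => by simpa using (h (σ.symm s)).symm⟩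

theorem ConfRel.mem_sunConf (h : ConfRel w w') (hw : w ∈ sunConf c) : w' ∈ sunConf c := by
  obtain ⟨σ, h⟩ := h
  refine ⟨fun s => (h s).mem_sunCover (hw.1 _), fun s t hst => ?_⟩
  exact σ.injective (hw.2 _ _ ((h s).trans (hst.trans (h t).symm)))

/-- Triples of points with distinct first coordinates, in cyclic order. -/
def cyclicSet (k : ℕ) : Set (Fin 3 → ℝ × (Fin k → ℝ)) :=
  {w | (w 0).1 < (w 1).1 ∧ (w 1).1 < (w 2).1 ∧ (w 2).1 < (w 0).1 + 1}

/-- Triples of points on the legs at `v`, in increasing order. -/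
def legSet (c : Fin k → ℝ) (v : ℝ) (L : Fin 3 → WithTop (Fin k)) :
    Set (Fin 3 → ℝ × (Fin k → ℝ)) :=
  {w | (∀ s, w s ∈ leg c v (L s)) ∧ ∀ s t, s < t → legKey v (L s) (w s) < legKey v (L t) (w t)}

/-- Triples whose first point is close to `v`, and closer than the two others, which lie on legs
at `v`, in increasing order. -/
def vertexSet (c : Fin k → ℝ) (ε v : ℝ) (l m : WithTop (Fin k)) :
    Set (Fin 3 → ℝ × (Fin k → ℝ)) :=
  {w | vertexDist v (w 0) < ε ∧ w 1 ∈ leg c v l ∧ w 2 ∈ leg c v m ∧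
    vertexDist v (w 0) < reach v l (w 1) ∧ vertexDist v (w 0) < reach v m (w 2) ∧
    legKey v l (w 1) < legKey v m (w 2)}

theorem isOpen_cyclicSet : IsOpen (cyclicSet k) := by
  refine .and (isOpen_lt ?_ ?_) (.and (isOpen_lt ?_ ?_) (isOpen_lt ?_ ?_)) <;> fun_prop

theorem isOpen_legSet : IsOpen (legSet c v L) := by
  rw [legSet, Set.ofPred_and]
  simp only [Set.ofPred_forall]
  refine .inter (isOpen_iInter_of_finite fun s => (isOpen_leg c v (L s)).preimage (by fun_prop))
    (isOpen_iInter_of_finite fun s => isOpen_iInter_of_finite fun t =>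
      isOpen_iInter_of_finite fun _ => isOpen_legKey_lt v _ _ (by fun_prop) (by fun_prop))

theorem isOpen_vertexSet : IsOpen (vertexSet c ε v l m) := by
  have h0 : Continuous fun w : Fin 3 → ℝ × (Fin k → ℝ) => vertexDist v (w 0) :=
    (continuous_vertexDist v).comp (by fun_prop)
  refine .and (isOpen_lt h0 continuous_const)
    (.and ((isOpen_leg c v l).preimage (f := fun w : Fin 3 → ℝ × (Fin k → ℝ) => w 1) (by fun_prop))
    (.and ((isOpen_leg c v m).preimage (f := fun w : Fin 3 → ℝ × (Fin k → ℝ) => w 2) (by fun_prop))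
    (.and (isOpen_lt h0 ((continuous_reach v l).comp (by fun_prop)))
    (.and (isOpen_lt h0 ((continuous_reach v m).comp (by fun_prop)))
    (isOpen_legKey_lt v _ _ (by fun_prop) (by fun_prop))))))

theorem abs_sub_lt_one_of_cyclicSet (h : w ∈ cyclicSet k) (s t : Fin 3) :
    |(w s).1 - (w t).1| < 1 := by
  obtain ⟨h1, h2, h3⟩ := h
  rw [abs_lt]
  constructor <;> fin_cases s <;> fin_cases t <;> simp <;> linarith

theorem eq_of_fst_eq_of_cyclicSet (h : w ∈ cyclicSet k) {s t : Fin 3} (hst : (w s).1 = (w t).1) :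
    s = t := by
  obtain ⟨h1, h2, h3⟩ := h
  fin_cases s <;> fin_cases t <;> simp at hst ⊢ <;> linarith

theorem mem_sunConf_of_cyclicSet (hw : ∀ s, w s ∈ sunCover c) (h : w ∈ cyclicSet k) :
    w ∈ sunConf c := by
  refine ⟨hw, fun s t ⟨n, hn, _⟩ => ?_⟩
  have hn0 : n = 0 := by
    refine intCast_eq_zero_of_abs_lt_one ?_
    rw [show (n : ℝ) = (w t).1 - (w s).1 by linarith]
    exact abs_sub_lt_one_of_cyclicSet h t s
  exact eq_of_fst_eq_of_cyclicSet h (by simpa [hn0] using hn.symm)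

theorem mem_sunConf_of_legSet (hw : ∀ s, w s ∈ sunCover c) (h : w ∈ legSet c v L) :
    w ∈ sunConf c := by
  refine ⟨hw, fun s t hst => ?_⟩
  obtain ⟨h1, h2⟩ := hst.eq_of_mem_leg (hw s) (h.1 s) (h.1 t)
  by_contra hne
  rcases lt_or_gt_of_ne hne with hlt | hlt
  · have := h.2 s t hlt
    rw [h1, h2] at this
    exact lt_irrefl _ this
  · have := h.2 t s hlt
    rw [h1, h2] at this
    exact lt_irrefl _ this

theorem vertexDist_lt_one (hε : IsVertexGap c ε) (hw : w ∈ vertexSet c ε v l m) :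
    vertexDist v (w 0) < 1 := hw.1.trans (by linarith [hε.le_half])

theorem mem_sunConf_of_vertexSet (hε : IsVertexGap c ε) (hw : ∀ s, w s ∈ sunCover c)
    (h : w ∈ vertexSet c ε v l m) : w ∈ sunConf c := by
  have hd := vertexDist_lt_one hε h
  obtain ⟨h0, h1, h2, h3, h4, h5⟩ := h
  have h01 : ¬DeckRel (w 0) (w 1) := fun h =>
    (h.reach_le_vertexDist (hw 0) hd h1).not_gt h3
  have h02 : ¬DeckRel (w 0) (w 2) := fun h =>
    (h.reach_le_vertexDist (hw 0) hd h2).not_gt h4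
  have h12 : ¬DeckRel (w 1) (w 2) := fun h => by
    obtain ⟨rfl, h⟩ := h.eq_of_mem_leg (hw 1) h1 h2
    rw [h] at h5
    exact lt_irrefl _ h5
  refine ⟨hw, fun s t hst => ?_⟩
  fin_cases s <;> fin_cases t <;> simp at hst ⊢
  exacts [h01 hst, h02 hst, h01 hst.symm, h12 hst, h02 hst.symm, h12 hst.symm]

theorem simplyConnectedSpace_cyclicSet : SimplyConnectedSpace ↥(sunConf c ∩ cyclicSet k) := by
  have : ContractibleSpace ↥(sunConf c ∩ cyclicSet k) := by
    refine contractibleSpace_of_shrink (R := fun w s => ((w s).1, 0)) ?_ (by fun_prop) ?_ ?_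
    · have h : (![(0, 0), (1 / 3, 0), (2 / 3, 0)] : Fin 3 → ℝ × (Fin k → ℝ)) ∈ cyclicSet k := by
        simp only [cyclicSet, Set.mem_ofPred_eq, Matrix.cons_val]
        norm_num
      refine ⟨_, mem_sunConf_of_cyclicSet (fun s => ?_) h, h⟩
      fin_cases s <;> exact mk_zero_mem_sunCover c _
    · rintro w ⟨hw, h⟩ a b ha hb hab
      have key : ∀ s, (a • w + b • fun s => ((w s).1, (0 : Fin k → ℝ))) s =
          ((w s).1, a • (w s).2) := fun s => combo_legShrink hab
      have h' : (a • w + b • fun s => ((w s).1, (0 : Fin k → ℝ))) ∈ cyclicSet k := by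
        simpa only [cyclicSet, Set.mem_ofPred_eq, key] using h
      refine ⟨mem_sunConf_of_cyclicSet (fun s => ?_) h', h'⟩
      rw [key]
      exact mk_smul_mem_sunCover (hw.1 s) ha (by linarith)
    · rintro w ⟨-, h1, h2, h3⟩ w' ⟨-, h1', h2', h3'⟩ a b ha hb hab
      have key : ∀ s, (a • (fun s => ((w s).1, (0 : Fin k → ℝ))) +
          b • fun s => ((w' s).1, (0 : Fin k → ℝ))) s = (a * (w s).1 + b * (w' s).1, 0) := by
        intro s
        simp
      have h' : (a • (fun s => ((w s).1, (0 : Fin k → ℝ))) +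
          b • fun s => ((w' s).1, (0 : Fin k → ℝ))) ∈ cyclicSet k := by
        simp only [cyclicSet, Set.mem_ofPred_eq, key]
        have hb' : b = 1 - a := by linarith
        rcases ha.eq_or_lt with rfl | ha
        · simp [hb', h1', h2', h3']
        · subst hb'
          refine ⟨?_, ?_, ?_⟩ <;> nlinarith
      refine ⟨mem_sunConf_of_cyclicSet (fun s => ?_) h', h'⟩
      rw [key]
      exact mk_zero_mem_sunCover c _
  infer_instance

theorem simplyConnectedSpace_legSet (hL : ∀ s t, s < t → L s ≠ ⊤)
    (hne : (sunConf c ∩ legSet c v L).Nonempty) :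
    SimplyConnectedSpace ↥(sunConf c ∩ legSet c v L) := by
  have : ContractibleSpace ↥(sunConf c ∩ legSet c v L) := by
    refine contractibleSpace_of_shrink (R := fun w s => legShrink (L s) (w s)) hne
      (continuous_pi fun s => (continuous_legShrink (L s)).comp (continuous_apply s)) ?_ ?_
    · rintro w ⟨hw, h⟩ a b ha hb hab
      have key := fun s => combo_legShrink_mem ha hb hab (hw.1 s) (h.1 s)
      have h' : (a • w + b • fun s => legShrink (L s) (w s)) ∈ legSet c v L := by
        refine ⟨fun s => (key s).2.1, fun s t hst => ?_⟩
        have := h.2 s t hst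
        rw [legKey, legKey, ← (key s).2.2, ← (key t).2.2] at this
        exact this
      exact ⟨mem_sunConf_of_legSet (fun s => (key s).1) h', h'⟩
    · rintro w ⟨hw, h⟩ w' ⟨hw', h'⟩ a b ha hb hab
      have key := fun s =>
        combo_legShrink_legShrink_mem ha hb hab (hw.1 s) (hw'.1 s) (h.1 s) (h'.1 s)
      have h'' : (a • (fun s => legShrink (L s) (w s)) + b • fun s => legShrink (L s) (w' s)) ∈
          legSet c v L := by
        refine ⟨fun s => (key s).2.1, fun s t hst => ?_⟩
        exact legKey_combo_lt ha hb hab (hL s t hst) (h.2 s t hst) (h'.2 s t hst)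
      exact ⟨mem_sunConf_of_legSet (fun s => (key s).1) h'', h''⟩
  infer_instance

theorem simplyConnectedSpace_vertexSet (hε : IsVertexGap c ε) (hv : v ∈ Set.range c) (hl : l ≠ ⊤)
    (hne : (sunConf c ∩ vertexSet c ε v l m).Nonempty) :
    SimplyConnectedSpace ↥(sunConf c ∩ vertexSet c ε v l m) := by
  have hd0 : vertexDist v (v, (0 : Fin k → ℝ)) = 0 := by simp [vertexDist]
  have : ContractibleSpace ↥(sunConf c ∩ vertexSet c ε v l m) := by
    refine contractibleSpace_of_shrink
      (R := fun w => ![(v, 0), legShrink l (w 1), legShrink m (w 2)]) hne ?_ ?_ ?_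
    · have h1 := (continuous_legShrink l).comp
        (continuous_apply (A := fun _ : Fin 3 => ℝ × (Fin k → ℝ)) 1)
      have h2 := (continuous_legShrink m).comp
        (continuous_apply (A := fun _ : Fin 3 => ℝ × (Fin k → ℝ)) 2)
      refine continuous_pi fun s => ?_
      fin_cases s
      exacts [continuous_const, h1, h2]
    · rintro w ⟨hw, h0, h1, h2, h3, h4, h5⟩ a b ha hb hab
      set u := a • w + b • ![(v, (0 : Fin k → ℝ)), legShrink l (w 1), legShrink m (w 2)] with hu
      have key0 := hε.combo_vertex_mem hv ha hb hab (hw.1 0) h0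
      have key1 := combo_legShrink_mem ha hb hab (hw.1 1) h1
      have key2 := combo_legShrink_mem ha hb hab (hw.1 2) h2
      have hr := vertexDist_combo_le v (w 0) (v, 0) ha hb hab
      have hpos : 0 ≤ vertexDist v (w 0) := (abs_nonneg _).trans (abs_le_vertexDist (hw.1 0))
      replace hr : vertexDist v (u 0) ≤ vertexDist v (w 0) := by
        refine hr.trans ?_
        rw [hd0]
        nlinarith
      have h' : u ∈ vertexSet c ε v l m := by
        refine ⟨hr.trans_lt h0, key1.2.1, key2.2.1, ?_, ?_, ?_⟩
        · exact (hr.trans_lt h3).trans_eq key1.2.2.symm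
        · exact (hr.trans_lt h4).trans_eq key2.2.2.symm
        · rw [legKey, legKey, ← key1.2.2, ← key2.2.2] at h5
          exact h5
      refine ⟨mem_sunConf_of_vertexSet hε (fun s => ?_) h', h'⟩
      fin_cases s
      exacts [key0, key1.1, key2.1]
    · rintro w ⟨hw, h0, h1, h2, h3, h4, h5⟩ w' ⟨hw', h0', h1', h2', h3', h4', h5'⟩ a b ha hb hab
      set u := a • ![(v, (0 : Fin k → ℝ)), legShrink l (w 1), legShrink m (w 2)] +
        b • ![(v, (0 : Fin k → ℝ)), legShrink l (w' 1), legShrink m (w' 2)] with hu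
      have hu0 : u 0 = (v, 0) := Convex.combo_self hab _
      have key1 := combo_legShrink_legShrink_mem ha hb hab (hw.1 1) (hw'.1 1) h1 h1'
      have key2 := combo_legShrink_legShrink_mem ha hb hab (hw.1 2) (hw'.1 2) h2 h2'
      have h' : u ∈ vertexSet c ε v l m := by
        refine ⟨?_, key1.2.1, key2.2.1, ?_, ?_, legKey_combo_lt ha hb hab hl h5 h5'⟩ <;>
          rw [hu0, hd0]
        exacts [hε.pos, reach_pos key1.2.1, reach_pos key2.2.1]
      refine ⟨mem_sunConf_of_vertexSet hε (fun s => ?_) h', h'⟩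
      fin_cases s
      exacts [hu0 ▸ mk_zero_mem_sunCover c v, key1.1, key2.1]
  infer_instance

theorem pathConnectedSpace_edgeSet (hε : IsVertexGap c ε) (hv : v ∈ Set.range c) (hl : l ≠ ⊤)
    (hne : (sunConf c ∩ (vertexSet c ε v l m ∩ {w | w 0 ∈ germ c v g})).Nonempty) :
    PathConnectedSpace ↥(sunConf c ∩ (vertexSet c ε v l m ∩ {w | w 0 ∈ germ c v g})) := by
  have : ContractibleSpace ↥(sunConf c ∩ (vertexSet c ε v l m ∩ {w | w 0 ∈ germ c v g})) := by
    refine contractibleSpace_of_shrink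
      (R := fun w => ![w 0, legShrink l (w 1), legShrink m (w 2)]) hne ?_ ?_ ?_
    · have h1 := (continuous_legShrink l).comp
        (continuous_apply (A := fun _ : Fin 3 => ℝ × (Fin k → ℝ)) 1)
      have h2 := (continuous_legShrink m).comp
        (continuous_apply (A := fun _ : Fin 3 => ℝ × (Fin k → ℝ)) 2)
      refine continuous_pi fun s => ?_
      fin_cases s
      exacts [continuous_apply (A := fun _ : Fin 3 => ℝ × (Fin k → ℝ)) 0, h1, h2]
    · rintro w ⟨hw, ⟨h0, h1, h2, h3, h4, h5⟩, hg⟩ a b ha hb hab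
      set u := a • w + b • ![w 0, legShrink l (w 1), legShrink m (w 2)] with hu
      have hu0 : u 0 = w 0 := Convex.combo_self hab _
      have key1 := combo_legShrink_mem ha hb hab (hw.1 1) h1
      have key2 := combo_legShrink_mem ha hb hab (hw.1 2) h2
      have h' : u ∈ vertexSet c ε v l m := by
        refine ⟨by rwa [hu0], key1.2.1, key2.2.1, ?_, ?_, ?_⟩
        · rw [hu0]
          exact h3.trans_eq key1.2.2.symm
        · rw [hu0]
          exact h4.trans_eq key2.2.2.symm
        · rw [legKey, legKey, ← key1.2.2, ← key2.2.2] at h5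
          exact h5
      refine ⟨mem_sunConf_of_vertexSet hε (fun s => ?_) h', h', ?_⟩
      · fin_cases s
        exacts [hu0 ▸ hw.1 0, key1.1, key2.1]
      · rw [Set.mem_ofPred_eq, hu0]
        exact hg
    · rintro w ⟨hw, ⟨h0, h1, h2, h3, h4, h5⟩, hg⟩ w' ⟨hw', ⟨h0', h1', h2', h3', h4', h5'⟩, hg'⟩
        a b ha hb hab
      set u := a • ![w 0, legShrink l (w 1), legShrink m (w 2)] +
        b • ![w' 0, legShrink l (w' 1), legShrink m (w' 2)] with hu
      have key0 := hε.combo_mem_germ hv ha hb hab (hw.1 0) (hw'.1 0) h0 h0' hg hg'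
      have key1 := combo_legShrink_legShrink_mem ha hb hab (hw.1 1) (hw'.1 1) h1 h1'
      have key2 := combo_legShrink_legShrink_mem ha hb hab (hw.1 2) (hw'.1 2) h2 h2'
      have hr := vertexDist_combo_le v (w 0) (w' 0) ha hb hab
      have combo : ∀ {p q p' q' : ℝ}, p < q → p' < q' → a * p + b * p' < a * q + b * q' := by
        intro p q p' q' h h'
        rcases ha.eq_or_lt with rfl | ha
        · simpa [show b = 1 by linarith] using h'
        · exact add_lt_add_of_lt_of_le (mul_lt_mul_of_pos_left h ha)
            (mul_le_mul_of_nonneg_left h'.le hb)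
      have h' : u ∈ vertexSet c ε v l m := by
        refine ⟨hr.trans_lt ((combo h0 h0').trans_eq ?_), key1.2.1, key2.2.1,
          (hr.trans_lt (combo h3 h3')).trans_le key1.2.2,
          (hr.trans_lt (combo h4 h4')).trans_le key2.2.2,
          legKey_combo_lt ha hb hab hl h5 h5'⟩
        rw [← add_mul, hab, one_mul]
      refine ⟨mem_sunConf_of_vertexSet hε (fun s => ?_) h', h', key0.2⟩
      fin_cases s
      exacts [key0.1, key1.1, key2.1]
  infer_instance

end Configurations

section Incidence

variable {k : ℕ} {c : Fin k → ℝ} {v v' ε : ℝ} {w w' : Fin 3 → ℝ × (Fin k → ℝ)}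
  {y y' : ℝ × (Fin k → ℝ)} {l l' m m' : WithTop (Fin k)} {L L' : Fin 3 → WithTop (Fin k)}

theorem perm_eq_one_of_lt (σ : Equiv.Perm (Fin 3)) (h : ∀ s t, s < t → σ s < σ t) : σ = 1 := by
  revert σ
  decide

theorem IsVertexGap.eq_of_abs_lt (hε : IsVertexGap c ε) (hv : v ∈ Set.range c)
    (hv' : v' ∈ Set.range c) (h : DeckRel y y') (hd : |y.1 - v| < ε) (hd' : |y'.1 - v'| < ε) :
    v = v' := by
  obtain ⟨i, rfl⟩ := hv
  obtain ⟨j, rfl⟩ := hv'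
  obtain ⟨n, h1, -⟩ := h
  have h2 := abs_lt.1 hd
  have h3 := abs_lt.1 hd'
  refine hε.eq_of_lt j i n (abs_lt.2 ⟨?_, ?_⟩) <;> linarith

theorem abs_fst_sub_lt (hε : IsVertexGap c ε) (hy : y ∈ sunCover c) (hl : y ∈ leg c v l)
    (htop : l ≠ ⊤) : |y.1 - v| < ε := by
  obtain ⟨i, rfl⟩ := WithTop.ne_top_iff_exists.1 htop
  simpa [fst_eq_of_mem_leg hy hl] using hε.pos

theorem ConfRel.eq_of_legSet (hr : ConfRel w w') (hw : w ∈ sunConf c) (h : w ∈ legSet c v L)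
    (h' : w' ∈ legSet c v L') : L = L' ∧ w = w' := by
  obtain ⟨σ, hσ⟩ := hr
  have key := fun s => (hσ s).eq_of_mem_leg (hw.1 _) (h.1 (σ s)) (h'.1 s)
  have hone : σ = 1 := by
    refine perm_eq_one_of_lt σ fun s t hst => ?_
    by_contra hlt
    have hlt' : σ t < σ s := lt_of_le_of_ne (not_lt.1 hlt) fun e => hst.ne' (σ.injective e)
    have h1 := h.2 _ _ hlt'
    rw [(key s).1, (key s).2, (key t).1, (key t).2] at h1
    exact lt_asymm h1 (h'.2 s t hst)
  subst hone
  exact ⟨funext fun s => (key s).1, funext fun s => (key s).2⟩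

theorem ConfRel.vertex_eq_of_legSet (hr : ConfRel w w') (hε : IsVertexGap c ε)
    (hv : v ∈ Set.range c) (hv' : v' ∈ Set.range c) (hw : w ∈ sunConf c) (h : w ∈ legSet c v L)
    (h' : w' ∈ legSet c v' L') (hL : ∀ s t, s < t → L s ≠ ⊤) (hL' : ∀ s t, s < t → L' s ≠ ⊤) :
    v = v' := by
  have hw' := hr.mem_sunConf hw
  obtain ⟨σ, hσ⟩ := hr
  obtain ⟨s, h1, h2⟩ : ∃ s, s < 2 ∧ σ s < 2 := by
    clear hσ
    revert σ
    decide
  exact hε.eq_of_abs_lt hv hv' (hσ s) (abs_fst_sub_lt hε (hw.1 _) (h.1 _) (hL _ _ h2))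
    (abs_fst_sub_lt hε (hw'.1 _) (h'.1 _) (hL' _ _ h1))

theorem exists_leg_of_vertexSet (h : w ∈ vertexSet c ε v l m) {s : Fin 3} (hs : s ≠ 0) :
    ∃ l', w s ∈ leg c v l' ∧ vertexDist v (w 0) < reach v l' (w s) := by
  obtain ⟨-, h1, h2, h3, h4, -⟩ := h
  fin_cases s
  exacts [(hs rfl).elim, ⟨l, h1, h3⟩, ⟨m, h2, h4⟩]

theorem abs_fst_sub_lt_of_vertexSet (hw : w ∈ sunConf c) (h : w ∈ vertexSet c ε v l m) :
    |(w 0).1 - v| < ε :=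
  (abs_le_vertexDist (hw.1 0)).trans_lt h.1

theorem ConfRel.vertex_eq_of_vertexSet (hr : ConfRel w w') (hε : IsVertexGap c ε)
    (hv : v ∈ Set.range c) (hv' : v' ∈ Set.range c) (hw : w ∈ sunConf c)
    (h : w ∈ vertexSet c ε v l m) (h' : w' ∈ vertexSet c ε v' l' m') (hl : l ≠ ⊤) (hl' : l' ≠ ⊤) :
    v = v' := by
  have hw' := hr.mem_sunConf hw
  obtain ⟨σ, hσ⟩ := hr
  obtain ⟨s, h1, h2⟩ : ∃ s, s < 2 ∧ σ s < 2 := by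
    clear hσ
    revert σ
    decide
  have key : ∀ {w : Fin 3 → ℝ × (Fin k → ℝ)} {v l m}, w ∈ sunConf c → w ∈ vertexSet c ε v l m →
      l ≠ ⊤ → ∀ s < 2, |(w s).1 - v| < ε := by
    intro w v l m hw h hl s hs
    obtain rfl | rfl : s = 0 ∨ s = 1 := by
      revert s
      decide
    · exact abs_fst_sub_lt_of_vertexSet hw h
    · exact abs_fst_sub_lt hε (hw.1 1) h.2.1 hl
  exact hε.eq_of_abs_lt hv hv' (hσ s) (key hw h hl _ h2) (key hw' h' hl' _ h1)

theorem ConfRel.eq_of_vertexSet (hr : ConfRel w w') (hε : IsVertexGap c ε) (hw : w ∈ sunConf c)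
    (h : w ∈ vertexSet c ε v l m) (h' : w' ∈ vertexSet c ε v l' m') :
    l = l' ∧ m = m' ∧ w = w' := by
  have hw' := hr.mem_sunConf hw
  obtain ⟨σ, hσ⟩ := hr
  have h0 : σ 0 = 0 := by
    by_contra h0
    obtain ⟨l₁, h1, h2⟩ := exists_leg_of_vertexSet h h0
    have h3 := (hσ 0).symm.reach_le_vertexDist (hw'.1 0) (vertexDist_lt_one hε h') h1
    have h0' : σ.symm 0 ≠ 0 := fun e => h0 (by rw [← e, σ.apply_symm_apply, e])
    obtain ⟨l₂, h4, h5⟩ := exists_leg_of_vertexSet h' h0'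
    have h6 := hσ (σ.symm 0)
    rw [σ.apply_symm_apply] at h6
    have h7 := h6.reach_le_vertexDist (hw.1 0) (vertexDist_lt_one hε h) h4
    linarith
  have e0 : w 0 = w' 0 := by
    have h1 := hσ 0
    rw [h0] at h1
    obtain ⟨n, h2, h3⟩ := h1
    have h4 := abs_lt.1 (abs_fst_sub_lt_of_vertexSet hw h)
    have h5 := abs_lt.1 (abs_fst_sub_lt_of_vertexSet hw' h')
    have h6 : n = 0 := intCast_eq_zero_of_abs_lt_one
      (abs_lt.2 ⟨by linarith [hε.le_half], by linarith [hε.le_half]⟩)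
    exact Prod.ext (by simp [h2, h6]) h3.symm
  obtain ⟨-, h1, h2, -, -, h3⟩ := h
  obtain ⟨-, h1', h2', -, -, h3'⟩ := h'
  obtain ⟨ha, hb⟩ | ⟨ha, hb⟩ : (σ 1 = 1 ∧ σ 2 = 2) ∨ (σ 1 = 2 ∧ σ 2 = 1) := by
    clear hσ
    revert σ
    decide
  · have e1 := hσ 1
    have e2 := hσ 2
    rw [ha] at e1
    rw [hb] at e2
    obtain ⟨f1, f2⟩ := e1.eq_of_mem_leg (hw.1 1) h1 h1'
    obtain ⟨f3, f4⟩ := e2.eq_of_mem_leg (hw.1 2) h2 h2'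
    refine ⟨f1, f3, funext fun s => ?_⟩
    fin_cases s
    exacts [e0, f2, f4]
  · have e1 := hσ 1
    have e2 := hσ 2
    rw [ha] at e1
    rw [hb] at e2
    obtain ⟨f1, f2⟩ := e1.eq_of_mem_leg (hw.1 2) h2 h1'
    obtain ⟨f3, f4⟩ := e2.eq_of_mem_leg (hw.1 1) h1 h2'
    rw [f1, f2, f3, f4] at h3
    exact (lt_asymm h3 h3').elim

theorem ConfRel.vertex_eq_of_vertexSet_of_legSet (hr : ConfRel w w') (hε : IsVertexGap c ε)
    (hv : v ∈ Set.range c) (hv' : v' ∈ Set.range c) (hw : w ∈ sunConf c)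
    (h : w ∈ vertexSet c ε v l m) (h' : w' ∈ legSet c v' L') (hl : l ≠ ⊤)
    (hL' : ∀ s t, s < t → L' s ≠ ⊤) : v = v' := by
  have hw' := hr.mem_sunConf hw
  obtain ⟨σ, hσ⟩ := hr
  obtain ⟨s, h1, h2⟩ : ∃ s, s < 2 ∧ (σ s = 0 ∨ σ s = 1) := by
    clear hσ
    revert σ
    decide
  refine hε.eq_of_abs_lt hv hv' (hσ s) ?_ (abs_fst_sub_lt hε (hw'.1 _) (h'.1 _) (hL' _ _ h1))
  rcases h2 with h2 | h2 <;> rw [h2]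
  · exact abs_fst_sub_lt_of_vertexSet hw h
  · exact abs_fst_sub_lt hε (hw.1 1) h.2.1 hl

theorem ConfRel.exists_germ_of_legSet (hr : ConfRel w w') (hε : IsVertexGap c ε)
    (hw : w ∈ sunConf c) (h : w ∈ vertexSet c ε v l m) (h' : w' ∈ legSet c v L')
    (hL' : ∀ s t, s < t → L' s ≠ ⊤) :
    ∃ g, w 0 ∈ germ c v g ∧ ¬(m = ⊤ ∧ germLabel g = ⊤) := by
  obtain ⟨σ, hσ⟩ := hr
  have h0 := hσ (σ.symm 0)
  have h2 := hσ (σ.symm 2)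
  rw [σ.apply_symm_apply] at h0 h2
  obtain ⟨g, hg⟩ := h0.exists_mem_germ (h'.1 _)
  refine ⟨g, hg, fun ⟨hm, hgt⟩ => ?_⟩
  have hlast : ∀ s, L' s = ⊤ → s = 2 := by
    intro s hs
    by_contra hne
    exact hL' s 2 (lt_of_le_of_ne (Fin.le_last s) hne) hs
  have h3 := ((deckRel_germRep g (w 0)).symm.trans h0).eq_of_mem_leg
    ((deckRel_germRep g (w 0)).mem_sunCover (hw.1 0))
    (germRep_mem_leg (hw.1 0) (vertexDist_lt_one hε h) hg) (h'.1 _)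
  have h4 := h2.eq_of_mem_leg (hw.1 2) h.2.2.1 (h'.1 _)
  have h5 := hlast _ (h3.1.symm.trans hgt)
  have h6 := hlast _ (h4.1.symm.trans hm)
  exact absurd (σ.symm.injective (h5.trans h6.symm)) (by decide)

theorem ConfRel.eq_of_cyclicSet (hr : ConfRel w w') (h : w ∈ cyclicSet k) {s t : Fin 3}
    (hst : (w' s).1 = (w' t).1) : s = t := by
  obtain ⟨σ, hσ⟩ := hr
  obtain ⟨n, hn, -⟩ := hσ s
  obtain ⟨n', hn', -⟩ := hσ t
  have h1 := abs_lt.1 (abs_sub_lt_one_of_cyclicSet h (σ s) (σ t))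
  have h2 : n' - n = 0 := intCast_eq_zero_of_abs_lt_one
    (abs_lt.2 ⟨by push_cast; linarith, by push_cast; linarith⟩)
  have h3 : n' = n := by omega
  rw [h3] at hn'
  exact σ.injective (eq_of_fst_eq_of_cyclicSet h (by linarith))

theorem not_confRel_legSet (hw' : w' ∈ sunConf c) (h : w ∈ cyclicSet k) (h' : w' ∈ legSet c v L)
    (hL : ∀ s t, s < t → L s ≠ ⊤) : ¬ConfRel w w' := by
  intro hr
  obtain ⟨i, hi⟩ := WithTop.ne_top_iff_exists.1 (hL 0 1 (by decide))
  obtain ⟨j, hj⟩ := WithTop.ne_top_iff_exists.1 (hL 1 2 (by decide))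
  have h0 := h'.1 0
  have h1 := h'.1 1
  rw [← hi] at h0
  rw [← hj] at h1
  exact absurd (hr.eq_of_cyclicSet h (s := 0) (t := 1)
    (by rw [fst_eq_of_mem_leg (hw'.1 0) h0, fst_eq_of_mem_leg (hw'.1 1) h1])) (by decide)

theorem ConfRel.eq_top_of_vertexSet (hr : ConfRel w w') (hw' : w' ∈ sunConf c)
    (h : w ∈ cyclicSet k) (h' : w' ∈ vertexSet c ε v l m) (hl : l ≠ ⊤) :
    m = ⊤ ∧ ∃ b, w' 0 ∈ germ c v (.inr b) := by
  obtain ⟨i, rfl⟩ := WithTop.ne_top_iff_exists.1 hl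
  have h1 := fst_eq_of_mem_leg (hw'.1 1) h'.2.1
  constructor
  · by_contra hm
    obtain ⟨j, rfl⟩ := WithTop.ne_top_iff_exists.1 hm
    have h2 := fst_eq_of_mem_leg (hw'.1 2) h'.2.2.1
    exact absurd (hr.eq_of_cyclicSet h (h1.trans h2.symm)) (by decide)
  · rcases lt_trichotomy (w' 0).1 v with h2 | h2 | h2
    · exact ⟨false, h2⟩
    · exact absurd (hr.eq_of_cyclicSet h (h2.trans h1.symm)) (by decide)
    · exact ⟨true, h2⟩

theorem ConfRel.exists_sum_eq (hr : ConfRel w w') :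
    ∃ n : ℤ, ∑ s, (w' s).1 = ∑ s, (w s).1 + n := by
  obtain ⟨σ, hσ⟩ := hr
  choose n hn _ using hσ
  refine ⟨∑ s, n s, ?_⟩
  rw [Finset.sum_congr rfl fun s _ => hn s, Finset.sum_add_distrib,
    Equiv.sum_comp σ fun s => (w s).1]
  push_cast
  rfl

theorem ConfRel.eq_of_sum_eq (hr : ConfRel w w') (h : w ∈ cyclicSet k) (h' : w' ∈ cyclicSet k)
    (hsum : ∑ s, (w' s).1 = ∑ s, (w s).1) : w = w' := by
  obtain ⟨σ, hσ⟩ := hr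
  choose n hn hn' using hσ
  have h0 : ∑ s, n s = 0 := by
    have := Equiv.sum_comp σ fun s => (w s).1
    rw [Finset.sum_congr rfl fun s _ => hn s, Finset.sum_add_distrib, this] at hsum
    exact_mod_cast add_eq_left.1 hsum
  have hd : ∀ s t, n s - n t < 2 := by
    intro s t
    have h1 := abs_lt.1 (abs_sub_lt_one_of_cyclicSet h (σ s) (σ t))
    have h2 := abs_lt.1 (abs_sub_lt_one_of_cyclicSet h' s t)
    have h3 := hn s
    have h4 := hn t
    have : (n s : ℝ) - n t < 2 := by linarith
    exact_mod_cast this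
  have hz : ∀ s, n s = 0 := by
    have h01 := hd 0 1
    have h02 := hd 0 2
    have h10 := hd 1 0
    have h12 := hd 1 2
    have h20 := hd 2 0
    have h21 := hd 2 1
    rw [Fin.sum_univ_three] at h0
    intro s
    fin_cases s <;> simp <;> omega
  have e : ∀ s, w (σ s) = w' s := fun s => Prod.ext (by simp [hn, hz]) (hn' s).symm
  have hmono : ∀ {w : Fin 3 → ℝ × (Fin k → ℝ)}, w ∈ cyclicSet k → StrictMono fun s => (w s).1 := by
    rintro w ⟨h1, h2, -⟩
    refine Fin.strictMono_iff_lt_succ.2 fun s => ?_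
    fin_cases s
    exacts [h1, h2]
  have hone : σ = 1 := by
    refine perm_eq_one_of_lt σ fun s t hst => ?_
    have := hmono h' hst
    simp only [← e] at this
    exact (hmono h).lt_iff_lt.1 this
  subst hone
  exact funext e

/-- The generator of the deck transformations of `cyclicSet`. -/
def cyclicShift (w : Fin 3 → ℝ × (Fin k → ℝ)) : Fin 3 → ℝ × (Fin k → ℝ) :=
  ![w 1, w 2, ((w 0).1 + 1, (w 0).2)]

theorem continuous_cyclicShift : Continuous (cyclicShift (k := k)) := by
  unfold cyclicShift
  fun_prop

theorem confRel_cyclicShift (w : Fin 3 → ℝ × (Fin k → ℝ)) : ConfRel w (cyclicShift w) := by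
  refine ⟨finRotate 3, fun s => ?_⟩
  fin_cases s
  exacts [.refl _, .refl _, ⟨1, by simp [cyclicShift]⟩]

theorem cyclicShift_mem (h : w ∈ cyclicSet k) : cyclicShift w ∈ cyclicSet k := by
  obtain ⟨h1, h2, h3⟩ := h
  exact ⟨h2, h3, by simpa [cyclicShift] using h1⟩

theorem sum_cyclicShift (w : Fin 3 → ℝ × (Fin k → ℝ)) :
    ∑ s, (cyclicShift w s).1 = ∑ s, (w s).1 + 1 := by
  simp only [Fin.sum_univ_three, cyclicShift, Matrix.cons_val]
  ring

/-- Put a triple whose first point is near a vertex in cyclic order. -/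
def sideRep (b : Bool) (w : Fin 3 → ℝ × (Fin k → ℝ)) : Fin 3 → ℝ × (Fin k → ℝ) :=
  if b then ![w 1, w 0, w 2] else w

theorem continuous_sideRep (b : Bool) : Continuous (sideRep (k := k) b) := by
  cases b <;> unfold sideRep <;> simp <;> fun_prop

theorem confRel_sideRep (b : Bool) (w : Fin 3 → ℝ × (Fin k → ℝ)) : ConfRel w (sideRep b w) := by
  cases b
  · exact ⟨1, fun s => .refl _⟩
  · refine ⟨Equiv.swap 0 1, fun s => ?_⟩
    fin_cases s
    exacts [.refl _, .refl _, .refl _]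

theorem sideRep_mem {b : Bool} (hw : w ∈ sunConf c) (h : w ∈ vertexSet c ε v l ⊤) (hl : l ≠ ⊤)
    (hb : w 0 ∈ germ c v (.inr b)) : sideRep b w ∈ cyclicSet k := by
  obtain ⟨i, rfl⟩ := WithTop.ne_top_iff_exists.1 hl
  have h1 := fst_eq_of_mem_leg (hw.1 1) h.2.1
  obtain ⟨h2, h3⟩ : v < (w 2).1 ∧ (w 2).1 < v + 1 := h.2.2.1
  have h4 : vertexDist v (w 0) < min ((w 2).1 - v) (v + 1 - (w 2).1) := h.2.2.2.2.1
  obtain ⟨h5, h6⟩ := lt_min_iff.1 ((abs_le_vertexDist (hw.1 0)).trans_lt h4)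
  rw [abs_lt] at h5 h6
  cases b
  · have hb : (w 0).1 < v := hb
    refine ⟨?_, ?_, ?_⟩ <;> simp only [sideRep, Bool.false_eq_true, if_false] <;> linarith
  · have hb : v < (w 0).1 := hb
    refine ⟨?_, ?_, ?_⟩ <;> simp only [sideRep, if_true, Matrix.cons_val] <;> linarith

theorem exists_perm_mem_legSet (hw : w ∈ sunConf c) (h : ∀ s, w s ∈ leg c v (L s))
    (htop : ∀ s t, L s = ⊤ → L t = ⊤ → s = t) :
    ∃ σ : Equiv.Perm (Fin 3), w ∘ σ ∈ legSet c v (L ∘ Tuple.sort L) := by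
  let key := fun s => legKey v (L s) (w s)
  have hkey : Function.Injective key := by
    intro s t hst
    by_cases hs : L s = ⊤
    · exact htop s t hs ((Prod.ext_iff.1 (toLex_inj.1 hst)).1.symm.trans hs)
    · have := eq_of_legKey_eq hs (hw.1 s) (hw.1 t) (h s) (h t) hst
      exact hw.2 s t (this ▸ .refl _)
  have hmono : StrictMono (key ∘ Tuple.sort key) :=
    (Tuple.monotone_sort key).strictMono_of_injective
      (hkey.comp (Tuple.sort key).injective)
  have hL : L ∘ Tuple.sort key = L ∘ Tuple.sort L := by
    refine Tuple.unique_monotone (fun s t hst => ?_) (Tuple.monotone_sort L)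
    rcases Prod.Lex.toLex_le_toLex.1 (hmono.monotone hst) with h1 | h1
    exacts [h1.le, h1.1.le]
  refine ⟨Tuple.sort key, fun s => ?_, fun s t hst => ?_⟩
  · rw [← hL]
    exact h _
  · rw [← hL]
    exact hmono hst

theorem sort_ne_top (htop : ∀ s t, L s = ⊤ → L t = ⊤ → s = t) (s t : Fin 3) (hst : s < t) :
    (L ∘ Tuple.sort L) s ≠ ⊤ := by
  intro h
  have h1 := Tuple.monotone_sort L hst.le
  rw [h, top_le_iff] at h1
  exact hst.ne ((Tuple.sort L).injective (htop _ _ h h1))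

end Incidence

section Covering

variable {k : ℕ} {c : Fin k → ℝ} {v ε : ℝ} {w : Fin 3 → ℝ × (Fin k → ℝ)}
  {l m : WithTop (Fin k)} {L : Fin 3 → WithTop (Fin k)} {g : Fin k ⊕ Bool}

theorem confRel_comp (w : Fin 3 → ℝ × (Fin k → ℝ)) (σ : Equiv.Perm (Fin 3)) :
    ConfRel w (w ∘ σ) := ⟨σ, fun _ => .refl _⟩

theorem ConfRel.trans {w₁ w₂ w₃ : Fin 3 → ℝ × (Fin k → ℝ)} :
    ConfRel w₁ w₂ → ConfRel w₂ w₃ → ConfRel w₁ w₃ := by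
  rintro ⟨σ, h⟩ ⟨ρ, h'⟩
  exact ⟨σ * ρ, fun s => (h (ρ s)).trans (h' s)⟩

theorem edge_top_unique (hl : l ≠ ⊤) (hg : ¬(m = ⊤ ∧ germLabel g = ⊤)) (s t : Fin 3) :
    ![germLabel g, l, m] s = ⊤ → ![germLabel g, l, m] t = ⊤ → s = t := by
  fin_cases s <;> fin_cases t <;> simp <;> tauto

theorem exists_legSet_of_edge (hε : IsVertexGap c ε) (hw : w ∈ sunConf c)
    (h : w ∈ vertexSet c ε v l m) (hg : w 0 ∈ germ c v g) (hl : l ≠ ⊤)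
    (hmg : ¬(m = ⊤ ∧ germLabel g = ⊤)) :
    ∃ w' ∈ legSet c v (![germLabel g, l, m] ∘ Tuple.sort ![germLabel g, l, m]), ConfRel w w' := by
  have hr : ConfRel w ![germRep g (w 0), w 1, w 2] := by
    refine ⟨1, fun s => ?_⟩
    fin_cases s
    exacts [deckRel_germRep g _, .refl _, .refl _]
  have hleg : ∀ s, ![germRep g (w 0), w 1, w 2] s ∈ leg c v (![germLabel g, l, m] s) := by
    intro s
    fin_cases s
    exacts [germRep_mem_leg (hw.1 0) (vertexDist_lt_one hε h) hg, h.2.1, h.2.2.1]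
  obtain ⟨σ, hσ⟩ := exists_perm_mem_legSet (hr.mem_sunConf hw) hleg (edge_top_unique hl hmg)
  exact ⟨_, hσ, hr.trans (confRel_comp _ σ)⟩

theorem exists_edge_of_vertexSet (hε : IsVertexGap c ε) (hw : w ∈ sunConf c)
    (h : w ∈ vertexSet c ε v l m) :
    ∃ u ∈ sunConf c, u ∈ vertexSet c ε v l m ∧ u 0 ∈ germ c v (.inr false) := by
  obtain ⟨δ, hδ, hδ'⟩ := exists_between
    (lt_min hε.pos (lt_min (reach_pos h.2.1) (reach_pos h.2.2.1)))
  obtain ⟨h1, h2⟩ := lt_min_iff.1 hδ'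
  obtain ⟨h2, h3⟩ := lt_min_iff.1 h2
  have hd : vertexDist v (v - δ, (0 : Fin k → ℝ)) = δ := by simp [vertexDist, abs_of_pos hδ]
  have hu : ![(v - δ, 0), w 1, w 2] ∈ vertexSet c ε v l m :=
    ⟨hd.trans_lt h1, h.2.1, h.2.2.1, hd.trans_lt h2, hd.trans_lt h3, h.2.2.2.2.2⟩
  refine ⟨_, mem_sunConf_of_vertexSet hε (fun s => ?_) hu, hu, ?_⟩
  · fin_cases s
    exacts [mk_zero_mem_sunCover c _, hw.1 1, hw.1 2]
  · exact sub_lt_self v hδ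

theorem exists_edge_of_legSet (hε : IsVertexGap c ε) (hw : w ∈ sunConf c) (h : w ∈ legSet c v L)
    (hL : ∀ s t, s < t → L s ≠ ⊤) :
    ∃ u ∈ sunConf c, u ∈ legSet c v L ∧ u ∈ vertexSet c ε v (L 1) (L 2) := by
  obtain ⟨i, hi⟩ := WithTop.ne_top_iff_exists.1 (hL 0 1 (by decide))
  have h0 := h.1 0
  rw [← hi] at h0
  obtain ⟨δ, hδ, hδ'⟩ := exists_between
    (lt_min hε.pos (lt_min (reach_pos h0) (lt_min (reach_pos (h.1 1)) (reach_pos (h.1 2)))))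
  obtain ⟨h1, h2⟩ := lt_min_iff.1 hδ'
  obtain ⟨h2, h3⟩ := lt_min_iff.1 h2
  obtain ⟨h3, h4⟩ := lt_min_iff.1 h3
  have h2' : δ < (w 0).2 i := h2
  have hci : c i = v := h0.1
  have hd : vertexDist v (v, (Pi.single i δ : Fin k → ℝ)) = δ := by simp [vertexDist]
  have hm : (v, (Pi.single i δ : Fin k → ℝ)) ∈ sunCover c := by
    rw [← hci]
    exact mk_single_mem_sunCover i hδ.le (h2'.le.trans ((hw.1 0).1 i).2)
  have hkey : legKey v (L 0) (v, Pi.single i δ) ≤ legKey v (L 0) (w 0) := by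
    rw [← hi]
    refine Prod.Lex.toLex_le_toLex.2 (.inr ⟨rfl, ?_⟩)
    simpa [reach] using h2'.le
  have hu : ![(v, Pi.single i δ), w 1, w 2] ∈ legSet c v L := by
    refine ⟨fun s => ?_, fun s t hst => ?_⟩
    · fin_cases s
      · change (v, Pi.single i δ) ∈ leg c v (L 0)
        rw [← hi]
        exact ⟨hci, by simp, by simpa using hδ⟩
      · exact h.1 1
      · exact h.1 2
    · have h01 := h.2 0 1 (by decide)
      have h02 := h.2 0 2 (by decide)
      have h12 := h.2 1 2 (by decide)
      fin_cases s <;> fin_cases t <;> first | exact absurd hst (by decide) | skip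
      exacts [hkey.trans_lt h01, hkey.trans_lt h02, h12]
  refine ⟨_, mem_sunConf_of_legSet (fun s => ?_) hu, hu, hd.trans_lt h1, h.1 1, h.1 2,
    hd.trans_lt h3, hd.trans_lt h4, h.2 1 2 (by decide)⟩
  fin_cases s
  exacts [hm, hw.1 1, hw.1 2]

theorem exists_cyclicSet_of_distinct (hw : ∀ s t (n : ℤ), (w s).1 = (w t).1 + n → s = t) :
    ∃ w' ∈ cyclicSet k, ConfRel w w' := by
  let f := fun s => (Int.fract (w s).1, (w s).2)
  have hf : ConfRel w f := ⟨1, fun s => ⟨-⌊(w s).1⌋, by simp [f, Int.fract, sub_eq_add_neg], rfl⟩⟩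
  let a := fun s => Int.fract (w s).1
  have ha : Function.Injective a := by
    intro s t hst
    obtain ⟨n, hn⟩ := Int.fract_eq_fract.1 hst
    exact hw s t n (by linarith)
  have hmono : StrictMono (a ∘ Tuple.sort a) :=
    (Tuple.monotone_sort a).strictMono_of_injective (ha.comp (Tuple.sort a).injective)
  refine ⟨f ∘ Tuple.sort a, ⟨hmono (by decide : (0 : Fin 3) < 1),
    hmono (by decide : (1 : Fin 3) < 2),
    ?_⟩, hf.trans (confRel_comp _ _)⟩
  have h1 := Int.fract_lt_one (w (Tuple.sort a 2)).1
  have h2 := Int.fract_nonneg (w (Tuple.sort a 0)).1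
  simp only [f, Function.comp_apply]
  linarith

theorem exists_leg_of_fst_mem (hε : IsVertexGap c ε) (hv : v ∈ Set.range c)
    {y : ℝ × (Fin k → ℝ)} (hy : y ∈ sunCover c) (h1 : v ≤ y.1) (h2 : y.1 < v + 1)
    (hne : y ≠ (v, 0)) : ∃ l, y ∈ leg c v l ∧ (l = ⊤ → v < y.1) := by
  rcases h1.eq_or_lt with h1 | h1
  · have h3 : y.2 ≠ 0 := fun h => hne (Prod.ext h1.symm h)
    obtain ⟨j, hj⟩ := Function.ne_iff.1 h3
    obtain ⟨n, hn⟩ := hy.2.1 j hj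
    obtain ⟨i, rfl⟩ := hv
    refine ⟨j, ⟨hε.eq_of_lt i j n ?_, by simp [← h1], (hy.1 j).1.lt_of_ne' hj⟩, fun h => ?_⟩
    · rw [← hn, ← h1, sub_self, abs_zero]
      linarith [hε.pos]
    · exact absurd h (by simp)
  · exact ⟨⊤, ⟨h1, h2⟩, fun _ => h1⟩

theorem exists_vertexSet_of_eq_vertex (hε : IsVertexGap c ε) (hw : w ∈ sunConf c)
    (h0 : w 0 = (v, 0)) (h1 : w 1 ∈ leg c v l) (h2 : w 2 ∈ leg c v m) (hlm : l ≠ ⊤ ∨ m ≠ ⊤) :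
    ∃ l m, l ≠ ⊤ ∧ ∃ w' ∈ vertexSet c ε v l m, ConfRel w w' := by
  have hd : vertexDist v (w 0) = 0 := by simp [h0, vertexDist]
  rcases lt_trichotomy (legKey v l (w 1)) (legKey v m (w 2)) with h | h | h
  · refine ⟨l, m, ?_, w, ⟨hd.trans_lt hε.pos, h1, h2, hd.trans_lt (reach_pos h1),
      hd.trans_lt (reach_pos h2), h⟩, ⟨1, fun s => .refl _⟩⟩
    rintro rfl
    have : (⊤ : WithTop (Fin k)) ≤ m := by
      rcases Prod.Lex.toLex_lt_toLex.1 h with h | h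
      exacts [h.le, h.1.le]
    exact hlm.elim (fun h => h rfl) fun h => h (top_le_iff.1 this)
  · have hlm' : l = m := (Prod.ext_iff.1 (toLex_inj.1 h)).1
    subst hlm'
    have := eq_of_legKey_eq (or_self_iff.1 hlm) (hw.1 1) (hw.1 2) h1 h2 h
    exact absurd (hw.2 1 2 (this ▸ .refl _)) (by decide)
  · refine ⟨m, l, ?_, ![w 0, w 2, w 1], ⟨hd.trans_lt hε.pos, h2, h1, hd.trans_lt (reach_pos h2),
      hd.trans_lt (reach_pos h1), h⟩, ⟨Equiv.swap 1 2, fun s => ?_⟩⟩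
    · rintro rfl
      have : (⊤ : WithTop (Fin k)) ≤ l := by
        rcases Prod.Lex.toLex_lt_toLex.1 h with h | h
        exacts [h.le, h.1.le]
      exact hlm.elim (fun h => h (top_le_iff.1 this)) fun h => h rfl
    · fin_cases s
      exacts [.refl _, .refl _, .refl _]

theorem exists_cyclicSet_or_legSet_or_vertexSet (hε : IsVertexGap c ε) (hw : w ∈ sunConf c) :
    (∃ w' ∈ cyclicSet k, ConfRel w w') ∨
    (∃ v ∈ Set.range c, ∃ L, (∀ s t, s < t → L s ≠ ⊤) ∧ ∃ w' ∈ legSet c v L, ConfRel w w') ∨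
    ∃ v ∈ Set.range c, ∃ l m, l ≠ ⊤ ∧ ∃ w' ∈ vertexSet c ε v l m, ConfRel w w' := by
  by_cases hdist : ∀ s t (n : ℤ), (w s).1 = (w t).1 + n → s = t
  · exact .inl (exists_cyclicSet_of_distinct hdist)
  push Not at hdist
  obtain ⟨s, t, n, hn, hst⟩ := hdist
  obtain ⟨v, hv, p, hp⟩ : ∃ v ∈ Set.range c, ∃ p : ℤ, (w s).1 = v + p := by
    by_contra hno
    have h2 : ∀ s, (∃ p : ℤ, (w s).1 = (w t).1 + p) → (w s).2 = 0 := by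
      rintro s' ⟨p, hp⟩
      by_contra h
      obtain ⟨j, hj⟩ := Function.ne_iff.1 h
      obtain ⟨q, hq⟩ := (hw.1 s').2.1 j hj
      exact hno ⟨c j, ⟨j, rfl⟩, q - p + n, by push_cast; linarith⟩
    refine hst (hw.2 s t ⟨-n, by push_cast; linarith, ?_⟩)
    rw [h2 s ⟨n, hn⟩, h2 t ⟨0, by simp⟩]
  refine .inr ?_
  let f := fun r => (v + Int.fract ((w r).1 - v), (w r).2)
  have hf : ConfRel w f := ⟨1, fun r => ⟨-⌊(w r).1 - v⌋, by
    simp only [f, Int.fract, Equiv.Perm.one_apply]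
    push_cast
    ring, rfl⟩⟩
  have hfc := hf.mem_sunConf hw
  have hfs : (f s).1 = v := by simp [f, hp]
  have hft : (f t).1 = v := by
    have : (w t).1 - v = ((p - n : ℤ) : ℝ) := by push_cast; linarith
    simp [f, this]
  have h1 : ∀ r, v ≤ (f r).1 := fun r => le_add_of_nonneg_right (Int.fract_nonneg _)
  have h2 : ∀ r, (f r).1 < v + 1 := fun r => by
    have := Int.fract_lt_one ((w r).1 - v)
    simp only [f]
    linarith
  have hleg := fun r => exists_leg_of_fst_mem hε hv (hfc.1 r) (h1 r) (h2 r)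
  by_cases hall : ∀ r, f r ≠ (v, 0)
  · choose L hL hL' using fun r => hleg r (hall r)
    have htop : ∀ r r', L r = ⊤ → L r' = ⊤ → r = r' := by
      have : ∀ s t r r' : Fin 3, s ≠ t → r ≠ s → r ≠ t → r' ≠ s → r' ≠ t → r = r' := by decide
      intro r r' hr hr'
      have h3 := hL' r hr
      have h4 := hL' r' hr'
      refine this s t r r' hst ?_ ?_ ?_ ?_ <;> rintro rfl <;> linarith
    obtain ⟨σ, hσ⟩ := exists_perm_mem_legSet hfc hL htop
    exact .inl ⟨v, hv, _, sort_ne_top htop, _, hσ, hf.trans (confRel_comp _ σ)⟩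
  · push Not at hall
    obtain ⟨r, hr⟩ := hall
    refine .inr ⟨v, hv, ?_⟩
    obtain ⟨σ, hσ⟩ : ∃ σ : Equiv.Perm (Fin 3), σ 0 = r := ⟨Equiv.swap 0 r, by simp⟩
    have hr' := hf.trans (confRel_comp _ σ)
    have hne : ∀ r', r' ≠ 0 → f (σ r') ≠ (v, 0) := by
      intro r' h h'
      have := hfc.2 (σ r') r (by rw [h', hr]; exact .refl _)
      exact h (σ.injective (this.trans hσ.symm))
    obtain ⟨l, hl, hl'⟩ := hleg _ (hne 1 (by decide))
    obtain ⟨m, hm, hm'⟩ := hleg _ (hne 2 (by decide))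
    have hlm : l ≠ ⊤ ∨ m ≠ ⊤ := by
      by_contra h
      push Not at h
      have h3 := hl' h.1
      have h4 := hm' h.2
      have key : ∀ (σ : Equiv.Perm (Fin 3)) (s t : Fin 3), s ≠ t →
          σ 1 = s ∨ σ 1 = t ∨ σ 2 = s ∨ σ 2 = t := by decide
      rcases key σ s t hst with e | e | e | e
      · rw [e] at h3; linarith
      · rw [e] at h3; linarith
      · rw [e] at h4; linarith
      · rw [e] at h4; linarith
    obtain ⟨l, m, hl, w', hw', hr''⟩ := exists_vertexSet_of_eq_vertex hε (hr'.mem_sunConf hw)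
      (by simp [hσ, hr]) hl hm hlm
    exact ⟨l, m, hl, w', hw', hr'.trans hr''⟩

end Covering

section Assembly

variable {k : ℕ} {c : Fin k → ℝ} {v v' ε : ℝ} {w w' : Fin 3 → ℝ × (Fin k → ℝ)}
  {l m : WithTop (Fin k)} {L : Fin 3 → WithTop (Fin k)} {U U' : Set (Fin 3 → ℝ × (Fin k → ℝ))}
  {X : Type} {Φ : ↥(sunConf c) → X}

/-- The restriction of a map on `sunConf c` to a subset. -/
def confPiece (Φ : ↥(sunConf c) → X) (U : Set (Fin 3 → ℝ × (Fin k → ℝ))) :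
    ↥(sunConf c ∩ U) → X := fun w => Φ ⟨w, w.2.1⟩

/-- The triples in `vertexSet` whose first point lies on a given germ. -/
def edgeSet (c : Fin k → ℝ) (ε v : ℝ) (l m : WithTop (Fin k)) (g : Fin k ⊕ Bool) :
    Set (Fin 3 → ℝ × (Fin k → ℝ)) :=
  vertexSet c ε v l m ∩ {w | w 0 ∈ germ c v g}

theorem isOpen_edgeSet {g : Fin k ⊕ Bool} : IsOpen (edgeSet c ε v l m g) :=
  isOpen_vertexSet.inter ((isOpen_germ c v g).preimage (continuous_apply 0))

theorem confPiece_eq_iff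
    (hΦ : ∀ w w', Φ w = Φ w' ↔ ConfRel (w : Fin 3 → ℝ × (Fin k → ℝ)) w')
    {x : ↥(sunConf c ∩ U)} {y : ↥(sunConf c ∩ U')} :
    confPiece Φ U x = confPiece Φ U' y ↔ ConfRel (x : Fin 3 → ℝ × (Fin k → ℝ)) y :=
  hΦ _ _

variable [TopologicalSpace X]

theorem continuous_confPiece (hΦ : Continuous Φ) : Continuous (confPiece Φ U) :=
  hΦ.comp (by fun_prop)

theorem isOpenMap_confPiece (hΦ : IsOpenMap Φ) (hU : IsOpen U) : IsOpenMap (confPiece Φ U) := by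
  have h : IsOpenEmbedding (Set.inclusion (Set.inter_subset_left : sunConf c ∩ U ⊆ sunConf c)) := by
    refine .inclusion _ ?_
    convert hU.preimage (continuous_subtype_val (p := (· ∈ sunConf c))) using 1
    ext w
    simp
  exact hΦ.comp h.isOpenMap

theorem isOpenEmbedding_confPiece (hΦc : Continuous Φ) (hΦo : IsOpenMap Φ)
    (hΦ : ∀ w w', Φ w = Φ w' ↔ ConfRel (w : Fin 3 → ℝ × (Fin k → ℝ)) w') (hU : IsOpen U)
    (hinj : ∀ w w', w ∈ sunConf c → w ∈ U → w' ∈ U → ConfRel w w' → w = w') :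
    IsOpenEmbedding (confPiece Φ U) :=
  .of_continuous_injective_isOpenMap (continuous_confPiece hΦc)
    (fun w w' h => Subtype.ext (hinj _ _ w.2.1 w.2.2 w'.2.2 ((hΦ _ _).1 h)))
    (isOpenMap_confPiece hΦo hU)

theorem joined_confPiece [PathConnectedSpace ↥(sunConf c ∩ U)] (hΦ : Continuous Φ)
    (hw : w ∈ sunConf c) (hw' : w' ∈ sunConf c) (h : w ∈ U) (h' : w' ∈ U) :
    Joined (Φ ⟨w, hw⟩) (Φ ⟨w', hw'⟩) :=
  (PathConnectedSpace.joined (⟨w, hw, h⟩ : ↥(sunConf c ∩ U)) ⟨w', hw', h'⟩).map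
    (continuous_confPiece hΦ)

theorem pathConnectedSpace_of_sunConf (hε : IsVertexGap c ε) (hΦc : Continuous Φ)
    (hΦs : Function.Surjective Φ)
    (hΦ : ∀ w w', Φ w = Φ w' ↔ ConfRel (w : Fin 3 → ℝ × (Fin k → ℝ)) w') :
    PathConnectedSpace X := by
  have hM := simplyConnectedSpace_cyclicSet (c := c)
  obtain ⟨⟨u₀, hu₀, hu₀'⟩⟩ : Nonempty ↥(sunConf c ∩ cyclicSet k) := inferInstance
  have hcyc : ∀ {w w' : Fin 3 → ℝ × (Fin k → ℝ)} (hw : w ∈ sunConf c), w' ∈ cyclicSet k →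
      ConfRel w w' → Joined (Φ ⟨u₀, hu₀⟩) (Φ ⟨w, hw⟩) := by
    intro w w' hw hw' hr
    rw [(hΦ ⟨w, hw⟩ ⟨w', hr.mem_sunConf hw⟩).2 hr]
    exact joined_confPiece hΦc _ _ hu₀' hw'
  have htop : ∀ {v l} {w : Fin 3 → ℝ × (Fin k → ℝ)} (hw : w ∈ sunConf c), v ∈ Set.range c →
      l ≠ ⊤ → w ∈ vertexSet c ε v l ⊤ → Joined (Φ ⟨u₀, hu₀⟩) (Φ ⟨w, hw⟩) := by
    intro v l w hw hv hl h
    have := simplyConnectedSpace_vertexSet hε hv hl ⟨w, hw, h⟩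
    obtain ⟨u, hu, hu', hg⟩ := exists_edge_of_vertexSet hε hw h
    exact (hcyc hu (sideRep_mem hu hu' hl hg) (confRel_sideRep _ _)).trans
      (joined_confPiece hΦc hu hw hu' h)
  have hleg : ∀ {v L} {w : Fin 3 → ℝ × (Fin k → ℝ)} (hw : w ∈ sunConf c), v ∈ Set.range c →
      (∀ s t, s < t → L s ≠ ⊤) → w ∈ legSet c v L →
      (∀ u (hu : u ∈ sunConf c), u ∈ vertexSet c ε v (L 1) (L 2) →
        Joined (Φ ⟨u₀, hu₀⟩) (Φ ⟨u, hu⟩)) → Joined (Φ ⟨u₀, hu₀⟩) (Φ ⟨w, hw⟩) := by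
    intro v L w hw hv hL h hj
    have := simplyConnectedSpace_legSet hL ⟨w, hw, h⟩
    obtain ⟨u, hu, hu', hu''⟩ := exists_edge_of_legSet hε hw h hL
    exact (hj u hu hu'').trans (joined_confPiece hΦc hu hw hu' h)
  have hvert : ∀ {v l m} {w : Fin 3 → ℝ × (Fin k → ℝ)} (hw : w ∈ sunConf c), v ∈ Set.range c →
      l ≠ ⊤ → w ∈ vertexSet c ε v l m → Joined (Φ ⟨u₀, hu₀⟩) (Φ ⟨w, hw⟩) := by
    intro v l m w hw hv hl h
    by_cases hm : m = ⊤
    · subst hm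
      exact htop hw hv hl h
    · have := simplyConnectedSpace_vertexSet hε hv hl ⟨w, hw, h⟩
      obtain ⟨u, hu, hu', hg⟩ := exists_edge_of_vertexSet hε hw h
      refine Joined.trans ?_ (joined_confPiece hΦc hu hw hu' h)
      have hmg : ¬(m = ⊤ ∧ germLabel (k := k) (.inr false) = ⊤) := fun e => hm e.1
      obtain ⟨w', hw', hr⟩ := exists_legSet_of_edge hε hu hu' hg hl hmg
      have hne := sort_ne_top (edge_top_unique hl hmg)
      rw [(hΦ ⟨u, hu⟩ ⟨w', hr.mem_sunConf hu⟩).2 hr]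
      refine hleg _ hv hne hw' fun x hx hx' => ?_
      have h2 : (![germLabel (.inr false), l, m] ∘
          Tuple.sort ![germLabel (.inr false), l, m]) 2 = ⊤ := by
        refine top_le_iff.1 ?_
        have := Tuple.monotone_sort ![germLabel (.inr false), l, m]
          (Fin.le_last ((Tuple.sort ![germLabel (.inr false), l, m]).symm 0))
        rw [Function.comp_apply, Equiv.apply_symm_apply] at this
        exact this
      rw [h2] at hx'
      exact htop hx hv (hne 1 2 (by decide)) hx'
  have hall : ∀ z, Joined (Φ ⟨u₀, hu₀⟩) z := by
    intro z
    obtain ⟨⟨w, hw⟩, rfl⟩ := hΦs z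
    rcases exists_cyclicSet_or_legSet_or_vertexSet hε hw with
      ⟨w', hw', hr⟩ | ⟨v, hv, L, hL, w', hw', hr⟩ | ⟨v, hv, l, m, hl, w', hw', hr⟩
    · exact hcyc hw hw' hr
    · rw [(hΦ ⟨w, hw⟩ ⟨w', hr.mem_sunConf hw⟩).2 hr]
      exact hleg _ hv hL hw' fun u hu hu' => hvert hu hv (hL 1 2 (by decide)) hu'
    · rw [(hΦ ⟨w, hw⟩ ⟨w', hr.mem_sunConf hw⟩).2 hr]
      exact hvert _ hv hl hw'
  exact ⟨⟨Φ ⟨u₀, hu₀⟩⟩, fun x y => (hall x).symm.trans (hall y)⟩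

/-- The indices of the nonempty sets `legSet`. -/
abbrev LegIndex (c : Fin k → ℝ) : Type :=
  {p : Set.range c × (Fin 3 → WithTop (Fin k)) //
    (∀ s t, s < t → p.2 s ≠ ⊤) ∧ (sunConf c ∩ legSet c p.1 p.2).Nonempty}

/-- The indices of the nonempty sets `vertexSet`. -/
abbrev VertexIndex (c : Fin k → ℝ) (ε : ℝ) : Type :=
  {p : Set.range c × WithTop (Fin k) × WithTop (Fin k) //
    p.2.1 ≠ ⊤ ∧ (sunConf c ∩ vertexSet c ε p.1 p.2.1 p.2.2).Nonempty}

/-- The indices of the nonempty sets `edgeSet`. -/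
abbrev EdgeIndex (c : Fin k → ℝ) (ε : ℝ) : Type :=
  {p : (Set.range c × WithTop (Fin k) × WithTop (Fin k)) × (Fin k ⊕ Bool) //
    p.1.2.1 ≠ ⊤ ∧ (sunConf c ∩ edgeSet c ε p.1.1 p.1.2.1 p.1.2.2 p.2).Nonempty}

/-- The vertex to which an edge is attached. -/
def EdgeIndex.vertex (e : EdgeIndex c ε) : VertexIndex c ε :=
  ⟨e.1.1, e.2.1, e.2.2.mono fun _ h => ⟨h.1, h.2.1⟩⟩

/-- The edges at which `vertexSet` meets `cyclicSet`. -/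
def EdgeIndex.IsCyclic (e : EdgeIndex c ε) : Prop :=
  e.1.1.2.2 = ⊤ ∧ germLabel e.1.2 = ⊤

theorem edgeIndex_eq (hε : IsVertexGap c ε) {e e' : EdgeIndex c ε} (hw : w ∈ sunConf c)
    (h : w ∈ edgeSet c ε e.1.1.1 e.1.1.2.1 e.1.1.2.2 e.1.2)
    (h' : w' ∈ edgeSet c ε e'.1.1.1 e'.1.1.2.1 e'.1.1.2.2 e'.1.2) (hr : ConfRel w w') :
    e = e' := by
  obtain ⟨⟨⟨⟨v, hv⟩, l, m⟩, g⟩, hl, _⟩ := e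
  obtain ⟨⟨⟨⟨v', hv'⟩, l', m'⟩, g'⟩, hl', _⟩ := e'
  obtain rfl := hr.vertex_eq_of_vertexSet hε hv hv' hw h.1 h'.1 hl hl'
  obtain ⟨rfl, rfl, rfl⟩ := hr.eq_of_vertexSet hε hw h.1 h'.1
  obtain rfl := germ_unique (hw.1 0) (vertexDist_lt_one hε h.1) h.2 h'.2
  rfl

theorem exists_fundamentalGroup_mulEquiv_freeGroup_of_sunConf (hε : IsVertexGap c ε)
    (hΦc : Continuous Φ) (hΦo : IsOpenMap Φ) (hΦs : Function.Surjective Φ)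
    (hΦ : ∀ w w', Φ w = Φ w' ↔ ConfRel (w : Fin 3 → ℝ × (Fin k → ℝ)) w') (z : X) :
    ∃ n : ℕ, Nonempty (FundamentalGroup X z ≃* FreeGroup (Fin n)) := by
  have := pathConnectedSpace_of_sunConf hε hΦc hΦs hΦ
  have := simplyConnectedSpace_cyclicSet (c := c)
  have (p : LegIndex c) : SimplyConnectedSpace ↥(sunConf c ∩ legSet c p.1.1 p.1.2) :=
    simplyConnectedSpace_legSet p.2.1 p.2.2
  have (p : VertexIndex c ε) :
      SimplyConnectedSpace ↥(sunConf c ∩ vertexSet c ε p.1.1 p.1.2.1 p.1.2.2) :=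
    simplyConnectedSpace_vertexSet hε p.1.1.2 p.2.1 p.2.2
  have (e : EdgeIndex c ε) :
      PathConnectedSpace ↥(sunConf c ∩ edgeSet c ε e.1.1.1 e.1.1.2.1 e.1.1.2.2 e.1.2) :=
    pathConnectedSpace_edgeSet hε e.1.1.1.2 e.2.1 e.2.2
  have hleg : ∀ e : {e : EdgeIndex c ε // ¬e.IsCyclic}, ∃ p : LegIndex c,
      ∀ w : ↥(sunConf c ∩ edgeSet c ε e.1.1.1.1 e.1.1.1.2.1 e.1.1.1.2.2 e.1.1.2),
        ∃ w' : ↥(sunConf c ∩ legSet c p.1.1 p.1.2),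
          ConfRel (w' : Fin 3 → ℝ × (Fin k → ℝ)) w := by
    rintro ⟨⟨⟨⟨v, l, m⟩, g⟩, hl, w₀, hw₀⟩, hmg⟩
    have key : ∀ w ∈ sunConf c ∩ edgeSet c ε v l m g, ∃ w' ∈ sunConf c ∩
        legSet c v (![germLabel g, l, m] ∘ Tuple.sort ![germLabel g, l, m]), ConfRel w' w := by
      rintro w ⟨hw, hw', hg⟩
      obtain ⟨w', h, hr⟩ := exists_legSet_of_edge hε hw hw' hg hl hmg
      exact ⟨w', ⟨hr.mem_sunConf hw, h⟩, hr.symm⟩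
    obtain ⟨w₁, hw₁, -⟩ := key w₀ hw₀
    refine ⟨⟨(v, _), sort_ne_top (edge_top_unique hl hmg), w₁, hw₁⟩, fun w => ?_⟩
    obtain ⟨w', hw', hr⟩ := key w w.2
    exact ⟨⟨w', hw'⟩, hr⟩
  choose tP l₁ hl₁ using hleg
  have hside : ∀ e : {e : EdgeIndex c ε // e.IsCyclic}, ∃ b, e.1.1.2 = .inr b := by
    rintro ⟨⟨⟨⟨v, l, m⟩, g⟩, hl, hne⟩, -, hg⟩
    rcases g with i | b
    · exact absurd hg WithTop.coe_ne_top
    · exact ⟨b, rfl⟩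
  choose b hb using hside
  have hl₂ : ∀ (e : {e : EdgeIndex c ε // e.IsCyclic})
      (w : ↥(sunConf c ∩ edgeSet c ε e.1.1.1.1 e.1.1.1.2.1 e.1.1.1.2.2 e.1.1.2)),
      sideRep (b e) w ∈ sunConf c ∩ cyclicSet k := by
    rintro e ⟨w, hw, h, hg⟩
    rw [e.2.1] at h
    rw [Set.mem_ofPred_eq, hb] at hg
    exact ⟨(confRel_sideRep _ _).mem_sunConf hw, sideRep_mem hw h e.1.2.1 hg⟩
  refine exists_fundamentalGroup_mulEquiv_freeGroup_of_pieces
    (Ψ := confPiece Φ (cyclicSet k)) (τ := fun w => ∑ s, ((w : Fin 3 → ℝ × (Fin k → ℝ)) s).1)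
    (continuous_confPiece hΦc) (isOpenMap_confPiece hΦo isOpen_cyclicSet)
    (continuous_finsetSum _ fun s _ => continuous_fst.comp
      ((continuous_apply s).comp continuous_subtype_val))
    (T := fun w => ⟨cyclicShift w, (confRel_cyclicShift _).mem_sunConf w.2.1,
      cyclicShift_mem w.2.2⟩)
    ((continuous_cyclicShift.comp continuous_subtype_val).subtype_mk _)
    (fun u => ((confPiece_eq_iff hΦ).2 (confRel_cyclicShift _)).symm)
    (fun u => sum_cyclicShift _)
    (fun u w h => ((confPiece_eq_iff hΦ).1 h).exists_sum_eq)
    (fun u w h hs => Subtype.ext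
      (((confPiece_eq_iff hΦ).1 h).eq_of_sum_eq u.2.2 w.2.2 hs.symm))
    (P := LegIndex c) (V := VertexIndex c ε)
    (jP := fun p => confPiece Φ (legSet c p.1.1 p.1.2))
    (jV := fun p => confPiece Φ (vertexSet c ε p.1.1 p.1.2.1 p.1.2.2))
    (fun p => isOpenEmbedding_confPiece hΦc hΦo hΦ isOpen_legSet
      fun w w' hw h h' hr => (hr.eq_of_legSet hw h h').2)
    (fun p => isOpenEmbedding_confPiece hΦc hΦo hΦ isOpen_vertexSet
      fun w w' hw h h' hr => (hr.eq_of_vertexSet hε hw h h').2.2)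
    (ε₁ := {e : EdgeIndex c ε // ¬e.IsCyclic}) (ε₂ := {e : EdgeIndex c ε // e.IsCyclic})
    (j₁ := fun e => confPiece Φ (edgeSet c ε e.1.1.1.1 e.1.1.1.2.1 e.1.1.1.2.2 e.1.1.2))
    (j₂ := fun e => confPiece Φ (edgeSet c ε e.1.1.1.1 e.1.1.1.2.1 e.1.1.1.2.2 e.1.1.2))
    (fun e => isOpenEmbedding_confPiece hΦc hΦo hΦ isOpen_edgeSet
      fun w w' hw h h' hr => (hr.eq_of_vertexSet hε hw h.1 h'.1).2.2)
    (fun e => isOpenEmbedding_confPiece hΦc hΦo hΦ isOpen_edgeSet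
      fun w w' hw h h' hr => (hr.eq_of_vertexSet hε hw h.1 h'.1).2.2)
    (tP := tP) (tV₁ := fun e => e.1.vertex) (tV₂ := fun e => e.1.vertex)
    (r₁ := fun e w => ⟨w, w.2.1, w.2.2.1⟩) (r₂ := fun e w => ⟨w, w.2.1, w.2.2.1⟩)
    (l₁ := l₁) (l₂ := fun e w => ⟨sideRep (b e) w, hl₂ e w⟩)
    (fun e x => rfl) (fun e x => rfl)
    (fun e x => (confPiece_eq_iff hΦ).2 (hl₁ e x))
    (fun e x => ((confPiece_eq_iff hΦ).2 (confRel_sideRep _ _)).symm)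
    (fun e => ((continuous_sideRep _).comp continuous_subtype_val).subtype_mk _)
    ?_ ?_ ?_ ?_ ?_ ?_ ?_ ?_ z
  · rintro ⟨⟨⟨v, hv⟩, L⟩, hL, _⟩ ⟨⟨⟨v', hv'⟩, L'⟩, hL', _⟩ x x' h
    have hr := (confPiece_eq_iff hΦ).1 h
    obtain rfl := hr.vertex_eq_of_legSet hε hv hv' x.2.1 x.2.2 x'.2.2 hL hL'
    obtain ⟨rfl, -⟩ := hr.eq_of_legSet x.2.1 x.2.2 x'.2.2
    rfl
  · rintro ⟨⟨⟨v, hv⟩, l, m⟩, hl, _⟩ ⟨⟨⟨v', hv'⟩, l', m'⟩, hl', _⟩ x x' h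
    have hr := (confPiece_eq_iff hΦ).1 h
    obtain rfl := hr.vertex_eq_of_vertexSet hε hv hv' x.2.1 x.2.2 x'.2.2 hl hl'
    obtain ⟨rfl, rfl, -⟩ := hr.eq_of_vertexSet hε x.2.1 x.2.2 x'.2.2
    rfl
  · intro e e' x x' h
    exact Subtype.ext (edgeIndex_eq hε x.2.1 x.2.2 x'.2.2 ((confPiece_eq_iff hΦ).1 h))
  · intro e e' x x' h
    exact Subtype.ext (edgeIndex_eq hε x.2.1 x.2.2 x'.2.2 ((confPiece_eq_iff hΦ).1 h))
  · intro u p x h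
    exact not_confRel_legSet x.2.1 u.2.2 x.2.2 p.2.1 ((confPiece_eq_iff hΦ).1 h)
  · rintro ⟨⟨⟨v, hv⟩, l, m⟩, hl, _⟩ x ⟨⟨⟨v', hv'⟩, L⟩, hL, _⟩ y h
    have hr := (confPiece_eq_iff hΦ).1 h
    obtain rfl := hr.vertex_eq_of_vertexSet_of_legSet hε hv hv' x.2.1 x.2.2 y.2.2 hl hL
    obtain ⟨g, hg, hmg⟩ := hr.exists_germ_of_legSet hε x.2.1 x.2.2 y.2.2 hL
    exact ⟨⟨⟨⟨⟨⟨v, hv⟩, l, m⟩, g⟩, hl, x, x.2.1, x.2.2, hg⟩, hmg⟩, ⟨x, x.2.1, x.2.2, hg⟩, rfl⟩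
  · rintro ⟨⟨⟨v, hv⟩, l, m⟩, hl, _⟩ x u h
    obtain ⟨hm, b, hg⟩ :=
      ((confPiece_eq_iff hΦ).1 h).symm.eq_top_of_vertexSet x.2.1 u.2.2 x.2.2 hl
    exact ⟨⟨⟨⟨⟨⟨v, hv⟩, l, m⟩, .inr b⟩, hl, x, x.2.1, x.2.2, hg⟩, hm, rfl⟩,
      ⟨x, x.2.1, x.2.2, hg⟩, rfl⟩
  · intro z
    obtain ⟨⟨w, hw⟩, rfl⟩ := hΦs z
    rcases exists_cyclicSet_or_legSet_or_vertexSet hε hw with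
      ⟨w', hw', hr⟩ | ⟨v, hv, L, hL, w', hw', hr⟩ | ⟨v, hv, l, m, hl, w', hw', hr⟩
    · exact .inl ⟨⟨w', hr.mem_sunConf hw, hw'⟩, (hΦ _ _).2 hr.symm⟩
    · exact .inr (.inl ⟨⟨(⟨v, hv⟩, L), hL, w', hr.mem_sunConf hw, hw'⟩,
        ⟨w', hr.mem_sunConf hw, hw'⟩, (hΦ _ _).2 hr.symm⟩)
    · exact .inr (.inr ⟨⟨(⟨v, hv⟩, l, m), hl, w', hr.mem_sunConf hw, hw'⟩,
        ⟨w', hr.mem_sunConf hw, hw'⟩, (hΦ _ _).2 hr.symm⟩)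

end Assembly

section UnorderedConfigurations

variable {n : ℕ} {Y : Type*}

theorem quot_mk_permRel_eq_iff {f g : {f : Fin n → Y // Function.Injective f}} :
    Quot.mk (permRel n Y) f = Quot.mk (permRel n Y) g ↔ permRel n Y f g := by
  have h : Equivalence (permRel n Y) := by
    refine ⟨fun f => ⟨1, rfl⟩, fun {f g} ⟨σ, h⟩ => ⟨σ⁻¹, ?_⟩,
      fun {f g h} ⟨σ, e⟩ ⟨ρ, e'⟩ => ⟨σ * ρ, ?_⟩⟩
    · rw [← h]
      ext s
      simp
    · rw [← e', ← e]
      rfl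
  exact ⟨fun e => h.eqvGen_iff.1 (Quot.eqvGen_exact e), Quot.sound⟩

theorem isOpenMap_quot_mk_permRel [TopologicalSpace Y] : IsOpenMap (Quot.mk (permRel n Y)) := by
  intro U hU
  rw [← isQuotientMap_quot_mk.isOpen_preimage]
  let act := fun (σ : Equiv.Perm (Fin n)) (f : {f : Fin n → Y // Function.Injective f}) =>
    (⟨f.1 ∘ σ, f.2.comp σ.injective⟩ : {f : Fin n → Y // Function.Injective f})
  have hact : ∀ σ, Continuous (act σ) := by
    refine fun σ => Continuous.subtype_mk (continuous_pi fun s => ?_) _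
    exact (continuous_apply (σ s)).comp continuous_subtype_val
  convert isOpen_iUnion fun σ => hU.preimage (hact σ) using 1
  ext f
  simp only [Set.mem_preimage, Set.mem_image, Set.mem_iUnion]
  constructor
  · rintro ⟨g, hg, e⟩
    obtain ⟨σ, h⟩ := quot_mk_permRel_eq_iff.1 e.symm
    exact ⟨σ, (Subtype.ext h : act σ f = g) ▸ hg⟩
  · rintro ⟨σ, h⟩
    exact ⟨_, h, (Quot.sound ⟨σ, rfl⟩).symm⟩

end UnorderedConfigurations

section SunProjection

variable {k : ℕ} {c : Fin k → ℝ} {Y : Type} {R : ↥(sunCover c) → Y}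

/-- The unordered configuration represented by a triple of points of `sunCover c`. -/
def confProj [TopologicalSpace Y] (hR : ∀ y y', R y = R y' ↔ DeckRel (y : ℝ × (Fin k → ℝ)) y')
    (w : ↥(sunConf c)) : UConf 3 Y :=
  Quot.mk _ ⟨fun s => R ⟨w.1 s, w.2.1 s⟩, fun s t h => w.2.2 s t ((hR _ _).1 h)⟩

variable [TopologicalSpace Y]

theorem continuous_confProj (hR : ∀ y y', R y = R y' ↔ DeckRel (y : ℝ × (Fin k → ℝ)) y')
    (hRc : Continuous R) : Continuous (confProj hR) := by
  refine continuous_quot_mk.comp (Continuous.subtype_mk (continuous_pi fun s => hRc.comp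
    (Continuous.subtype_mk ?_ _)) _)
  exact (continuous_apply s).comp continuous_subtype_val

theorem surjective_confProj (hR : ∀ y y', R y = R y' ↔ DeckRel (y : ℝ × (Fin k → ℝ)) y')
    (hRs : Function.Surjective R) : Function.Surjective (confProj hR) := by
  rintro ⟨f, hf⟩
  choose y hy using fun s => hRs (f s)
  refine ⟨⟨fun s => y s, fun s => (y s).2, fun s t h => ?_⟩,
    congrArg (Quot.mk _) (Subtype.ext (funext hy))⟩
  rw [← hR, hy, hy] at h
  exact hf h

theorem confProj_eq_iff (hR : ∀ y y', R y = R y' ↔ DeckRel (y : ℝ × (Fin k → ℝ)) y')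
    (w w' : ↥(sunConf c)) :
    confProj hR w = confProj hR w' ↔ ConfRel (w : Fin 3 → ℝ × (Fin k → ℝ)) w' := by
  refine (quot_mk_permRel_eq_iff (n := 3) (Y := Y)).trans ?_
  exact exists_congr fun σ => funext_iff.trans (forall_congr' fun s => hR _ _)

theorem isOpenMap_confProj (hR : ∀ y y', R y = R y' ↔ DeckRel (y : ℝ × (Fin k → ℝ)) y')
    (hRo : IsOpenMap R) : IsOpenMap (confProj hR) := by
  refine isOpenMap_quot_mk_permRel.comp (f := fun w : ↥(sunConf c) =>
    (⟨fun s => R ⟨w.1 s, w.2.1 s⟩, fun s t h => w.2.2 s t ((hR _ _).1 h)⟩ :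
      {f : Fin 3 → Y // Function.Injective f})) fun U hU => ?_
  obtain ⟨O, hO, rfl⟩ := isOpen_induced_iff.1 hU
  have hW : IsOpen {u : Fin 3 → ↥(sunCover c) | (fun s => (u s : ℝ × (Fin k → ℝ))) ∈ O} :=
    hO.preimage (by fun_prop)
  have hpi : IsOpenMap (Pi.map fun _ : Fin 3 => R) := IsOpenMap.piMap (fun _ => hRo) (by simp)
  convert (hpi _ hW).preimage continuous_subtype_val using 1
  ext ⟨f, hf⟩
  simp only [Set.mem_image, Set.mem_preimage, Subtype.exists, Set.mem_ofPred_eq]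
  constructor
  · rintro ⟨w, hw, hwO, e⟩
    exact ⟨fun s => ⟨w s, hw.1 s⟩, hwO, congrArg Subtype.val e⟩
  · rintro ⟨u, hu, e⟩
    refine ⟨fun s => u s, ⟨fun s => (u s).2, fun s t h => hf ?_⟩, hu, Subtype.ext e⟩
    rw [← e]
    exact (hR _ _).2 h

theorem isClosed_sunCover : IsClosed (sunCover c) := by
  have hZ : ∀ i, IsClosed {y : ℝ × (Fin k → ℝ) | ∃ n : ℤ, y.1 = c i + n} := by
    intro i
    convert Int.isClosedEmbedding_coe_real.isClosed_range.preimage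
      (f := fun y : ℝ × (Fin k → ℝ) => y.1 - c i) (by fun_prop) using 1
    ext y
    simp [eq_comm, sub_eq_iff_eq_add']
  have h0 : ∀ i, IsClosed {y : ℝ × (Fin k → ℝ) | y.2 i = 0} :=
    fun i => isClosed_eq (by fun_prop) continuous_const
  simp only [sunCover, ne_eq, ← or_iff_not_imp_left, Set.ofPred_and, Set.ofPred_forall,
    Set.ofPred_or]
  refine .inter (isClosed_iInter fun i => .inter (isClosed_le ?_ ?_) (isClosed_le ?_ ?_)) (.inter
    (isClosed_iInter fun i => (h0 i).union (hZ i))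
    (isClosed_iInter fun i => isClosed_iInter fun j =>
      (h0 i).union ((h0 j).union isClosed_const))) <;> fun_prop

theorem isOpenMap_of_deckRel [T2Space Y] (hRc : Continuous R) (hRs : Function.Surjective R)
    (hR : ∀ y y', R y = R y' ↔ DeckRel (y : ℝ × (Fin k → ℝ)) y') : IsOpenMap R := by
  let K : Set (ℝ × (Fin k → ℝ)) := Set.Icc (0, 0) (1, 1) ∩ sunCover c
  have hK : CompactSpace ↥K :=
    isCompact_iff_compactSpace.1 (isCompact_Icc.inter_right isClosed_sunCover)
  let Q : ↥K → Y := fun y => R ⟨y, y.2.2⟩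
  have hQc : Continuous Q := hRc.comp (by fun_prop)
  have hQs : Function.Surjective Q := by
    intro x
    obtain ⟨⟨y, hy⟩, rfl⟩ := hRs x
    have h : DeckRel y (Int.fract y.1, y.2) :=
      ⟨-⌊y.1⌋, by simp [Int.fract, sub_eq_add_neg], rfl⟩
    refine ⟨⟨(Int.fract y.1, y.2), ⟨⟨Int.fract_nonneg _, fun i => (hy.1 i).1⟩,
      (Int.fract_lt_one _).le, fun i => (hy.1 i).2⟩, h.mem_sunCover hy⟩, ?_⟩
    exact (hR _ _).2 h.symm
  have hQ : IsQuotientMap Q := hQc.isClosedMap.isQuotientMap hQc hQs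
  intro U hU
  obtain ⟨O, hO, rfl⟩ := isOpen_induced_iff.1 hU
  rw [← hQ.isOpen_preimage]
  convert isOpen_iUnion fun n : ℤ => hO.preimage
    (f := fun y : ↥K => ((y : ℝ × (Fin k → ℝ)).1 + n, (y : ℝ × (Fin k → ℝ)).2))
    (by fun_prop) using 1
  ext y
  simp only [Set.mem_preimage, Set.mem_image, Set.mem_iUnion, Subtype.exists]
  constructor
  · rintro ⟨x, hx, hxO, e⟩
    obtain ⟨n, h1, h2⟩ := ((hR _ _).1 e).symm
    refine ⟨n, ?_⟩
    have : x = ((y : ℝ × (Fin k → ℝ)).1 + n, (y : ℝ × (Fin k → ℝ)).2) := Prod.ext h1 h2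
    exact this ▸ hxO
  · rintro ⟨n, h⟩
    have hr : DeckRel (y : ℝ × (Fin k → ℝ))
      ((y : ℝ × (Fin k → ℝ)).1 + n, (y : ℝ × (Fin k → ℝ)).2) := ⟨n, rfl, rfl⟩
    exact ⟨_, hr.mem_sunCover y.2.2, h, (hR _ _).2 hr.symm⟩

theorem exists_isVertexGap (hc : ∀ i, c i ∈ Set.Ico (0 : ℝ) 1) : ∃ ε, IsVertexGap c ε := by
  have h : ∀ᶠ ε in 𝓝[>] (0 : ℝ), ∀ i j (n : ℤ), |c j + n - c i| < 2 * ε → c j = c i := by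
    refine Filter.eventually_all.2 fun i => Filter.eventually_all.2 fun j => ?_
    by_cases hij : c j = c i
    · exact .of_forall fun _ _ _ => hij
    obtain ⟨h1, h2⟩ := hc i
    obtain ⟨h3, h4⟩ := hc j
    have hlt : |c j - c i| < 1 := abs_lt.2 ⟨by linarith, by linarith⟩
    have hpos : 0 < min |c j - c i| (1 - |c j - c i|) / 2 :=
      half_pos (lt_min (abs_pos.2 (sub_ne_zero.2 hij)) (by linarith))
    filter_upwards [Ioo_mem_nhdsGT hpos] with ε hε n hn
    obtain ⟨h5, h6⟩ := lt_min_iff.1 ((lt_div_iff₀' two_pos).1 hε.2)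
    exfalso
    by_cases h0 : n = 0
    · rw [h0] at hn
      simp only [Int.cast_zero, add_zero] at hn
      linarith
    · have h7 : (1 : ℝ) ≤ |(n : ℝ)| := by exact_mod_cast Int.one_le_abs h0
      have h8 : |(n : ℝ)| ≤ |c j + n - c i| + |c j - c i| := by
        have := abs_sub (c j + n - c i) (c j - c i)
        rwa [show c j + n - c i - (c j - c i) = n by ring] at this
      linarith
  obtain ⟨ε, h1, h2⟩ := (h.and (Ioo_mem_nhdsGT (by norm_num : (0 : ℝ) < 1 / 2))).exists
  exact ⟨ε, h2.1, h2.2.le, h1⟩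

end SunProjection

section SunRealization

/-- The parametrization of the unit circle by fractions of a full turn. -/
noncomputable def circlePoint (a : ℝ) : ℝ × ℝ :=
  (Real.cos (2 * Real.pi * a), Real.sin (2 * Real.pi * a))

theorem circlePoint_mem (a : ℝ) : circlePoint a ∈ unitCircle :=
  Real.cos_sq_add_sin_sq _

theorem circlePoint_eq_iff {a b : ℝ} : circlePoint a = circlePoint b ↔ ∃ n : ℤ, b = a + n := by
  have h : circlePoint a = circlePoint b ↔
      ((2 * Real.pi * b : ℝ) : Real.Angle) = ((2 * Real.pi * a : ℝ) : Real.Angle) := by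
    simp only [circlePoint, Prod.mk.injEq]
    exact ⟨fun h => Real.Angle.cos_sin_inj h.1.symm h.2.symm, fun h =>
      ⟨(congrArg Real.Angle.cos h).symm, (congrArg Real.Angle.sin h).symm⟩⟩
  rw [h, Real.Angle.angle_eq_iff_two_pi_dvd_sub]
  refine exists_congr fun n => ?_
  rw [← mul_sub, mul_right_inj' Real.two_pi_pos.ne', sub_eq_iff_eq_add']

theorem exists_circlePoint_eq {x : ℝ × ℝ} (hx : x ∈ unitCircle) :
    ∃ a ∈ Set.Ico (0 : ℝ) 1, circlePoint a = x := by
  let z : ℂ := ⟨x.1, x.2⟩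
  have hz : ‖z‖ = 1 := by
    rw [← sq_eq_sq₀ (norm_nonneg _) zero_le_one, Complex.sq_norm, Complex.normSq_apply]
    simpa [z, sq, unitCircle] using hx
  have h : circlePoint (z.arg / (2 * Real.pi)) = x := by
    have h0 : 2 * Real.pi * (z.arg / (2 * Real.pi)) = z.arg :=
      mul_div_cancel₀ _ Real.two_pi_pos.ne'
    have h1 := Complex.norm_mul_cos_arg z
    have h2 := Complex.norm_mul_sin_arg z
    rw [hz, one_mul] at h1 h2
    rw [circlePoint, h0, h1, h2]
  refine ⟨Int.fract (z.arg / (2 * Real.pi)), ⟨Int.fract_nonneg _, Int.fract_lt_one _⟩, ?_⟩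
  rw [← h, circlePoint_eq_iff]
  exact ⟨_, (Int.fract_add_floor _).symm⟩

variable {k : ℕ} {c : Fin k → ℝ} {p q : Fin k → ℝ × ℝ} {y y' : ℝ × (Fin k → ℝ)}

/-- The point of the sun graph in the plane represented by a point of `sunCover c`. -/
noncomputable def sunPoint (p q : Fin k → ℝ × ℝ) (y : ℝ × (Fin k → ℝ)) : ℝ × ℝ :=
  circlePoint y.1 + ∑ i, y.2 i • (q i - p i)

theorem continuous_sunPoint : Continuous (sunPoint p q) := by
  unfold sunPoint circlePoint
  fun_prop

theorem sunPoint_eq_circlePoint (h : y.2 = 0) : sunPoint p q y = circlePoint y.1 := by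
  simp [sunPoint, h]

theorem sunPoint_eq_of_ne_zero (hpc : ∀ i, circlePoint (c i) = p i) (hy : y ∈ sunCover c)
    {i : Fin k} (hi : y.2 i ≠ 0) : sunPoint p q y = p i + y.2 i • (q i - p i) := by
  obtain ⟨n, hn⟩ := hy.2.1 i hi
  have h := hpc i
  rw [circlePoint_eq_iff.2 ⟨n, hn⟩] at h
  rw [sunPoint, h, Finset.sum_eq_single_of_mem i (by simp)]
  intro j _ hj
  rw [not_not.1 fun h => hj (hy.2.2 j i h hi), zero_smul]

theorem sunPoint_mem_segment (hpc : ∀ i, circlePoint (c i) = p i) (hy : y ∈ sunCover c)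
    {i : Fin k} (hi : y.2 i ≠ 0) : sunPoint p q y ∈ segment ℝ (p i) (q i) := by
  rw [sunPoint_eq_of_ne_zero hpc hy hi, segment_eq_image']
  exact ⟨y.2 i, hy.1 i, rfl⟩

theorem sunPoint_ne (hpc : ∀ i, circlePoint (c i) = p i) (hpq : ∀ i, q i ≠ p i)
    (hy : y ∈ sunCover c) {i : Fin k} (hi : y.2 i ≠ 0) : sunPoint p q y ≠ p i := by
  rw [sunPoint_eq_of_ne_zero hpc hy hi, Ne, add_eq_left, smul_eq_zero]
  exact not_or_intro hi (sub_ne_zero.2 (hpq i))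

theorem sunPoint_notMem_unitCircle (hpc : ∀ i, circlePoint (c i) = p i) (hpq : ∀ i, q i ≠ p i)
    (hseg : ∀ i, segment ℝ (p i) (q i) ∩ unitCircle = {p i})
    (hy : y ∈ sunCover c) {i : Fin k} (hi : y.2 i ≠ 0) : sunPoint p q y ∉ unitCircle := fun h =>
  sunPoint_ne hpc hpq hy hi ((hseg i).subset ⟨sunPoint_mem_segment hpc hy hi, h⟩)

theorem sunPoint_mem (hpc : ∀ i, circlePoint (c i) = p i) (hy : y ∈ sunCover c) :
    sunPoint p q y ∈ unitCircle ∪ ⋃ i, segment ℝ (p i) (q i) := by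
  by_cases h : y.2 = 0
  · rw [sunPoint_eq_circlePoint h]
    exact .inl (circlePoint_mem _)
  · obtain ⟨i, hi⟩ := Function.ne_iff.1 h
    exact .inr (Set.mem_iUnion.2 ⟨i, sunPoint_mem_segment hpc hy hi⟩)

theorem exists_sunPoint_eq (hpc : ∀ i, circlePoint (c i) = p i) {x : ℝ × ℝ}
    (hx : x ∈ unitCircle ∪ ⋃ i, segment ℝ (p i) (q i)) :
    ∃ y ∈ sunCover c, sunPoint p q y = x := by
  rcases hx with hx | hx
  · obtain ⟨a, -, rfl⟩ := exists_circlePoint_eq hx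
    exact ⟨(a, 0), mk_zero_mem_sunCover c a, sunPoint_eq_circlePoint rfl⟩
  · obtain ⟨i, hi⟩ := Set.mem_iUnion.1 hx
    rw [segment_eq_image'] at hi
    obtain ⟨t, ht, rfl⟩ := hi
    refine ⟨(c i, Pi.single i t), mk_single_mem_sunCover i ht.1 ht.2, ?_⟩
    rw [sunPoint, Finset.sum_eq_single_of_mem i (by simp)]
    · simp [hpc]
    · intro j _ hj
      simp [hj]

theorem sunPoint_eq_iff (hpc : ∀ i, circlePoint (c i) = p i) (hpq : ∀ i, q i ≠ p i)
    (hseg : ∀ i, segment ℝ (p i) (q i) ∩ unitCircle = {p i})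
    (hdisj : ∀ i j, i ≠ j →
      segment ℝ (p i) (q i) ∩ segment ℝ (p j) (q j) ⊆ ({p i} : Set (ℝ × ℝ)) ∩ {p j})
    (hy : y ∈ sunCover c) (hy' : y' ∈ sunCover c) :
    sunPoint p q y = sunPoint p q y' ↔ DeckRel y y' := by
  constructor
  · intro h
    by_cases h0 : y.2 = 0 <;> by_cases h0' : y'.2 = 0
    · rw [sunPoint_eq_circlePoint h0, sunPoint_eq_circlePoint h0', circlePoint_eq_iff] at h
      exact h.imp fun n hn => ⟨hn, h0'.trans h0.symm⟩
    · obtain ⟨i, hi⟩ := Function.ne_iff.1 h0'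
      refine absurd ?_ (sunPoint_notMem_unitCircle hpc hpq hseg hy' hi)
      rw [← h, sunPoint_eq_circlePoint h0]
      exact circlePoint_mem _
    · obtain ⟨i, hi⟩ := Function.ne_iff.1 h0
      refine absurd ?_ (sunPoint_notMem_unitCircle hpc hpq hseg hy hi)
      rw [h, sunPoint_eq_circlePoint h0']
      exact circlePoint_mem _
    · obtain ⟨i, hi⟩ := Function.ne_iff.1 h0
      obtain ⟨j, hj⟩ := Function.ne_iff.1 h0'
      have hij : i = j := by
        by_contra hij
        exact sunPoint_ne hpc hpq hy hi (hdisj i j hij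
          ⟨sunPoint_mem_segment hpc hy hi, h ▸ sunPoint_mem_segment hpc hy' hj⟩).1
      subst hij
      have ht : y.2 i = y'.2 i := by
        rw [sunPoint_eq_of_ne_zero hpc hy hi, sunPoint_eq_of_ne_zero hpc hy' hj] at h
        exact smul_left_injective ℝ (sub_ne_zero.2 (hpq i)) (add_left_cancel h)
      obtain ⟨n, hn⟩ := hy.2.1 i hi
      obtain ⟨m, hm⟩ := hy'.2.1 i hj
      refine ⟨m - n, by rw [hn, hm]; push_cast; ring, funext fun l => ?_⟩
      rcases eq_or_ne l i with rfl | hl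
      · exact ht.symm
      · rw [not_not.1 fun h => hl (hy.2.2 l i h hi), not_not.1 fun h => hl (hy'.2.2 l i h hj)]
  · rintro ⟨n, h1, h2⟩
    rw [sunPoint, sunPoint, h2, circlePoint_eq_iff.2 ⟨n, h1⟩]

theorem exists_fundamentalGroup_mulEquiv_freeGroup_of_ne (hp : ∀ i, p i ∈ unitCircle)
    (hpq : ∀ i, q i ≠ p i) (hseg : ∀ i, segment ℝ (p i) (q i) ∩ unitCircle = {p i})
    (hdisj : ∀ i j, i ≠ j →
      segment ℝ (p i) (q i) ∩ segment ℝ (p j) (q j) ⊆ ({p i} : Set (ℝ × ℝ)) ∩ {p j})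
    (x : UConf 3 ↥(unitCircle ∪ ⋃ i, segment ℝ (p i) (q i))) :
    ∃ n : ℕ, Nonempty (FundamentalGroup _ x ≃* FreeGroup (Fin n)) := by
  choose c hc hpc using fun i => exists_circlePoint_eq (hp i)
  obtain ⟨ε, hε⟩ := exists_isVertexGap hc
  let R : ↥(sunCover c) → ↥(unitCircle ∪ ⋃ i, segment ℝ (p i) (q i)) :=
    fun y => ⟨sunPoint p q y, sunPoint_mem hpc y.2⟩
  have hRc : Continuous R := (continuous_sunPoint.comp continuous_subtype_val).subtype_mk _
  have hRs : Function.Surjective R := by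
    rintro ⟨x, hx⟩
    obtain ⟨y, hy, h⟩ := exists_sunPoint_eq hpc hx
    exact ⟨⟨y, hy⟩, Subtype.ext h⟩
  have hR : ∀ y y', R y = R y' ↔ DeckRel (y : ℝ × (Fin k → ℝ)) y' := fun y y' =>
    Subtype.ext_iff.trans (sunPoint_eq_iff hpc hpq hseg hdisj y.2 y'.2)
  exact exists_fundamentalGroup_mulEquiv_freeGroup_of_sunConf hε (continuous_confProj hR hRc)
    (isOpenMap_confProj hR (isOpenMap_of_deckRel hRc hRs hR)) (surjective_confProj hR hRs)
    (confProj_eq_iff hR) x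

end SunRealization

end SunGraphs

/-- The 3-strand braid group of any sun graph realization `S ⊆ ℝ²` (the unit
circle with `k` segments attached, meeting the circle and each other only at
their attachment points) is a free group of finite rank. -/
theorem sun_graph_braid_group_free
    (k : ℕ) (p q : Fin k → ℝ × ℝ) (S : Set (ℝ × ℝ))
    (hS : S = unitCircle ∪ ⋃ i, segment ℝ (p i) (q i))
    (hp : ∀ i, p i ∈ unitCircle)
    (hseg : ∀ i, segment ℝ (p i) (q i) ∩ unitCircle = {p i})
    (hdisj : ∀ i j, i ≠ j →
      segment ℝ (p i) (q i) ∩ segment ℝ (p j) (q j) ⊆ ({p i} : Set (ℝ × ℝ)) ∩ {p j}) :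
    ∀ x : UConf 3 ↥S, ∃ n : ℕ,
      Nonempty (FundamentalGroup (UConf 3 ↥S) x ≃* FreeGroup (Fin n)) := by
  let e := Fintype.equivFin {i // q i ≠ p i}
  have hS' : S = unitCircle ∪ ⋃ j, segment ℝ (p (e.symm j)) (q (e.symm j)) := by
    rw [hS]
    apply subset_antisymm
    · refine Set.union_subset Set.subset_union_left (Set.iUnion_subset fun i => ?_)
      by_cases hi : q i = p i
      · rw [hi, segment_same, Set.singleton_subset_iff]
        exact .inl (hp i)
      · intro x hx
        exact .inr (Set.mem_iUnion.2 ⟨e ⟨i, hi⟩, by simpa using hx⟩)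
    · exact Set.union_subset_union_right _ (Set.iUnion_subset fun j =>
        Set.subset_iUnion (fun i => segment ℝ (p i) (q i)) _)
  subst hS'
  exact exists_fundamentalGroup_mulEquiv_freeGroup_of_ne (fun j => hp _) (fun j => (e.symm j).2)
    (fun j => hseg _) fun i j hij => hdisj _ _ fun h => hij (e.symm.injective (Subtype.ext h))
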